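/- There exist absolute constants C > 0 and c > 0 such that for every integer n ≥ 1 and every real x ≥ 1, if H is an n×n GUE random matrix with largest eigenvalue λ_max and smallest eigenvalue λ_min, then Prob{ e^{−1/x} < |λ_max|/|λ_min| < e^{1/x} } ≤ C·n^{2/3}/x + C·e^{−cn}. -/

import Mathlib

open MeasureTheory ProbabilityTheory Matrix

noncomputable instance matrixMeasurableSpace {m n α : Type*} [MeasurableSpace α] :
    MeasurableSpace (Matrix m n α) := MeasurableSpace.pi

/-- The standard complex Gaussian measure on `ℂ` (independent standard Gaussian
real and imaginary parts). -/
noncomputable def complexGaussian : Measure ℂ :=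
  ((gaussianReal 0 1).prod (gaussianReal 0 1)).map (fun p => Complex.mk p.1 p.2)

/-- The law of an `n × n` matrix with i.i.d. standard complex Gaussian entries. -/
noncomputable def matrixGaussian (n : ℕ) : Measure (Matrix (Fin n) (Fin n) ℂ) :=
  Measure.pi fun _ : Fin n => Measure.pi fun _ : Fin n => complexGaussian

/-- The Gaussian Unitary Ensemble: the law of `H = (G + G*)/2` for `G` complex Gaussian. -/
noncomputable def GUE (n : ℕ) : Measure (Matrix (Fin n) (Fin n) ℂ) :=
  (matrixGaussian n).map (fun G => (1 / 2 : ℂ) • (G + Gᴴ))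

/-- The eigenvalues of a Hermitian matrix, sorted in increasing order
(junk value `0` if the matrix is not Hermitian). -/
noncomputable def sortedEigs {n : ℕ} (H : Matrix (Fin n) (Fin n) ℂ) : Fin n → ℝ :=
  if h : H.IsHermitian then h.eigenvalues ∘ (Tuple.sort h.eigenvalues) else 0

/-- The eigenvalues of a Hermitian matrix, sorted by absolute value in decreasing order,
`|λ₁| ≥ |λ₂| ≥ … ≥ |λₙ|` (junk value `0` if the matrix is not Hermitian);
`absSortedEigs H j` is the eigenvalue of `(j+1)`-largest absolute value. -/
noncomputable def absSortedEigs {n : ℕ} (H : Matrix (Fin n) (Fin n) ℂ) : Fin n → ℝ :=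
  if h : H.IsHermitian then
    fun j => h.eigenvalues ((Tuple.sort fun i => |h.eigenvalues i|) j.rev)
  else 0

namespace GUEx
open MeasureTheory ProbabilityTheory Matrix
open scoped ComplexOrder

/-- square complex matrices -/
abbrev Mat (n : ℕ) := Matrix (Fin n) (Fin n) ℂ

/-- Hermitian part -/
noncomputable def herm {n : ℕ} (G : Mat n) : Mat n := (1 / 2 : ℂ) • (G + Gᴴ)

lemma herm_isHermitian {n : ℕ} (G : Mat n) : (herm G).IsHermitian := by
  unfold herm Matrix.IsHermitian
  rw [conjTranspose_smul, conjTranspose_add, conjTranspose_conjTranspose, add_comm]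
  congr 1
  simp

/-- the pencil t - M -/
noncomputable def pen {n : ℕ} (t : ℝ) (M : Mat n) : Mat n := (t : ℂ) • (1 : Mat n) - M

lemma pen_isHermitian {n : ℕ} (t : ℝ) {M : Mat n} (hM : M.IsHermitian) :
    (pen t M).IsHermitian := by
  unfold pen
  refine IsHermitian.sub ?_ hM
  unfold Matrix.IsHermitian
  rw [conjTranspose_smul]
  simp

lemma pen_posSemidef_iff {n : ℕ} (t : ℝ) {M : Mat n} (hM : M.IsHermitian) :
    (pen t M).PosSemidef ↔ ∀ i, hM.eigenvalues i ≤ t := by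
  have key : pen t M = (hM.eigenvectorUnitary : Mat n) *
      diagonal (fun i => ((t - hM.eigenvalues i : ℝ) : ℂ)) *
      star (hM.eigenvectorUnitary : Mat n) := by
    have h1 := hM.spectral_theorem
    rw [Unitary.conjStarAlgAut_apply] at h1
    have h2 : diagonal (fun i => ((t - hM.eigenvalues i : ℝ) : ℂ)) =
        (t : ℂ) • (1 : Mat n) - diagonal (RCLike.ofReal ∘ hM.eigenvalues) := by
      ext i j
      by_cases h : i = j
      · subst h; simp
      · simp [h]
    rw [h2, mul_sub, sub_mul, ← h1]
    simp [pen]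
  rw [key, Unitary.isUnit_coe.posSemidef_star_right_conjugate_iff, posSemidef_diagonal_iff]
  constructor
  · intro h i
    have := h i
    rw [Complex.zero_le_real] at this
    linarith
  · intro h i
    rw [Complex.zero_le_real]
    linarith [h i]

lemma pen_posDef_iff {n : ℕ} (t : ℝ) {M : Mat n} (hM : M.IsHermitian) :
    (pen t M).PosDef ↔ ∀ i, hM.eigenvalues i < t := by
  have key : pen t M = (hM.eigenvectorUnitary : Mat n) *
      diagonal (fun i => ((t - hM.eigenvalues i : ℝ) : ℂ)) *
      star (hM.eigenvectorUnitary : Mat n) := by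
    have h1 := hM.spectral_theorem
    rw [Unitary.conjStarAlgAut_apply] at h1
    have h2 : diagonal (fun i => ((t - hM.eigenvalues i : ℝ) : ℂ)) =
        (t : ℂ) • (1 : Mat n) - diagonal (RCLike.ofReal ∘ hM.eigenvalues) := by
      ext i j
      by_cases h : i = j
      · subst h; simp
      · simp [h]
    rw [h2, mul_sub, sub_mul, ← h1]
    simp [pen]
  rw [key, Unitary.isUnit_coe.posDef_star_right_conjugate_iff, posDef_diagonal_iff]
  constructor
  · intro h i
    have := h i
    rw [Complex.zero_lt_real] at this
    linarith
  · intro h i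
    rw [Complex.zero_lt_real]
    linarith [h i]

/-- top eigenvalue -/
noncomputable def tp {n : ℕ} (M : Mat n) : ℝ := sInf {t : ℝ | (pen t M).PosSemidef}

/-- bottom eigenvalue -/
noncomputable def bt {n : ℕ} (M : Mat n) : ℝ := -tp (-M)

lemma tp_exists {n : ℕ} {M : Mat (n + 1)} (hM : M.IsHermitian) :
    ∃ i, hM.eigenvalues i = tp M ∧ ∀ j, hM.eigenvalues j ≤ tp M := by
  obtain ⟨i, hi⟩ := Finite.exists_max hM.eigenvalues
  have : tp M = hM.eigenvalues i := by
    unfold tp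
    have : {t : ℝ | (pen t M).PosSemidef} = Set.Ici (hM.eigenvalues i) := by
      ext t
      simp only [Set.mem_setOf_eq, pen_posSemidef_iff t hM, Set.mem_Ici]
      exact ⟨fun h => h i, fun h j => (hi j).trans h⟩
    rw [this, csInf_Ici]
  exact ⟨i, this.symm, fun j => this ▸ hi j⟩

lemma tp_le_iff {n : ℕ} {M : Mat (n + 1)} (hM : M.IsHermitian) (t : ℝ) :
    tp M ≤ t ↔ (pen t M).PosSemidef := by
  obtain ⟨i, hi, hj⟩ := tp_exists hM
  rw [pen_posSemidef_iff t hM]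
  exact ⟨fun h j => (hj j).trans h, fun h => hi ▸ h i⟩

lemma tp_lt_iff {n : ℕ} {M : Mat (n + 1)} (hM : M.IsHermitian) (t : ℝ) :
    tp M < t ↔ (pen t M).PosDef := by
  obtain ⟨i, hi, hj⟩ := tp_exists hM
  rw [pen_posDef_iff t hM]
  exact ⟨fun h j => (hj j).trans_lt h, fun h => hi ▸ h i⟩

lemma tp_eq {n : ℕ} {M : Mat (n + 1)} (t : ℝ) (hM : M.IsHermitian)
    (h1 : (pen t M).PosSemidef) (h2 : ¬ (pen t M).PosDef) : tp M = t :=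
  le_antisymm ((tp_le_iff hM t).2 h1) (not_lt.1 fun h => h2 ((tp_lt_iff hM t).1 h))

lemma pen_neg {n : ℕ} (t : ℝ) (M : Mat n) : pen t (-M) = M - pen (-t) 0 := by
  unfold pen; simp; abel

lemma le_bt_iff {n : ℕ} {M : Mat (n + 1)} (hM : M.IsHermitian) (t : ℝ) :
    t ≤ bt M ↔ (M - (t : ℂ) • (1 : Mat (n + 1))).PosSemidef := by
  unfold bt
  rw [le_neg, tp_le_iff hM.neg]
  have : pen (-t) (-M) = M - (t : ℂ) • (1 : Mat (n + 1)) := by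
    unfold pen; simp; abel
  rw [this]

lemma bt_exists {n : ℕ} {M : Mat (n + 1)} (hM : M.IsHermitian) :
    ∃ i, hM.eigenvalues i = bt M ∧ ∀ j, bt M ≤ hM.eigenvalues j := by
  obtain ⟨i, hi⟩ := Finite.exists_min hM.eigenvalues
  have key : ∀ t, t ≤ bt M ↔ ∀ j, t ≤ hM.eigenvalues j := by
    intro t
    rw [le_bt_iff hM]
    have h0 : (M - (t : ℂ) • (1 : Mat (n + 1))) = (hM.eigenvectorUnitary : Mat (n+1)) *
      diagonal (fun i => ((hM.eigenvalues i - t : ℝ) : ℂ)) *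
      star (hM.eigenvectorUnitary : Mat (n+1)) := by
      have h1 := hM.spectral_theorem
      rw [Unitary.conjStarAlgAut_apply] at h1
      have h2 : diagonal (fun i => ((hM.eigenvalues i - t: ℝ) : ℂ)) =
          diagonal (RCLike.ofReal ∘ hM.eigenvalues) - (t : ℂ) • (1 : Mat (n+1)) := by
        ext i j
        by_cases h : i = j
        · subst h; simp
        · simp [h]
      rw [h2, mul_sub, sub_mul, ← h1]
      simp
    rw [h0, Unitary.isUnit_coe.posSemidef_star_right_conjugate_iff, posSemidef_diagonal_iff]
    constructor
    · intro h i
      have := h i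
      rw [Complex.zero_le_real] at this
      linarith
    · intro h i
      rw [Complex.zero_le_real]
      linarith [h i]
  have h3 := (key (bt M)).1 le_rfl
  exact ⟨i, le_antisymm ((key _).2 hi) (h3 i), h3⟩

lemma bt_le_tp {n : ℕ} {M : Mat (n + 1)} (hM : M.IsHermitian) : bt M ≤ tp M := by
  obtain ⟨i, hi, _⟩ := bt_exists hM
  obtain ⟨_, _, h⟩ := tp_exists hM
  exact hi ▸ h i

lemma sortedEigs_last {n : ℕ} {M : Mat (n + 1)} (hM : M.IsHermitian)
    (h : n < n + 1) : sortedEigs M ⟨n, h⟩ = tp M := by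
  obtain ⟨i, hi, hj⟩ := tp_exists hM
  have hmono := Tuple.monotone_sort hM.eigenvalues
  unfold sortedEigs
  rw [dif_pos hM]
  apply le_antisymm
  · exact hj _
  · rw [← hi]
    have := hmono (show (Tuple.sort hM.eigenvalues).symm i ≤ ⟨n, h⟩ from Fin.le_last _)
    simpa using this

lemma sortedEigs_zero {n : ℕ} {M : Mat (n + 1)} (hM : M.IsHermitian)
    (h : 0 < n + 1) : sortedEigs M ⟨0, h⟩ = bt M := by
  obtain ⟨i, hi, hj⟩ := bt_exists hM
  have hmono := Tuple.monotone_sort hM.eigenvalues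
  unfold sortedEigs
  rw [dif_pos hM]
  apply le_antisymm
  · rw [← hi]
    have := hmono (show ⟨0, h⟩ ≤ (Tuple.sort hM.eigenvalues).symm i from Fin.zero_le _)
    simpa using this
  · exact hj _

end GUEx

namespace GUEx
open MeasureTheory ProbabilityTheory Matrix
open scoped ComplexOrder

instance instBorelMat {n : ℕ} : BorelSpace (Mat n) :=
  inferInstanceAs (BorelSpace (Fin n → Fin n → ℂ))
instance instSCMat {n : ℕ} : SecondCountableTopology (Mat n) :=
  inferInstanceAs (SecondCountableTopology (Fin n → Fin n → ℂ))

instance instProbCG : IsProbabilityMeasure complexGaussian := by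
  unfold complexGaussian
  apply Measure.isProbabilityMeasure_map
  have : Measurable (fun p : ℝ × ℝ => Complex.mk p.1 p.2) :=
    Complex.measurableEquivRealProd.symm.measurable
  exact this.aemeasurable

instance instProbMG {n : ℕ} : IsProbabilityMeasure (matrixGaussian n) := by
  unfold matrixGaussian
  exact inferInstanceAs (IsProbabilityMeasure
    (Measure.pi fun _ : Fin n => Measure.pi fun _ : Fin n => complexGaussian))

lemma continuous_herm {n : ℕ} : Continuous (herm (n := n)) := by
  unfold herm
  fun_prop

lemma continuous_entry {n : ℕ} (i j : Fin n) : Continuous (fun G : Mat n => G i j) := by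
  fun_prop

lemma continuous_pen {n : ℕ} : Continuous (fun p : ℝ × Mat n => pen p.1 (herm p.2)) := by
  unfold pen
  have := continuous_herm (n := n)
  fun_prop

lemma isClosed_posSemidef_herm {n : ℕ} {X : Type*} [TopologicalSpace X] (f : X → Mat n)
    (hf : Continuous f) (hH : ∀ x, (f x).IsHermitian) : IsClosed {x | (f x).PosSemidef} := by
  have : {x | (f x).PosSemidef} = ⋂ v : Fin n → ℂ, {x | 0 ≤ (star v ⬝ᵥ (f x *ᵥ v)).re} := by
    ext x
    simp only [Set.mem_ofPred_eq, Set.mem_iInter]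
    constructor
    · intro h v
      exact h.re_dotProduct_nonneg v
    · intro h
      refine PosSemidef.of_dotProduct_mulVec_nonneg (hH x) fun v => ?_
      rw [Complex.le_def]
      refine ⟨h v, ?_⟩
      have := (hH x).im_star_dotProduct_mulVec_self v
      simpa using this.symm
  rw [this]
  refine isClosed_iInter fun v => isClosed_le continuous_const ?_
  exact Complex.continuous_re.comp (by fun_prop)

lemma measurable_tp_herm {n : ℕ} : Measurable (fun G : Mat (n + 1) => tp (herm G)) := by
  refine measurable_of_Iic fun t => ?_
  have : (fun G : Mat (n + 1) => tp (herm G)) ⁻¹' Set.Iic t =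
      {G | (pen t (herm G)).PosSemidef} := by
    ext G
    simp [tp_le_iff (herm_isHermitian G)]
  rw [this]
  refine (isClosed_posSemidef_herm (fun G => pen t (herm G)) ?_ ?_).measurableSet
  · exact continuous_pen.comp (continuous_const.prodMk continuous_id : Continuous fun G : Mat (n + 1) => (t, G))
  · exact fun G => pen_isHermitian t (herm_isHermitian G)

lemma herm_neg {n : ℕ} (G : Mat n) : herm (-G) = -herm G := by
  unfold herm
  simp only [conjTranspose_neg]
  rw [← neg_add, smul_neg]

lemma measurable_bt_herm {n : ℕ} : Measurable (fun G : Mat (n + 1) => bt (herm G)) := by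
  have : (fun G : Mat (n + 1) => bt (herm G)) = fun G => - tp (herm (-G)) := by
    ext G; rw [herm_neg]; rfl
  rw [this]
  exact (measurable_tp_herm.comp measurable_neg).neg

lemma herm_of_isHermitian {n : ℕ} {M : Mat n} (hM : M.IsHermitian) : herm M = M := by
  unfold herm
  rw [hM.eq]
  ext i j
  simp
  ring

/-- l1 norm of the entries -/
noncomputable def NG {n : ℕ} (G : Mat n) : ℝ := ∑ i, ∑ j, ‖G i j‖

lemma NG_nonneg {n : ℕ} (G : Mat n) : 0 ≤ NG G := by unfold NG; positivity

lemma continuous_NG {n : ℕ} : Continuous (NG (n := n)) := by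
  unfold NG
  fun_prop

lemma entry_le_NG {n : ℕ} (G : Mat n) (i j : Fin n) : ‖G i j‖ ≤ NG G := by
  unfold NG
  calc ‖G i j‖ ≤ ∑ j, ‖G i j‖ :=
        Finset.single_le_sum (f := fun j => ‖G i j‖) (fun _ _ => norm_nonneg _) (Finset.mem_univ j)
    _ ≤ _ := Finset.single_le_sum (f := fun i => ∑ j, ‖G i j‖)
        (fun _ _ => by positivity) (Finset.mem_univ i)

lemma NG_herm_le {n : ℕ} (G : Mat n) : NG (herm G) ≤ NG G := by
  have h : ∀ i j, ‖herm G i j‖ ≤ (‖G i j‖ + ‖G j i‖) / 2 := by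
    intro i j
    have : herm G i j = (1 / 2 : ℂ) * (G i j + star (G j i)) := by
      simp [herm]
    rw [this, norm_mul]
    have h2 := norm_add_le (G i j) (star (G j i))
    rw [norm_star] at h2
    norm_num
    norm_num at h2
    linarith
  calc NG (herm G) ≤ ∑ i, ∑ j, (‖G i j‖ + ‖G j i‖) / 2 :=
        Finset.sum_le_sum fun i _ => Finset.sum_le_sum fun j _ => h i j
    _ = (NG G + ∑ i, ∑ j, ‖G j i‖) / 2 := by
        simp only [← Finset.sum_div, Finset.sum_add_distrib, NG]
    _ = NG G := by
        rw [Finset.sum_comm (f := fun i j => ‖G j i‖)]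
        unfold NG; ring

lemma abs_eig_le {n : ℕ} {M : Mat n} (hM : M.IsHermitian) (i : Fin n) :
    |hM.eigenvalues i| ≤ NG M := by
  rw [hM.eigenvalues_eq]
  set v := (hM.eigenvectorBasis i) with hv
  have hv1 : ∀ j, ‖v j‖ ≤ 1 := by
    intro j
    have h1 : ‖v‖ = 1 := hM.eigenvectorBasis.norm_eq_one i
    exact h1 ▸ PiLp.norm_apply_le v j
  calc |RCLike.re (star (v.ofLp) ⬝ᵥ M *ᵥ v.ofLp)| ≤ ‖star (v.ofLp) ⬝ᵥ M *ᵥ v.ofLp‖ :=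
        Complex.abs_re_le_norm _
    _ ≤ ∑ k, ∑ l, ‖M k l‖ := by
        simp only [dotProduct, mulVec, Finset.mul_sum]
        refine (norm_sum_le _ _).trans (Finset.sum_le_sum fun k _ => ?_)
        refine (norm_sum_le _ _).trans (Finset.sum_le_sum fun l _ => ?_)
        rw [norm_mul, norm_mul, Pi.star_apply, norm_star]
        calc _ ≤ 1 * (‖M k l‖ * 1) := by gcongr <;> apply hv1
          _ = _ := by ring

lemma abs_tp_herm_le {n : ℕ} (G : Mat (n + 1)) : |tp (herm G)| ≤ NG G := by
  obtain ⟨i, hi, _⟩ := tp_exists (herm_isHermitian G)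
  rw [← hi]
  exact (abs_eig_le _ i).trans (NG_herm_le G)

lemma abs_bt_herm_le {n : ℕ} (G : Mat (n + 1)) : |bt (herm G)| ≤ NG G := by
  obtain ⟨i, hi, _⟩ := bt_exists (herm_isHermitian G)
  rw [← hi]
  exact (abs_eig_le _ i).trans (NG_herm_le G)

/-- polynomial growth relative to a gauge -/
def PG {α : Type*} (N : α → ℝ) (f : α → ℂ) : Prop :=
  ∃ (C : ℝ) (k : ℕ), 0 ≤ C ∧ ∀ x, ‖f x‖ ≤ C * (1 + N x) ^ k

section PGsec
variable {α : Type*} {N : α → ℝ}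

lemma PG.const (c : ℂ) : PG N (fun _ => c) := ⟨‖c‖, 0, norm_nonneg _, fun x => by simp⟩

lemma PG.mul {f g : α → ℂ} (hf : PG N f) (hg : PG N g) : PG N (fun x => f x * g x) := by
  obtain ⟨C, k, hC, h1⟩ := hf
  obtain ⟨D, l, hD, h2⟩ := hg
  refine ⟨C * D, k + l, by positivity, fun x => ?_⟩
  rw [norm_mul, pow_add]
  calc _ ≤ (C * (1 + N x) ^ k) * (D * (1 + N x) ^ l) :=
        mul_le_mul (h1 x) (h2 x) (norm_nonneg _) ((norm_nonneg _).trans (h1 x))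
    _ = _ := by ring

lemma PG.add (hN : ∀ x, 0 ≤ N x) {f g : α → ℂ} (hf : PG N f) (hg : PG N g) : PG N (fun x => f x + g x) := by
  obtain ⟨C, k, hC, h1⟩ := hf
  obtain ⟨D, l, hD, h2⟩ := hg
  refine ⟨C + D, k + l, by positivity, fun x => ?_⟩
  have h0 : 1 ≤ 1 + N x := by linarith [hN x]
  have e1 : (1 + N x) ^ k ≤ (1 + N x) ^ (k + l) := pow_le_pow_right₀ h0 (by omega)
  have e2 : (1 + N x) ^ l ≤ (1 + N x) ^ (k + l) := pow_le_pow_right₀ h0 (by omega)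
  calc _ ≤ ‖f x‖ + ‖g x‖ := norm_add_le _ _
    _ ≤ C * (1 + N x) ^ (k + l) + D * (1 + N x) ^ (k + l) :=
      add_le_add ((h1 x).trans (by gcongr)) ((h2 x).trans (by gcongr))
    _ = _ := by ring

lemma PG.neg {f : α → ℂ} (hf : PG N f) : PG N (fun x => - f x) := by
  obtain ⟨C, k, hC, h1⟩ := hf
  exact ⟨C, k, hC, fun x => by simpa using h1 x⟩

lemma PG.sub (hN : ∀ x, 0 ≤ N x) {f g : α → ℂ} (hf : PG N f) (hg : PG N g) : PG N (fun x => f x - g x) := by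
  simpa [sub_eq_add_neg] using PG.add hN hf hg.neg

lemma PG.sum (hN : ∀ x, 0 ≤ N x) {ι : Type*} (s : Finset ι) {f : ι → α → ℂ} (hf : ∀ i ∈ s, PG N (f i)) :
    PG N (fun x => ∑ i ∈ s, f i x) := by
  classical
  induction s using Finset.induction_on with
  | empty => simpa using PG.const (N := N) 0
  | insert a s ha ih =>
    simp only [Finset.sum_insert ha]
    exact PG.add hN (hf a (by simp)) (ih fun i hi => hf i (by simp [hi]))

lemma PG.prod {ι : Type*} (s : Finset ι) {f : ι → α → ℂ} (hf : ∀ i ∈ s, PG N (f i)) :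
    PG N (fun x => ∏ i ∈ s, f i x) := by
  classical
  induction s using Finset.induction_on with
  | empty => simpa using PG.const (N := N) 1
  | insert a s ha ih =>
    simp only [Finset.prod_insert ha]
    exact PG.mul (hf a (by simp)) (ih fun i hi => hf i (by simp [hi]))

lemma PG.mono {f g : α → ℂ} (hg : PG N g) (h : ∀ x, ‖f x‖ ≤ ‖g x‖) : PG N f := by
  obtain ⟨C, k, hC, h1⟩ := hg
  exact ⟨C, k, hC, fun x => (h x).trans (h1 x)⟩

lemma PG.of_le {f : α → ℂ} (h : ∀ x, ‖f x‖ ≤ 1 + N x) : PG N f :=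
  ⟨1, 1, zero_le_one, fun x => by simpa using h x⟩

lemma PG.comp {β : Type*} {f : α → ℂ} (hf : PG N f) (φ : β → α) : PG (N ∘ φ) (fun x => f (φ x)) := by
  obtain ⟨C, k, hC, h1⟩ := hf
  exact ⟨C, k, hC, fun x => h1 (φ x)⟩

/-- matrix valued version -/
def PGM {n : ℕ} (N : α → ℝ) (f : α → Mat n) : Prop := ∀ i j, PG N (fun x => f x i j)

lemma PGM.mul (hN : ∀ x, 0 ≤ N x) {n : ℕ} {f g : α → Mat n} (hf : PGM N f) (hg : PGM N g) :
    PGM N (fun x => f x * g x) := by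
  intro i j
  simp only [Matrix.mul_apply]
  exact PG.sum hN _ fun k _ => (hf i k).mul (hg k j)

lemma PGM.det (hN : ∀ x, 0 ≤ N x) {n : ℕ} {f : α → Mat n} (hf : PGM N f) : PG N (fun x => (f x).det) := by
  simp only [Matrix.det_apply']
  exact PG.sum hN _ fun σ _ => (PG.const _).mul (PG.prod _ fun i _ => hf _ _)

lemma PGM.trace (hN : ∀ x, 0 ≤ N x) {n : ℕ} {f : α → Mat n} (hf : PGM N f) : PG N (fun x => (f x).trace) := by
  simp only [Matrix.trace, Matrix.diag]
  exact PG.sum hN _ fun i _ => hf i i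

lemma PGM.adjugate (hN : ∀ x, 0 ≤ N x) {n : ℕ} {f : α → Mat n} (hf : PGM N f) : PGM N (fun x => (f x).adjugate) := by
  intro i j
  simp only [Matrix.adjugate_apply]
  apply PGM.det hN
  intro k l
  by_cases h : k = j
  · subst h
    simpa [Matrix.updateRow_apply] using PG.const (N := N) _
  · simpa [Matrix.updateRow_apply, h] using hf k l

lemma PGM.const {n : ℕ} (A : Mat n) : PGM N (fun _ => A) := fun i j => PG.const _

lemma PG.integrable [MeasurableSpace α] {μ : Measure α} {f : α → ℂ}
    (hI : ∀ k : ℕ, Integrable (fun x => (1 + N x) ^ k) μ)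
    (hf : PG N f) (hm : AEStronglyMeasurable f μ) : Integrable f μ := by
  obtain ⟨C, k, hC, h1⟩ := hf
  exact ((hI k).const_mul C).mono' hm (Filter.Eventually.of_forall h1)

end PGsec

lemma integrable_pow_of_memLp {α : Type*} [MeasurableSpace α] {μ : Measure α}
    [IsProbabilityMeasure μ] {f : α → ℝ}
    (hf : ∀ k : ℕ, MemLp f k μ) (k : ℕ) : Integrable (fun x => (1 + f x) ^ k) μ := by
  have h1 : MemLp (fun x => 1 + f x) k μ := by
    have a : MemLp (fun _ : α => (1 : ℝ)) k μ := memLp_const 1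
    exact a.add (hf k)
  rcases Nat.eq_zero_or_pos k with rfl | hk
  · simp
  have := h1.integrable_norm_pow (by omega)
  have hm : AEStronglyMeasurable (fun x => (1 + f x) ^ k) μ := by
    have b : AEStronglyMeasurable (fun x => 1 + f x) μ := h1.1
    exact b.pow k
  refine Integrable.mono' this hm (Filter.Eventually.of_forall fun x => ?_)
  simp

lemma memLp_norm_complexGaussian (k : ℕ) : MemLp (fun z : ℂ => ‖z‖) k complexGaussian := by
  unfold complexGaussian
  have hm : Measurable (fun p : ℝ × ℝ => Complex.mk p.1 p.2) :=
    Complex.measurableEquivRealProd.symm.measurable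
  rw [memLp_map_measure_iff (by fun_prop) hm.aemeasurable]
  have h1 : MemLp (fun p : ℝ × ℝ => p.1) k ((gaussianReal 0 1).prod (gaussianReal 0 1)) :=
    (memLp_id_gaussianReal (μ := 0) (v := 1) k).comp_fst _
  have h2 : MemLp (fun p : ℝ × ℝ => p.2) k ((gaussianReal 0 1).prod (gaussianReal 0 1)) :=
    (memLp_id_gaussianReal (μ := 0) (v := 1) k).comp_snd _
  refine (h1.norm.add h2.norm).mono ?_ (Filter.Eventually.of_forall fun p => ?_)
  · exact (measurable_norm.comp hm).aestronglyMeasurable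
  · simp only [Function.comp, norm_norm, Pi.add_apply]
    rw [Real.norm_of_nonneg (by positivity)]
    exact Complex.norm_le_abs_re_add_abs_im _

lemma memLp_NG {n : ℕ} (k : ℕ) : MemLp (NG (n := n)) k (matrixGaussian n) := by
  unfold NG
  refine memLp_finsetSum _ fun i _ => memLp_finsetSum _ fun j _ => ?_
  have h1 : MeasurePreserving (fun G : Mat n => G i j) (matrixGaussian n) complexGaussian := by
    have a := measurePreserving_eval
      (fun _ : Fin n => (Measure.pi fun _ : Fin n => complexGaussian)) i
    have b := measurePreserving_eval (fun _ : Fin n => complexGaussian) j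
    exact b.comp a
  exact (memLp_norm_complexGaussian k).comp_measurePreserving h1

/-- the gauge on pairs -/
noncomputable def N2 {n : ℕ} (p : ℝ × Mat n) : ℝ := |p.1| + NG p.2

lemma N2_nonneg {n : ℕ} (p : ℝ × Mat n) : 0 ≤ N2 p := by
  unfold N2; have := NG_nonneg p.2; positivity

lemma integrable_N2 {n : ℕ} (k : ℕ) : Integrable (fun p : ℝ × Mat n => (1 + N2 p) ^ k)
    ((gaussianReal 0 1).prod (matrixGaussian n)) := by
  refine integrable_pow_of_memLp (fun k => ?_) k
  have h1 : MemLp (fun p : ℝ × Mat n => p.1) k ((gaussianReal 0 1).prod (matrixGaussian n)) :=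
    (memLp_id_gaussianReal (μ := 0) (v := 1) k).comp_fst _
  have h2 : MemLp (fun p : ℝ × Mat n => NG p.2) k ((gaussianReal 0 1).prod (matrixGaussian n)) :=
    (memLp_NG k).comp_snd _
  exact h1.norm.add h2

lemma integrable_NG {n : ℕ} (k : ℕ) : Integrable (fun p : Mat n => (1 + NG p) ^ k)
    (matrixGaussian n) := integrable_pow_of_memLp (fun k => memLp_NG k) k

lemma PGM_pen {n : ℕ} : PGM (N2 (n := n)) (fun p => pen p.1 (herm p.2)) := by
  intro i j
  unfold pen
  simp only [Matrix.sub_apply, Matrix.smul_apply, smul_eq_mul]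
  refine PG.sub N2_nonneg (PG.mul (PG.of_le fun x => ?_) (PG.const _)) (PG.of_le fun x => ?_)
  · have := NG_nonneg x.2
    simp [N2]; linarith
  · have := (entry_le_NG (herm x.2) i j).trans (NG_herm_le x.2)
    have h2 := abs_nonneg x.1
    unfold N2; linarith

end GUEx

namespace GUEx
open MeasureTheory ProbabilityTheory Matrix
open scoped ComplexOrder Topology

lemma frontier_finite {I : Set ℝ} (hI : IsOpen I) (hc : I.OrdConnected) :
    (frontier I).Finite := by
  rcases I.eq_empty_or_nonempty with rfl | hne
  · simp
  refine (Set.toFinite {sSup I, sInf I}).subset fun x hx => ?_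
  have hxI : x ∉ I := by
    rw [hI.frontier_eq] at hx; exact hx.2
  have hxc : x ∈ closure I := frontier_subset_closure hx
  by_cases h : ∃ y ∈ I, y < x
  · obtain ⟨y, hy, hyx⟩ := h
    left
    have hub : x ∈ upperBounds I := by
      intro z hz
      by_contra hzx
      push Not at hzx
      exact hxI (hc.out hy hz ⟨hyx.le, hzx.le⟩)
    exact ((isLUB_of_mem_closure hub hxc).csSup_eq hne).symm
  · right
    push Not at h
    have hlb : x ∈ lowerBounds I := fun z hz => h z hz
    exact ((isGLB_of_mem_closure hlb hxc).csInf_eq hne).symm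

lemma core1 {I : Set ℝ} (hI : IsOpen I) (hc : I.OrdConnected) (g g' : ℝ → ℂ)
    (hg : Continuous g) (h0 : ∀ a ∈ frontier I, g a = 0)
    (hd : ∀ a ∈ I, HasDerivAt g (g' a) a)
    (hi : Integrable (I.indicator g)) (hi' : Integrable (I.indicator g')) :
    ∫ a, I.indicator g' a = 0 := by
  have hfin := frontier_finite hI hc
  have hcont : Continuous (I.indicator g) := continuous_indicator h0 hg.continuousOn
  have hder : ∀ a ∉ frontier I, HasDerivAt (I.indicator g) (I.indicator g' a) a := by
    intro a ha
    by_cases haI : a ∈ I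
    · rw [Set.indicator_of_mem haI]
      refine (hd a haI).congr_of_eventuallyEq ?_
      filter_upwards [hI.mem_nhds haI] with b hb
      rw [Set.indicator_of_mem hb]
    · rw [Set.indicator_of_notMem haI]
      have hcl : a ∉ closure I := by
        intro h; apply ha; rw [hI.frontier_eq]; exact ⟨h, haI⟩
      refine (hasDerivAt_const a (0 : ℂ)).congr_of_eventuallyEq ?_
      filter_upwards [isClosed_closure.isOpen_compl.mem_nhds hcl] with b hb
      rw [Set.indicator_of_notMem (fun h => hb (subset_closure h))]
  obtain ⟨U, hU⟩ := hfin.bddAbove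
  obtain ⟨L, hL⟩ := hfin.bddBelow
  have t1 : Filter.Tendsto (I.indicator g) Filter.atTop (𝓝 0) :=
    tendsto_zero_of_hasDerivAt_of_integrableOn_Ioi (a := U) (f' := I.indicator g')
      (fun x hx => hder x fun h => absurd (hU h) (not_le.mpr hx)) hi'.integrableOn hi.integrableOn
  have t2 : Filter.Tendsto (I.indicator g) Filter.atBot (𝓝 0) :=
    tendsto_zero_of_hasDerivAt_of_integrableOn_Iic (a := L - 1) (f' := I.indicator g')
      (fun x hx => hder x fun h => by
        have := hL h
        have h2 : x ≤ L - 1 := hx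
        linarith) hi'.integrableOn hi.integrableOn
  have t3 := intervalIntegral_tendsto_integral (a := fun x : ℝ => -x) (b := fun x => x)
    (l := Filter.atTop) hi' Filter.tendsto_neg_atTop_atBot Filter.tendsto_id
  have t4 : ∀ R : ℝ, ∫ x in -R..R, I.indicator g' x = I.indicator g R - I.indicator g (-R) := by
    intro R
    refine integral_eq_of_hasDerivAt_off_countable _ _ hfin.countable hcont.continuousOn ?_
      hi'.intervalIntegrable
    exact fun x hx => hder x hx.2
  simp only [t4] at t3
  have t5 : Filter.Tendsto (fun R => I.indicator g R - I.indicator g (-R)) Filter.atTop (𝓝 (0 - 0)) :=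
    t1.sub (t2.comp Filter.tendsto_neg_atTop_atBot)
  rw [sub_zero] at t5
  exact tendsto_nhds_unique t3 t5

lemma integrable_gauss_iff {f : ℝ → ℂ} :
    Integrable f (gaussianReal 0 1) ↔ Integrable (fun x => gaussianPDFReal 0 1 x • f x) := by
  rw [gaussianReal_of_var_ne_zero 0 one_ne_zero,
    integrable_withDensity_iff_integrable_smul' (measurable_gaussianPDF 0 1)
      (ae_of_all _ fun _ => gaussianPDF_lt_top)]
  simp

lemma hasDerivAt_pdf (a : ℝ) :
    HasDerivAt (gaussianPDFReal 0 1) (-a * gaussianPDFReal 0 1 a) a := by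
  unfold gaussianPDFReal
  have h : HasDerivAt (fun x : ℝ => -(x - 0) ^ 2 / (2 * ((1 : NNReal) : ℝ))) (-a) a := by
    have := ((hasDerivAt_pow 2 a).neg).div_const 2
    simp only [sub_zero, NNReal.coe_one, mul_one]
    refine this.congr_deriv ?_
    norm_num
    ring
  refine (h.exp.const_mul _).congr_deriv ?_
  ring

lemma continuous_pdf : Continuous (gaussianPDFReal 0 1) :=
  continuous_iff_continuousAt.mpr fun a => (hasDerivAt_pdf a).continuousAt

lemma ibp1 {I : Set ℝ} (hI : IsOpen I) (hc : I.OrdConnected) (f f' : ℝ → ℂ)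
    (hf : Continuous f) (h0 : ∀ a ∈ frontier I, f a = 0)
    (hd : ∀ a ∈ I, HasDerivAt f (f' a) a)
    (hi : Integrable (I.indicator f) (gaussianReal 0 1))
    (hi' : Integrable (I.indicator (fun a => f' a - a * f a)) (gaussianReal 0 1)) :
    ∫ a, I.indicator (fun a => f' a - a * f a) a ∂(gaussianReal 0 1) = 0 := by
  rw [integral_gaussianReal_eq_integral_smul one_ne_zero]
  rw [integrable_gauss_iff] at hi hi'
  set φ := gaussianPDFReal 0 1
  have e1 : ∀ h : ℝ → ℂ, (fun x => φ x • I.indicator h x) =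
      I.indicator (fun x => φ x • h x) := by
    intro h
    ext x
    by_cases hx : x ∈ I <;> simp [hx]
  rw [e1] at hi hi' ⊢
  refine core1 hI hc (fun x => φ x • f x) _ (continuous_pdf.smul hf) ?_ ?_ hi hi'
  · intro a ha; simp [h0 a ha]
  · intro a ha
    refine ((hasDerivAt_pdf a).smul (hd a ha)).congr_deriv ?_
    simp only [Complex.real_smul]
    push_cast
    ring
end GUEx

namespace GUEx
open MeasureTheory ProbabilityTheory Matrix
open scoped ComplexOrder Topology

lemma hasDerivAt_det {n : ℕ} (P K : Mat n) (hP : IsUnit P.det) :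
    HasDerivAt (fun a : ℝ => (P + (a : ℂ) • K).det) (trace (P.adjugate * K)) 0 := by
  have h1 : ∀ r : ℂ, (P + r • K).det = P.det * (1 + trace (P⁻¹ * K) * r +
      (det (1 + (Polynomial.X : Polynomial ℂ) • (P⁻¹ * K).map Polynomial.C)).divX.divX.eval r
        * r ^ 2) := by
    intro r
    rw [← det_one_add_smul, ← det_mul, mul_add, mul_one, Matrix.mul_smul,
      Matrix.mul_nonsing_inv_cancel_left _ _ hP]
  have h2 : HasDerivAt (fun r : ℂ => (P + r • K).det) (trace (P.adjugate * K)) 0 := by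
    simp only [h1]
    set q := (det (1 + (Polynomial.X : Polynomial ℂ) • (P⁻¹ * K).map Polynomial.C)).divX.divX
    have e1 : HasDerivAt (fun r : ℂ => trace (P⁻¹ * K) * r) (trace (P⁻¹ * K)) 0 := by
      simpa using (hasDerivAt_id (0 : ℂ)).const_mul (trace (P⁻¹ * K))
    have e2 := (q.hasDerivAt 0).mul (hasDerivAt_pow 2 (0 : ℂ))
    have e3 := ((e1.const_add 1).add e2).const_mul P.det
    refine e3.congr_deriv ?_
    simp only [Matrix.inv_def, Matrix.smul_mul, trace_smul, smul_eq_mul]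
    have : P.det * Ring.inverse P.det = 1 := Ring.mul_inverse_cancel _ hP
    simp only [ne_eq, OfNat.ofNat_ne_zero, not_false_eq_true, zero_pow, mul_zero,
      Nat.add_one_sub_one, pow_one, add_zero, ← mul_assoc, this, one_mul]
  have h3 := h2.comp_ofReal (z := (0 : ℝ))
  simpa using h3

lemma differentiable_adj {n : ℕ} (P K : Mat n) (i j : Fin n) :
    Differentiable ℝ (fun a : ℝ => (P + (a : ℂ) • K).adjugate i j) := by
  have hof : Differentiable ℝ (fun a : ℝ => (a : ℂ)) := Complex.ofRealCLM.differentiable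
  simp only [Matrix.adjugate_apply, Matrix.det_apply']
  refine Differentiable.fun_sum fun σ _ => ?_
  refine Differentiable.const_mul ?_ _
  refine Differentiable.fun_finsetProd fun k _ => ?_
  by_cases h : σ k = j
  · simp [Matrix.updateRow_apply, h]
  · simp only [Matrix.updateRow_apply, h, if_false, Matrix.add_apply, Matrix.smul_apply,
      smul_eq_mul]
    exact (hof.mul_const _).const_add _

lemma hasDerivAt_F {n : ℕ} (P K A : Mat n) (hP : IsUnit P.det) :
    HasDerivAt (fun a : ℝ => (P + (a : ℂ) • K).det * trace ((P + (a : ℂ) • K).adjugate * A))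
      (2 * trace (P.adjugate * K) * trace (P.adjugate * A)
        - trace (P.adjugate * K * P.adjugate * A)) 0 := by
  set J := P.adjugate with hJ
  set J' : Mat n := Matrix.of fun i j => deriv (fun a : ℝ => (P + (a : ℂ) • K).adjugate i j) 0
    with hJ'
  have hd : ∀ i j, HasDerivAt (fun a : ℝ => (P + (a : ℂ) • K).adjugate i j) (J' i j) 0 :=
    fun i j => (differentiable_adj P K i j 0).hasDerivAt
  have hof : HasDerivAt (fun a : ℝ => (a : ℂ)) 1 0 := Complex.ofRealCLM.hasDerivAt
  have hdP : ∀ i j, HasDerivAt (fun a : ℝ => (P + (a : ℂ) • K) i j) (K i j) 0 := by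
    intro i j
    simp only [Matrix.add_apply, Matrix.smul_apply, smul_eq_mul]
    refine ((hof.mul_const _).const_add _).congr_deriv (by ring)
  have hdet := hasDerivAt_det P K hP
  have key : J' * P + J * K = trace (J * K) • (1 : Mat n) := by
    ext i j
    have l : HasDerivAt (fun a : ℝ => ((P + (a : ℂ) • K).adjugate * (P + (a : ℂ) • K)) i j)
        ((J' * P + J * K) i j) 0 := by
      simp only [Matrix.mul_apply, Matrix.add_apply (J' * P)]
      rw [← Finset.sum_add_distrib]
      refine HasDerivAt.fun_sum fun k _ => ?_
      refine ((hd i k).mul (hdP k j)).congr_deriv ?_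
      simp [hJ]
    have r : HasDerivAt (fun a : ℝ => ((P + (a : ℂ) • K).adjugate * (P + (a : ℂ) • K)) i j)
        ((trace (J * K) • (1 : Mat n)) i j) 0 := by
      simp only [adjugate_mul, Matrix.smul_apply, smul_eq_mul]
      exact hdet.mul_const _
    exact l.unique r
  have key2 : P.det • J' = trace (J * K) • J - J * K * J := by
    have h : J' * P * J = (trace (J * K) • (1 : Mat n) - J * K) * J := by
      rw [← key]; simp
    rw [Matrix.mul_assoc, hJ, mul_adjugate] at h
    simpa [sub_mul] using h
  have htr : HasDerivAt (fun a : ℝ => trace ((P + (a : ℂ) • K).adjugate * A))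
      (trace (J' * A)) 0 := by
    simp only [trace, diag, Matrix.mul_apply]
    refine HasDerivAt.fun_sum fun i _ => HasDerivAt.fun_sum fun k _ => ?_
    exact (hd i k).mul_const _
  refine (hdet.mul htr).congr_deriv ?_
  have : P.det * trace (J' * A) = trace (J * K) * trace (J * A) - trace (J * K * J * A) := by
    have : P.det * trace (J' * A) = trace ((P.det • J') * A) := by simp
    rw [this, key2, sub_mul]
    simp
  simp only [Complex.ofReal_zero, zero_smul, add_zero]
  rw [this]
  ring

lemma tp_add_le {n : ℕ} {M K : Mat (n + 1)} (hM : M.IsHermitian) (hK : K.IsHermitian) :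
    tp (M + K) ≤ tp M + NG K := by
  rw [tp_le_iff (hM.add hK)]
  have h1 : (pen (tp M) M).PosSemidef := (tp_le_iff hM _).1 le_rfl
  have h2 : (pen (NG K) K).PosSemidef :=
    (pen_posSemidef_iff _ hK).2 fun i => (le_abs_self _).trans (abs_eig_le hK i)
  have h3 : pen (tp M + NG K) (M + K) = pen (tp M) M + pen (NG K) K := by
    unfold pen; push_cast; rw [add_smul]; abel
  rw [h3]; exact h1.add h2

lemma herm_add {n : ℕ} (G G' : Mat n) : herm (G + G') = herm G + herm G' := by
  unfold herm
  rw [conjTranspose_add, ← smul_add]; congr 1; abel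

lemma herm_smul {n : ℕ} (a : ℝ) (G : Mat n) : herm (a • G) = (a : ℂ) • herm G := by
  unfold herm
  rw [conjTranspose_smul]
  simp only [star_trivial]
  ext i j
  simp
  ring

lemma continuous_tp_herm {n : ℕ} : Continuous (fun G : Mat (n + 1) => tp (herm G)) := by
  have hlip : ∀ G G' : Mat (n + 1), tp (herm G) ≤ tp (herm G') + NG (G - G') := by
    intro G G'
    have h := tp_add_le (herm_isHermitian G') (herm_isHermitian (G - G'))
    rw [← herm_add, add_sub_cancel] at h
    exact h.trans (by gcongr; exact NG_herm_le _)
  rw [continuous_iff_continuousAt]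
  intro G
  have h1 : Filter.Tendsto (fun G' : Mat (n + 1) => tp (herm G) - NG (G - G')) (𝓝 G)
      (𝓝 (tp (herm G))) := by
    have : Continuous (fun G' : Mat (n + 1) => tp (herm G) - NG (G - G')) :=
      continuous_const.sub (continuous_NG.comp (continuous_const.sub continuous_id))
    have h := this.tendsto G
    simpa [NG] using h
  have h2 : Filter.Tendsto (fun G' : Mat (n + 1) => tp (herm G) + NG (G' - G)) (𝓝 G)
      (𝓝 (tp (herm G))) := by
    have : Continuous (fun G' : Mat (n + 1) => tp (herm G) + NG (G' - G)) :=
      continuous_const.add (continuous_NG.comp (continuous_id.sub continuous_const))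
    have h := this.tendsto G
    simpa [NG] using h
  refine tendsto_of_tendsto_of_tendsto_of_le_of_le h1 h2 (fun G' => ?_) (fun G' => ?_)
  · have := hlip G G'
    simp only; linarith
  · exact hlip G' G

/-- the domain `λ > top eigenvalue` -/
def DD (n : ℕ) : Set (ℝ × Mat (n + 1)) := {p | tp (herm p.2) < p.1}

lemma isOpen_DD {n : ℕ} : IsOpen (DD n) :=
  isOpen_lt (continuous_tp_herm.comp continuous_snd) continuous_fst

lemma mem_DD {n : ℕ} (p : ℝ × Mat (n + 1)) : p ∈ DD n ↔ (pen p.1 (herm p.2)).PosDef :=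
  tp_lt_iff (herm_isHermitian p.2) p.1

/-- pencil at a point -/
noncomputable def PP {n : ℕ} (p : ℝ × Mat n) : Mat n := pen p.1 (herm p.2)

lemma PP_add_smul {n : ℕ} (p V : ℝ × Mat n) (a : ℝ) : PP (p + a • V) = PP p + (a : ℂ) • PP V := by
  unfold PP pen
  simp only [Prod.fst_add, Prod.snd_add, Prod.smul_fst, Prod.smul_snd, herm_add, herm_smul]
  simp only [smul_eq_mul, Complex.ofReal_add, Complex.ofReal_mul, add_smul, smul_sub, mul_smul]
  abel

lemma PP_add {n : ℕ} (p V : ℝ × Mat n) : PP (p + V) = PP p + PP V := by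
  simpa using PP_add_smul p V 1

lemma PP_smul {n : ℕ} (p : ℝ × Mat n) (a : ℝ) : PP (a • p) = (a : ℂ) • PP p := by
  have := PP_add_smul 0 p a
  have h0 : PP (0 : ℝ × Mat n) = 0 := by simp [PP, pen, herm]
  simpa [h0] using this

lemma convex_DD {n : ℕ} : Convex ℝ (DD n) := by
  intro p hp q hq a b ha hb hab
  rw [mem_DD] at *
  change (PP _).PosDef
  rw [PP_add, PP_smul, PP_smul]
  change (PP p).PosDef at hp
  change (PP q).PosDef at hq
  rcases ha.eq_or_lt with rfl | ha
  · obtain rfl : b = 1 := by linarith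
    simpa using hq
  · refine PosDef.add_posSemidef (hp.smul (by exact_mod_cast ha)) ?_
    exact hq.posSemidef.smul (by exact_mod_cast hb)

lemma det_closure_DD {n : ℕ} (p : ℝ × Mat (n + 1)) (h1 : p ∈ closure (DD n)) (h2 : p ∉ DD n) :
    (PP p).det = 0 := by
  have h3 : tp (herm p.2) ≤ p.1 := by
    have : closure (DD n) ⊆ {p | tp (herm p.2) ≤ p.1} :=
      closure_minimal (fun q (hq : tp (herm q.2) < q.1) => show tp (herm q.2) ≤ q.1 from hq.le)
        (isClosed_le (continuous_tp_herm.comp continuous_snd) continuous_fst)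
    exact this h1
  rw [tp_le_iff (herm_isHermitian _)] at h3
  by_contra hne
  exact h2 ((mem_DD p).2 (h3.posDef_iff_det_ne_zero.2 hne))

lemma continuous_PP {n : ℕ} : Continuous (PP (n := n)) := continuous_pen

lemma ibpT {n : ℕ} {X : Type*} [MeasurableSpace X] (ν : Measure X) [SFinite ν]
    (T : ℝ × X → ℝ × Mat (n + 1)) (hT : MeasurePreserving T ((gaussianReal 0 1).prod ν)
      ((gaussianReal 0 1).prod (matrixGaussian (n + 1))))
    (V : ℝ × Mat (n + 1)) (hV : ∀ a b x, T (a, x) = T (b, x) + (a - b) • V)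
    (ℓ : ℝ × Mat (n + 1) → ℝ) (hℓ : ∀ a x, ℓ (T (a, x)) = a) (hℓc : Continuous ℓ)
    (hℓg : PG N2 (fun p => (ℓ p : ℂ)))
    (f f' : ℝ × Mat (n + 1) → ℂ) (hf : Continuous f) (hf' : Continuous f')
    (hfg : PG N2 f) (hfg' : PG N2 f') (h0 : ∀ p, (PP p).det = 0 → f p = 0)
    (hd : ∀ p ∈ DD n, HasDerivAt (fun a : ℝ => f (p + a • V)) (f' p) 0) :
    ∫ p in DD n, (f' p - ℓ p * f p) ∂((gaussianReal 0 1).prod (matrixGaussian (n + 1))) = 0 := by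
  have hDm : MeasurableSet (DD n) := isOpen_DD.measurableSet
  set g : ℝ × Mat (n + 1) → ℂ := fun p => f' p - ℓ p * f p with hg
  have hgc : Continuous g := hf'.sub ((Complex.continuous_ofReal.comp hℓc).mul hf)
  have hgg : PG N2 g := PG.sub N2_nonneg hfg' (hℓg.mul hfg)
  have hfi : Integrable ((DD n).indicator f) ((gaussianReal 0 1).prod (matrixGaussian (n + 1))) :=
    (hfg.integrable integrable_N2 hf.aestronglyMeasurable).indicator hDm
  have hgi : Integrable ((DD n).indicator g) ((gaussianReal 0 1).prod (matrixGaussian (n + 1))) :=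
    (hgg.integrable integrable_N2 hgc.aestronglyMeasurable).indicator hDm
  rw [← integral_indicator hDm, ← hT.map_eq,
    integral_map hT.measurable.aemeasurable (by rw [hT.map_eq]; exact hgi.1)]
  have hfi2 := hT.integrable_comp_of_integrable hfi
  have hgi2 := hT.integrable_comp_of_integrable hgi
  change ∫ z, ((DD n).indicator g ∘ T) z ∂_ = 0
  rw [integral_prod_symm _ hgi2]
  refine integral_eq_zero_of_ae ?_
  filter_upwards [hfi2.prod_left_ae, hgi2.prod_left_ae] with x h1 h2
  set I : Set ℝ := {a | T (a, x) ∈ DD n} with hI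
  have hTx : ∀ a, T (a, x) = T (0, x) + a • V := fun a => by simpa using hV a 0 x
  have hTc : Continuous (fun a => T (a, x)) := by
    have : (fun a => T (a, x)) = fun a => T (0, x) + a • V := funext hTx
    rw [this]; fun_prop
  have e : ∀ h : ℝ × Mat (n + 1) → ℂ, (fun a => ((DD n).indicator h ∘ T) (a, x)) =
      I.indicator (fun a => h (T (a, x))) := by
    intro h
    ext a
    by_cases ha : T (a, x) ∈ DD n
    · have ha' : a ∈ I := ha
      simp [ha, ha']
    · have ha' : a ∉ I := ha
      simp [ha, ha']
  rw [e] at h1 h2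
  rw [e]
  have hgx : (fun a => g (T (a, x))) = fun a : ℝ => f' (T (a, x)) - a * f (T (a, x)) := by
    ext a; simp [hg, hℓ]
  rw [hgx] at h2 ⊢
  refine ibp1 (isOpen_DD.preimage hTc) ?_ (fun a => f (T (a, x))) (fun a => f' (T (a, x)))
    (hf.comp hTc) ?_ ?_ h1 h2
  · have hcv : Convex ℝ I := by
      intro a ha b hb s t hs ht hst
      change T (_, x) ∈ DD n
      have : T (s • a + t • b, x) = s • T (a, x) + t • T (b, x) := by
        rw [hTx, hTx a, hTx b]
        have h1 : T (0, x) = s • T (0, x) + t • T (0, x) := by rw [← add_smul, hst, one_smul]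
        conv_lhs => rw [h1]
        simp only [smul_add, add_smul, smul_smul, smul_eq_mul]
        abel
      rw [this]
      exact convex_DD ha hb hs ht hst
    exact hcv.ordConnected
  · intro a ha
    have hIo : IsOpen I := isOpen_DD.preimage hTc
    change a ∈ frontier I at ha
    rw [hIo.frontier_eq] at ha
    refine h0 _ (det_closure_DD _ ?_ ha.2)
    exact hTc.closure_preimage_subset _ ha.1
  · intro a ha
    have h := hd _ ha
    have h2 : HasDerivAt (fun b : ℝ => f (T (a, x) + (b - a) • V)) (f' (T (a, x))) a := by
      have h3 := HasDerivAt.comp_sub_const a a (f := fun c => f (T (a, x) + c • V))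
        (f' := f' (T (a, x))) (by simpa using h)
      exact h3
    refine h2.congr_of_eventuallyEq (Filter.Eventually.of_forall fun b => ?_)
    simp only
    rw [hV b a x]
end GUEx

namespace GUEx
open MeasureTheory ProbabilityTheory Matrix
open scoped ComplexOrder Topology

lemma mp_update {ι : Type*} [Fintype ι] [DecidableEq ι] {β : Type*} [MeasurableSpace β]
    (μ : Measure β) [IsProbabilityMeasure μ] (i : ι) :
    MeasurePreserving (fun p : (ι → β) × β => Function.update p.1 i p.2)
      ((Measure.pi fun _ : ι => μ).prod μ) (Measure.pi fun _ : ι => μ) := by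
  have hm : Measurable (fun p : (ι → β) × β => Function.update p.1 i p.2) := by
    rw [measurable_pi_iff]
    intro k
    by_cases h : k = i
    · subst h; simpa using measurable_snd
    · simp only [Function.update_apply, h, if_false]
      exact (measurable_pi_apply k).comp measurable_fst
  refine ⟨hm, ?_⟩
  symm
  refine Measure.pi_eq fun s hs => ?_
  rw [Measure.map_apply hm (MeasurableSet.univ_pi hs)]
  have : (fun p : (ι → β) × β => Function.update p.1 i p.2) ⁻¹' Set.univ.pi s =
      (Set.univ.pi (Function.update s i Set.univ)) ×ˢ (s i) := by
    ext ⟨x, y⟩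
    simp only [Set.mem_preimage, Set.mem_univ_pi, Set.mem_prod]
    constructor
    · intro h
      refine ⟨fun k => ?_, by simpa using h i⟩
      by_cases hk : k = i
      · subst hk; simp
      · simpa [hk] using h k
    · rintro ⟨h1, h2⟩ k
      by_cases hk : k = i
      · subst hk; simpa using h2
      · simpa [hk] using h1 k
  rw [this, Measure.prod_prod, Measure.pi_pi]
  rw [← Finset.mul_prod_erase Finset.univ (fun k => μ (s k)) (Finset.mem_univ i),
    ← Finset.mul_prod_erase Finset.univ _ (Finset.mem_univ i)]
  simp only [Function.update_self, measure_univ, one_mul]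
  rw [mul_comm]
  congr 1
  refine Finset.prod_congr rfl fun k hk => ?_
  rw [Function.update_of_ne (Finset.ne_of_mem_erase hk)]

/-- replace one entry -/
def setEntry {n : ℕ} (i j : Fin n) (G : Mat n) (r : Fin n → ℂ) (z : ℂ) : Mat n :=
  Function.update (G : Fin n → Fin n → ℂ) i (Function.update r j z)

/-- auxiliary space -/
abbrev YY (n : ℕ) := ℝ × (Mat n × (Fin n → ℂ))

/-- auxiliary measure -/
noncomputable def muY (n : ℕ) : Measure (YY n) :=
  (gaussianReal 0 1).prod ((matrixGaussian n).prod (Measure.pi fun _ : Fin n => complexGaussian))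

instance {n : ℕ} : IsProbabilityMeasure (muY n) := by unfold muY; infer_instance

lemma mp_setEntry {n : ℕ} (i j : Fin n) :
    MeasurePreserving (fun p : YY n × ℂ => (p.1.1, setEntry i j p.1.2.1 p.1.2.2 p.2))
      ((muY n).prod complexGaussian) ((gaussianReal 0 1).prod (matrixGaussian n)) := by
  have h1 := mp_update (ι := Fin n) complexGaussian j
  have h2 : MeasurePreserving (fun p : (Fin n → Fin n → ℂ) × (Fin n → ℂ) => Function.update p.1 i p.2)
      ((matrixGaussian n).prod (Measure.pi fun _ : Fin n => complexGaussian)) (matrixGaussian n) :=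
    mp_update (ι := Fin n) (Measure.pi fun _ : Fin n => complexGaussian) i
  have h3 := h2.comp ((MeasurePreserving.id (matrixGaussian n)).prod h1)
  have h4 := (MeasurePreserving.id (gaussianReal 0 1)).prod h3
  have a1 := measurePreserving_prodAssoc (gaussianReal 0 1)
    ((matrixGaussian n).prod (Measure.pi fun _ : Fin n => complexGaussian)) complexGaussian
  have a2 := (MeasurePreserving.id (gaussianReal 0 1)).prod
    (measurePreserving_prodAssoc (matrixGaussian n)
      (Measure.pi fun _ : Fin n => complexGaussian) complexGaussian)
  exact h4.comp (a2.comp a1)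

lemma mp_cg : MeasurePreserving (fun p : ℝ × ℝ => Complex.mk p.1 p.2)
    ((gaussianReal 0 1).prod (gaussianReal 0 1)) complexGaussian :=
  ⟨Complex.measurableEquivRealProd.symm.measurable, rfl⟩

lemma mp_reorder {Y : Type*} [MeasurableSpace Y] (ν : Measure Y) [SFinite ν]
    (γ : Measure ℝ) [SFinite γ] :
    MeasurePreserving (fun p : ℝ × (Y × ℝ) => (p.2.1, (p.1, p.2.2)))
      (γ.prod (ν.prod γ)) (ν.prod (γ.prod γ)) := by
  have a1 : MeasurePreserving _ (γ.prod (ν.prod γ)) ((γ.prod ν).prod γ) :=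
    (measurePreserving_prodAssoc γ ν γ).symm MeasurableEquiv.prodAssoc
  have a2 : MeasurePreserving _ ((γ.prod ν).prod γ) ((ν.prod γ).prod γ) :=
    (Measure.measurePreserving_swap (μ := γ) (ν := ν)).prod (MeasurePreserving.id γ)
  have a3 := measurePreserving_prodAssoc ν γ γ
  exact a3.comp (a2.comp a1)

lemma mp_Tre {n : ℕ} (i j : Fin n) :
    MeasurePreserving (fun p : ℝ × (YY n × ℝ) =>
      (p.2.1.1, setEntry i j p.2.1.2.1 p.2.1.2.2 (Complex.mk p.1 p.2.2)))
      ((gaussianReal 0 1).prod ((muY n).prod (gaussianReal 0 1)))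
      ((gaussianReal 0 1).prod (matrixGaussian n)) := by
  exact (mp_setEntry i j).comp (((MeasurePreserving.id (muY n)).prod mp_cg).comp
    (mp_reorder (muY n) (gaussianReal 0 1)))

lemma mp_Tim {n : ℕ} (i j : Fin n) :
    MeasurePreserving (fun p : ℝ × (YY n × ℝ) =>
      (p.2.1.1, setEntry i j p.2.1.2.1 p.2.1.2.2 (Complex.mk p.2.2 p.1)))
      ((gaussianReal 0 1).prod ((muY n).prod (gaussianReal 0 1)))
      ((gaussianReal 0 1).prod (matrixGaussian n)) := by
  exact (mp_setEntry i j).comp (((MeasurePreserving.id (muY n)).prod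
    (mp_cg.comp Measure.measurePreserving_swap)).comp
    (mp_reorder (muY n) (gaussianReal 0 1)))

lemma setEntry_val {n : ℕ} (i j : Fin n) (G : Mat n) (r : Fin n → ℂ) (z : ℂ) (k l : Fin n) :
    setEntry i j G r z k l = if k = i then (if l = j then z else r l) else G k l := by
  change Function.update (fun a b => G a b) i (Function.update r j z) k l = _
  by_cases hk : k = i
  · subst hk
    by_cases hl : l = j
    · subst hl; simp
    · simp [hl]
  · simp [hk]

lemma setEntry_eq {n : ℕ} (i j : Fin n) (G : Mat n) (r : Fin n → ℂ) (z w : ℂ) :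
    setEntry i j G r z = setEntry i j G r w + Matrix.single i j (z - w) := by
  ext k l
  simp only [Matrix.add_apply, Matrix.single_apply, setEntry_val]
  by_cases hk : k = i
  · subst hk
    by_cases hl : l = j
    · subst hl; simp
    · have : ¬ (j = l) := fun h => hl h.symm
      simp [hl, this]
  · have : ¬ (i = k) := fun h => hk h.symm
    simp [hk, this]

lemma setEntry_apply {n : ℕ} (i j : Fin n) (G : Mat n) (r : Fin n → ℂ) (z : ℂ) :
    setEntry i j G r z i j = z := by
  simp [setEntry_val]

lemma PGM_PP {n : ℕ} : PGM (N2 (n := n)) PP := PGM_pen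

lemma PG_N2_fst {n : ℕ} : PG (N2 (n := n)) (fun p => (p.1 : ℂ)) := by
  refine PG.of_le fun x => ?_
  have := NG_nonneg x.2
  simp [N2]; linarith

lemma PG_N2_re {n : ℕ} (i j : Fin n) : PG (N2 (n := n)) (fun p => ((p.2 i j).re : ℂ)) := by
  refine PG.of_le fun x => ?_
  have := entry_le_NG x.2 i j
  have h2 := abs_nonneg x.1
  have h3 := Complex.abs_re_le_norm (x.2 i j)
  simp [N2]; linarith

lemma PG_N2_im {n : ℕ} (i j : Fin n) : PG (N2 (n := n)) (fun p => ((p.2 i j).im : ℂ)) := by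
  refine PG.of_le fun x => ?_
  have := entry_le_NG x.2 i j
  have h2 := abs_nonneg x.1
  have h3 := Complex.abs_im_le_norm (x.2 i j)
  simp [N2]; linarith

/-- the product Gaussian measure -/
noncomputable abbrev GG (n : ℕ) : Measure (ℝ × Mat n) :=
  (gaussianReal 0 1).prod (matrixGaussian n)

lemma continuous_adjPP {n : ℕ} : Continuous (fun p : ℝ × Mat n => (PP p).adjugate) :=
  continuous_PP.matrix_adjugate

lemma PGM_adjPP {n : ℕ} : PGM (N2 (n := n)) (fun p => (PP p).adjugate) :=
  PGM.adjugate N2_nonneg PGM_PP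

lemma PG_trJ {n : ℕ} (A : Mat n) : PG (N2 (n := n)) (fun p => trace ((PP p).adjugate * A)) :=
  PGM.trace N2_nonneg (PGM.mul N2_nonneg PGM_adjPP (PGM.const A))

lemma PG_d {n : ℕ} : PG (N2 (n := n)) (fun p => (PP p).det) :=
  PGM.det N2_nonneg PGM_PP

lemma PG_trJJ {n : ℕ} (A B : Mat n) :
    PG (N2 (n := n)) (fun p => trace ((PP p).adjugate * A * (PP p).adjugate * B)) :=
  PGM.trace N2_nonneg (PGM.mul N2_nonneg (PGM.mul N2_nonneg (PGM.mul N2_nonneg PGM_adjPP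
    (PGM.const A)) PGM_adjPP) (PGM.const B))

lemma cont_trJ {n : ℕ} (A : Mat n) : Continuous (fun p : ℝ × Mat n => trace ((PP p).adjugate * A)) :=
  (continuous_adjPP.mul continuous_const).matrix_trace

lemma cont_d {n : ℕ} : Continuous (fun p : ℝ × Mat n => (PP p).det) :=
  continuous_PP.matrix_det

lemma cont_trJJ {n : ℕ} (A B : Mat n) :
    Continuous (fun p : ℝ × Mat n => trace ((PP p).adjugate * A * (PP p).adjugate * B)) :=
  (((continuous_adjPP.mul continuous_const).mul continuous_adjPP).mul
    continuous_const).matrix_trace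

lemma isUnit_DD {n : ℕ} {p : ℝ × Mat (n + 1)} (hp : p ∈ DD n) : IsUnit (PP p).det := by
  rw [mem_DD] at hp
  exact isUnit_iff_ne_zero.2 hp.det_pos.ne'

lemma ibpV {n : ℕ} {X : Type*} [MeasurableSpace X] (ν : Measure X) [SFinite ν]
    (T : ℝ × X → ℝ × Mat (n + 1)) (hT : MeasurePreserving T ((gaussianReal 0 1).prod ν)
      (GG (n + 1)))
    (V : ℝ × Mat (n + 1)) (hV : ∀ a b x, T (a, x) = T (b, x) + (a - b) • V)
    (ℓ : ℝ × Mat (n + 1) → ℝ) (hℓ : ∀ a x, ℓ (T (a, x)) = a) (hℓc : Continuous ℓ)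
    (hℓg : PG N2 (fun p => (ℓ p : ℂ))) (A : Mat (n + 1)) :
    ∫ p in DD n, ((2 * trace ((PP p).adjugate * PP V) * trace ((PP p).adjugate * A)
        - trace ((PP p).adjugate * PP V * (PP p).adjugate * A)) -
        ℓ p * ((PP p).det * trace ((PP p).adjugate * A))) ∂(GG (n + 1)) = 0 := by
  refine ibpT ν T hT V hV ℓ hℓ hℓc hℓg (fun p => (PP p).det * trace ((PP p).adjugate * A))
    (fun p => 2 * trace ((PP p).adjugate * PP V) * trace ((PP p).adjugate * A)
        - trace ((PP p).adjugate * PP V * (PP p).adjugate * A)) ?_ ?_ ?_ ?_ ?_ ?_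
  · exact cont_d.mul (cont_trJ A)
  · exact ((continuous_const.mul (cont_trJ _)).mul (cont_trJ _)).sub (cont_trJJ _ _)
  · exact PG_d.mul (PG_trJ A)
  · exact PG.sub N2_nonneg (((PG.const 2).mul (PG_trJ _)).mul (PG_trJ _)) (PG_trJJ _ _)
  · intro p hp; simp [hp]
  · intro p hp
    simp only [PP_add_smul]
    exact hasDerivAt_F _ _ _ (isUnit_DD hp)

lemma PP_single {n : ℕ} (i j : Fin n) (c : ℂ) :
    PP ((0 : ℝ), Matrix.single i j c) = - herm (Matrix.single i j c) := by
  simp [PP, pen]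

lemma ibp_re {n : ℕ} (i j : Fin (n + 1)) :
    ∫ p in DD n, ((2 * trace ((PP p).adjugate * PP (0, Matrix.single i j 1)) *
        trace ((PP p).adjugate * herm (Matrix.single i j 1))
        - trace ((PP p).adjugate * PP (0, Matrix.single i j 1) * (PP p).adjugate
          * herm (Matrix.single i j 1))) -
        (p.2 i j).re * ((PP p).det * trace ((PP p).adjugate * herm (Matrix.single i j 1))))
        ∂(GG (n + 1)) = 0 := by
  refine ibpV _ _ (mp_Tre i j) (0, Matrix.single i j 1) ?_ (fun p => (p.2 i j).re) ?_ ?_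
    (PG_N2_re i j) _
  · intro a b x
    refine Prod.ext (by simp) ?_
    simp only [Prod.snd_add, Prod.smul_snd]
    rw [setEntry_eq i j _ _ (Complex.mk a x.2) (Complex.mk b x.2)]
    congr 1
    rw [Matrix.smul_single]
    congr 1
    apply Complex.ext <;> simp
  · intro a x
    simp [setEntry_apply]
  · exact Complex.continuous_re.comp ((continuous_entry i j).comp continuous_snd)

lemma ibp_im {n : ℕ} (i j : Fin (n + 1)) :
    ∫ p in DD n, ((2 * trace ((PP p).adjugate * PP (0, Matrix.single i j Complex.I)) *
        trace ((PP p).adjugate * herm (Matrix.single i j Complex.I))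
        - trace ((PP p).adjugate * PP (0, Matrix.single i j Complex.I) * (PP p).adjugate
          * herm (Matrix.single i j Complex.I))) -
        (p.2 i j).im * ((PP p).det * trace ((PP p).adjugate * herm (Matrix.single i j Complex.I))))
        ∂(GG (n + 1)) = 0 := by
  refine ibpV _ _ (mp_Tim i j) (0, Matrix.single i j Complex.I) ?_ (fun p => (p.2 i j).im) ?_ ?_
    (PG_N2_im i j) _
  · intro a b x
    refine Prod.ext (by simp) ?_
    simp only [Prod.snd_add, Prod.smul_snd]
    rw [setEntry_eq i j _ _ (Complex.mk x.2 a) (Complex.mk x.2 b)]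
    congr 1
    rw [Matrix.smul_single]
    congr 1
    apply Complex.ext <;> simp
  · intro a x
    simp [setEntry_apply]
  · exact Complex.continuous_im.comp ((continuous_entry i j).comp continuous_snd)

lemma herm_single_apply {n : ℕ} (i j k l : Fin n) (c : ℂ) :
    herm (Matrix.single i j c) k l =
      (1 / 2) * ((if i = k ∧ j = l then c else 0) + (if i = l ∧ j = k then star c else 0)) := by
  simp only [herm, Matrix.smul_apply, Matrix.add_apply, conjTranspose_apply, Matrix.single_apply,
    smul_eq_mul]
  congr 2
  split_ifs <;> simp

lemma herm_single {n : ℕ} (i j : Fin n) (c : ℂ) :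
    herm (Matrix.single i j c) = (1 / 2 : ℂ) • (Matrix.single i j c + Matrix.single j i (star c)) := by
  unfold herm
  rw [conjTranspose_single]

lemma tr_single {n : ℕ} (J : Mat n) (i j : Fin n) (c : ℂ) :
    trace (J * Matrix.single i j c) = J j i * c := by
  rw [trace_mul_single]; simp [mul_comm]

lemma tr_single2 {n : ℕ} (J : Mat n) (i j k l : Fin n) (c : ℂ) :
    (J * Matrix.single i j c * J) k l = J k i * c * J j l := by
  rw [Matrix.mul_apply, Finset.sum_eq_single j]
  · simp
  · intro b _ hb
    rw [Matrix.mul_single_apply_of_ne _ _ _ _ _ hb, zero_mul]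
  · simp

lemma tr_pair {n : ℕ} (J : Mat n) (i j : Fin n) (a b : ℝ) (d : ℂ) :
    ((2 * trace (J * PP (0, Matrix.single i j 1)) *
        trace (J * herm (Matrix.single i j 1))
        - trace (J * PP (0, Matrix.single i j 1) * J
          * herm (Matrix.single i j 1))) - a * (d * trace (J * herm (Matrix.single i j 1)))) +
    ((2 * trace (J * PP (0, Matrix.single i j Complex.I)) *
        trace (J * herm (Matrix.single i j Complex.I))
        - trace (J * PP (0, Matrix.single i j Complex.I) * J
          * herm (Matrix.single i j Complex.I))) -
          b * (d * trace (J * herm (Matrix.single i j Complex.I)))) =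
    -2 * (J i j * J j i) + J i i * J j j - d * (1 / 2) * (J j i * (a + b * Complex.I) +
      J i j * (a - b * Complex.I)) := by
  rw [PP_single, PP_single, herm_single, herm_single]
  simp only [Matrix.mul_neg, Matrix.neg_mul, trace_neg, Matrix.mul_smul, Matrix.smul_mul,
    trace_smul, smul_eq_mul, Matrix.mul_add, Matrix.add_mul, trace_add, tr_single, tr_single2]
  simp only [star_one, mul_one, Complex.star_def, Complex.conj_I]
  ring_nf
  simp only [Complex.I_sq]
  ring

end GUEx

namespace GUEx
open MeasureTheory ProbabilityTheory Matrix
open scoped ComplexOrder Topology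

lemma integrable_PG {n : ℕ} {f : ℝ × Mat n → ℂ} (hc : Continuous f) (hg : PG N2 f) :
    Integrable f (GG n) := hg.integrable integrable_N2 hc.aestronglyMeasurable

lemma trace_J_herm {n : ℕ} (p : ℝ × Mat n) :
    trace ((PP p).adjugate * herm p.2) = p.1 * trace (PP p).adjugate - n * (PP p).det := by
  have h1 : herm p.2 = (p.1 : ℂ) • (1 : Mat n) - PP p := by simp [PP, pen]
  rw [h1, mul_sub, adjugate_mul]
  simp [mul_comm]

lemma sum_pair {n : ℕ} (p : ℝ × Mat n) (J : Mat n) (d : ℂ) :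
    ∑ i, ∑ j, (-2 * (J i j * J j i) + J i i * J j j - d * (1 / 2) *
      (J j i * ((p.2 i j).re + (p.2 i j).im * Complex.I) +
      J i j * ((p.2 i j).re - (p.2 i j).im * Complex.I))) =
    -2 * trace (J * J) + trace J * trace J - d * trace (J * herm p.2) := by
  have e1 : ∑ i, ∑ j, J i j * J j i = trace (J * J) := by
    simp [trace, Matrix.mul_apply]
  have e2 : ∑ i, ∑ j, J i i * J j j = trace J * trace J := by
    simp only [trace, diag, Finset.sum_mul_sum]
  have e3 : ∑ i, ∑ j, (J j i * ((p.2 i j).re + (p.2 i j).im * Complex.I) +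
      J i j * ((p.2 i j).re - (p.2 i j).im * Complex.I)) = 2 * trace (J * herm p.2) := by
    have h1 : ∀ z : ℂ, (z.re : ℂ) + z.im * Complex.I = z := Complex.re_add_im
    have h2 : ∀ z : ℂ, (z.re : ℂ) - z.im * Complex.I = star z := fun z => by
      apply Complex.ext <;> simp
    simp only [h1, h2, Finset.sum_add_distrib]
    have a1 : ∑ i, ∑ j, J j i * p.2 i j = trace (J * p.2) := by
      rw [Finset.sum_comm]
      simp [trace, Matrix.mul_apply]
    have a2 : ∑ i, ∑ j, J i j * star (p.2 i j) = trace (J * p.2ᴴ) := by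
      simp [trace, Matrix.mul_apply]
    rw [a1, a2]
    simp [herm, Matrix.mul_add]
    ring
  simp only [Finset.sum_sub_distrib, Finset.sum_add_distrib, ← Finset.mul_sum] at *
  rw [e1, e2, e3]
  ring

lemma lin3 {α : Type*} [MeasurableSpace α] {μ : Measure α} {f g h : α → ℂ} (a b c : ℂ)
    (hf : Integrable f μ) (hg : Integrable g μ) (hh : Integrable h μ) (hf0 : ∫ x, f x ∂μ = 0)
    (hg0 : ∫ x, g x ∂μ = 0) (hh0 : ∫ x, h x ∂μ = 0) :
    ∫ x, (a * f x + (b * g x + c * h x)) ∂μ = 0 := by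
  have h1 : Integrable (fun x => b * g x + c * h x) μ := (hg.const_mul b).add (hh.const_mul c)
  rw [integral_add (hf.const_mul a) h1, integral_add (hg.const_mul b) (hh.const_mul c)]
  simp only [integral_const_mul, hf0, hg0, hh0]
  simp

lemma sum2 {α : Type*} [MeasurableSpace α] {μ : Measure α} {n : ℕ} {f g : Fin n → Fin n → α → ℂ}
    (hf : ∀ i j, Integrable (f i j) μ) (hg : ∀ i j, Integrable (g i j) μ)
    (hf0 : ∀ i j, ∫ x, f i j x ∂μ = 0) (hg0 : ∀ i j, ∫ x, g i j x ∂μ = 0) :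
    ∫ x, (∑ i, ∑ j, (f i j x + g i j x)) ∂μ = 0 := by
  have h1 : ∀ i j, Integrable (fun x => f i j x + g i j x) μ := fun i j => (hf i j).add (hg i j)
  rw [integral_finsetSum _ fun i _ => integrable_finsetSum _ fun j _ => h1 i j]
  refine Finset.sum_eq_zero fun i _ => ?_
  rw [integral_finsetSum _ fun j _ => h1 i j]
  refine Finset.sum_eq_zero fun j _ => ?_
  rw [integral_add (hf i j) (hg i j), hf0, hg0, add_zero]

lemma ident3 {n : ℕ} :
    ∫ p in DD n, (-2 * trace ((PP p).adjugate * (PP p).adjugate) +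
      trace (PP p).adjugate * trace (PP p).adjugate - (PP p).det *
      (p.1 * trace (PP p).adjugate - (n + 1 : ℕ) * (PP p).det)) ∂(GG (n + 1)) = 0 := by
  have hre : ∀ i j : Fin (n + 1), Integrable (fun p : ℝ × Mat (n + 1) =>
      ((2 * trace ((PP p).adjugate * PP (0, Matrix.single i j 1)) *
        trace ((PP p).adjugate * herm (Matrix.single i j 1))
        - trace ((PP p).adjugate * PP (0, Matrix.single i j 1) * (PP p).adjugate
          * herm (Matrix.single i j 1))) -
        (p.2 i j).re * ((PP p).det * trace ((PP p).adjugate * herm (Matrix.single i j 1)))))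
        ((GG (n + 1)).restrict (DD n)) := by
    intro i j
    refine (integrable_PG ?_ ?_).restrict
    · exact (((continuous_const.mul (cont_trJ _)).mul (cont_trJ _)).sub (cont_trJJ _ _)).sub
        ((Complex.continuous_ofReal.comp (Complex.continuous_re.comp
          ((continuous_entry i j).comp continuous_snd))).mul (cont_d.mul (cont_trJ _)))
    · exact PG.sub N2_nonneg (PG.sub N2_nonneg (((PG.const 2).mul (PG_trJ _)).mul (PG_trJ _))
        (PG_trJJ _ _)) ((PG_N2_re i j).mul (PG_d.mul (PG_trJ _)))
  have him : ∀ i j : Fin (n + 1), Integrable (fun p : ℝ × Mat (n + 1) =>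
      ((2 * trace ((PP p).adjugate * PP (0, Matrix.single i j Complex.I)) *
        trace ((PP p).adjugate * herm (Matrix.single i j Complex.I))
        - trace ((PP p).adjugate * PP (0, Matrix.single i j Complex.I) * (PP p).adjugate
          * herm (Matrix.single i j Complex.I))) -
        (p.2 i j).im * ((PP p).det * trace ((PP p).adjugate * herm (Matrix.single i j Complex.I)))))
        ((GG (n + 1)).restrict (DD n)) := by
    intro i j
    refine (integrable_PG ?_ ?_).restrict
    · exact (((continuous_const.mul (cont_trJ _)).mul (cont_trJ _)).sub (cont_trJJ _ _)).sub
        ((Complex.continuous_ofReal.comp (Complex.continuous_im.comp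
          ((continuous_entry i j).comp continuous_snd))).mul (cont_d.mul (cont_trJ _)))
    · exact PG.sub N2_nonneg (PG.sub N2_nonneg (((PG.const 2).mul (PG_trJ _)).mul (PG_trJ _))
        (PG_trJJ _ _)) ((PG_N2_im i j).mul (PG_d.mul (PG_trJ _)))
  rw [← sum2 hre him ibp_re ibp_im]
  congr 1
  ext p
  rw [← trace_J_herm, ← sum_pair p]
  simp only [tr_pair]

lemma PP_one {n : ℕ} : PP ((1 : ℝ), (0 : Mat n)) = 1 := by simp [PP, pen, herm]

lemma ident2 {n : ℕ} :
    ∫ p in DD n, ((2 * trace (PP p).adjugate * trace (PP p).adjugate -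
      trace ((PP p).adjugate * (PP p).adjugate)) -
      p.1 * ((PP p).det * trace (PP p).adjugate)) ∂(GG (n + 1)) = 0 := by
  have := ibpV (matrixGaussian (n + 1)) id (MeasurePreserving.id _) ((1 : ℝ), 0)
    (fun a b x => by
      refine Prod.ext ?_ ?_ <;> simp) (fun p => p.1) (fun a x => rfl) continuous_fst PG_N2_fst 1
  simpa [PP_one] using this

lemma PG_tr {n : ℕ} : PG (N2 (n := n)) (fun p => trace (PP p).adjugate) := by
  simpa using PG_trJ (n := n) 1
lemma cont_tr {n : ℕ} : Continuous (fun p : ℝ × Mat n => trace (PP p).adjugate) := by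
  simpa using cont_trJ (n := n) 1
lemma PG_tr2 {n : ℕ} : PG (N2 (n := n)) (fun p => trace ((PP p).adjugate * (PP p).adjugate)) := by
  simpa using PG_trJJ (n := n) 1 1
lemma cont_tr2 {n : ℕ} :
    Continuous (fun p : ℝ × Mat n => trace ((PP p).adjugate * (PP p).adjugate)) := by
  simpa using cont_trJJ (n := n) 1 1
lemma cont_l {n : ℕ} : Continuous (fun p : ℝ × Mat n => (p.1 : ℂ)) :=
  Complex.continuous_ofReal.comp continuous_fst

lemma ident1 {n : ℕ} :
    ∫ p in DD n, (((PP p).det ^ 2 + 2 * p.1 * (PP p).det * trace (PP p).adjugate) -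
      p.1 * (p.1 * (PP p).det ^ 2)) ∂(GG (n + 1)) = 0 := by
  refine ibpT (matrixGaussian (n + 1)) id (MeasurePreserving.id _) ((1 : ℝ), 0)
    (fun a b x => by
      refine Prod.ext ?_ ?_ <;> simp) (fun p => p.1) (fun a x => rfl) continuous_fst PG_N2_fst
    (fun p => p.1 * (PP p).det ^ 2)
    (fun p => (PP p).det ^ 2 + 2 * p.1 * (PP p).det * trace (PP p).adjugate) ?_ ?_ ?_ ?_ ?_ ?_
  · exact cont_l.mul (cont_d.pow 2)
  · exact (cont_d.pow 2).add (((continuous_const.mul cont_l).mul cont_d).mul cont_tr)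
  · simp only [pow_two]
    exact PG_N2_fst.mul (PG_d.mul PG_d)
  · simp only [pow_two]
    exact PG.add N2_nonneg (PG_d.mul PG_d) ((((PG.const 2).mul PG_N2_fst).mul PG_d).mul PG_tr)
  · intro p hp; simp [hp]
  · intro p hp
    simp only [PP_add_smul, PP_one]
    have h1 := hasDerivAt_det (PP p) 1 (isUnit_DD hp)
    have h2 : HasDerivAt (fun a : ℝ => (((p + a • ((1 : ℝ), (0 : Mat (n + 1)))).1 : ℝ) : ℂ)) 1 0 := by
      have hof : HasDerivAt (fun a : ℝ => (a : ℂ)) 1 0 := Complex.ofRealCLM.hasDerivAt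
      simpa using hof.const_add (p.1 : ℂ)
    refine (h2.mul (h1.pow 2)).congr_deriv ?_
    simp
    ring

/-- real determinant -/
noncomputable def dr {n : ℕ} (p : ℝ × Mat n) : ℝ := (PP p).det.re
/-- real trace of adjugate -/
noncomputable def jr {n : ℕ} (p : ℝ × Mat n) : ℝ := (trace (PP p).adjugate).re

lemma PP_herm {n : ℕ} (p : ℝ × Mat n) : (PP p).IsHermitian :=
  pen_isHermitian _ (herm_isHermitian _)

lemma det_eq_dr {n : ℕ} (p : ℝ × Mat n) : (PP p).det = (dr p : ℂ) := by
  have h : star (PP p).det = (PP p).det := by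
    rw [← det_conjTranspose, (PP_herm p).eq]
  exact (Complex.conj_eq_iff_re.1 h).symm

lemma tr_eq_jr {n : ℕ} (p : ℝ × Mat n) : trace (PP p).adjugate = (jr p : ℂ) := by
  have h : star (trace (PP p).adjugate) = trace (PP p).adjugate := by
    rw [← trace_conjTranspose, adjugate_conjTranspose, (PP_herm p).eq]
  exact (Complex.conj_eq_iff_re.1 h).symm

lemma cont_dr {n : ℕ} : Continuous (dr (n := n)) := Complex.continuous_re.comp cont_d
lemma cont_jr {n : ℕ} : Continuous (jr (n := n)) := Complex.continuous_re.comp cont_tr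

lemma ident {n : ℕ} :
    ∫ p in DD n, (3 * (p.1 * dr p - 2 * jr p) ^ 2 - 4 * (n + 2) * dr p ^ 2 + p.1 ^ 2 * dr p ^ 2)
      ∂(GG (n + 1)) = 0 := by
  have i1 : Integrable (fun p => (((PP p).det ^ 2 + 2 * p.1 * (PP p).det * trace (PP p).adjugate) -
      p.1 * (p.1 * (PP p).det ^ 2))) ((GG (n + 1)).restrict (DD n)) := by
    refine (integrable_PG ?_ ?_).restrict
    · exact ((cont_d.pow 2).add (((continuous_const.mul cont_l).mul cont_d).mul cont_tr)).sub
        (cont_l.mul (cont_l.mul (cont_d.pow 2)))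
    · simp only [pow_two]
      exact PG.sub N2_nonneg (PG.add N2_nonneg (PG_d.mul PG_d)
        ((((PG.const 2).mul PG_N2_fst).mul PG_d).mul PG_tr))
        (PG_N2_fst.mul (PG_N2_fst.mul (PG_d.mul PG_d)))
  have i2 : Integrable (fun p => ((2 * trace (PP p).adjugate * trace (PP p).adjugate -
      trace ((PP p).adjugate * (PP p).adjugate)) -
      p.1 * ((PP p).det * trace (PP p).adjugate))) ((GG (n + 1)).restrict (DD n)) := by
    refine (integrable_PG ?_ ?_).restrict
    · exact (((continuous_const.mul cont_tr).mul cont_tr).sub cont_tr2).sub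
        (cont_l.mul (cont_d.mul cont_tr))
    · exact PG.sub N2_nonneg (PG.sub N2_nonneg (((PG.const 2).mul PG_tr).mul PG_tr) PG_tr2)
        (PG_N2_fst.mul (PG_d.mul PG_tr))
  have i3 : Integrable (fun p => (-2 * trace ((PP p).adjugate * (PP p).adjugate) +
      trace (PP p).adjugate * trace (PP p).adjugate - (PP p).det *
      (p.1 * trace (PP p).adjugate - (n + 1 : ℕ) * (PP p).det)))
      ((GG (n + 1)).restrict (DD n)) := by
    refine (integrable_PG ?_ ?_).restrict
    · exact ((continuous_const.mul cont_tr2).add (cont_tr.mul cont_tr)).sub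
        (cont_d.mul ((cont_l.mul cont_tr).sub (continuous_const.mul cont_d)))
    · exact PG.sub N2_nonneg (PG.add N2_nonneg ((PG.const _).mul PG_tr2) (PG_tr.mul PG_tr))
        (PG_d.mul (PG.sub N2_nonneg (PG_N2_fst.mul PG_tr) ((PG.const _).mul PG_d)))
  have key : ∫ p in DD n, ((-4 : ℂ) * (((PP p).det ^ 2 + 2 * p.1 * (PP p).det * trace (PP p).adjugate) -
      p.1 * (p.1 * (PP p).det ^ 2)) + (8 * ((2 * trace (PP p).adjugate * trace (PP p).adjugate -
      trace ((PP p).adjugate * (PP p).adjugate)) -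
      p.1 * ((PP p).det * trace (PP p).adjugate)) + (-4 : ℂ) *
      (-2 * trace ((PP p).adjugate * (PP p).adjugate) +
      trace (PP p).adjugate * trace (PP p).adjugate - (PP p).det *
      (p.1 * trace (PP p).adjugate - (n + 1 : ℕ) * (PP p).det)))) ∂(GG (n + 1)) = 0 := by
    exact lin3 _ _ _ i1 i2 i3 ident1 ident2 ident3
  have e : ∀ p : ℝ × Mat (n + 1), ((-4 : ℂ) * (((PP p).det ^ 2 + 2 * p.1 * (PP p).det * trace (PP p).adjugate) -
      p.1 * (p.1 * (PP p).det ^ 2)) + (8 * ((2 * trace (PP p).adjugate * trace (PP p).adjugate -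
      trace ((PP p).adjugate * (PP p).adjugate)) -
      p.1 * ((PP p).det * trace (PP p).adjugate)) + (-4 : ℂ) *
      (-2 * trace ((PP p).adjugate * (PP p).adjugate) +
      trace (PP p).adjugate * trace (PP p).adjugate - (PP p).det *
      (p.1 * trace (PP p).adjugate - (n + 1 : ℕ) * (PP p).det)))) =
      ((3 * (p.1 * dr p - 2 * jr p) ^ 2 - 4 * (n + 2) * dr p ^ 2 + p.1 ^ 2 * dr p ^ 2 : ℝ) : ℂ) := by
    intro p
    rw [det_eq_dr, tr_eq_jr]
    push_cast
    ring
  simp only [e] at key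
  rw [← Complex.ofReal_eq_zero, ← integral_complex_ofReal]
  exact key

end GUEx

namespace GUEx
open MeasureTheory ProbabilityTheory Matrix
open scoped ComplexOrder Topology ENNReal

lemma lcons {n : ℕ} {E : Type*} [MeasurableSpace E] (μ : Measure E) [SigmaFinite μ]
    (f : (Fin (n + 1) → E) → ℝ≥0∞) (hf : Measurable f) :
    ∫⁻ x, f x ∂(Measure.pi fun _ => μ) =
      ∫⁻ e, ∫⁻ v, f (Fin.cons e v) ∂(Measure.pi fun _ : Fin n => μ) ∂μ := by
  have h := (measurePreserving_piFinSuccAbove (fun _ : Fin (n + 1) => μ) 0).symm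
  have h2 := h.lintegral_comp hf
  rw [← h2, lintegral_prod]
  · simp [MeasurableEquiv.piFinSuccAbove, Fin.insertNthEquiv]
  · exact (hf.comp (MeasurableEquiv.measurable _)).aemeasurable

lemma lintegral_fin_prod {n : ℕ} {E : Type*} [MeasurableSpace E] (μ : Measure E) [SigmaFinite μ]
    (f : Fin n → E → ℝ≥0∞) (hf : ∀ i, Measurable (f i)) :
    ∫⁻ x, ∏ i, f i (x i) ∂(Measure.pi fun _ => μ) = ∏ i, ∫⁻ y, f i y ∂μ := by
  induction n with
  | zero => simp [Measure.pi_of_empty]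
  | succ n ih =>
    have hm : ∀ {k} (g : Fin k → E → ℝ≥0∞), (∀ i, Measurable (g i)) →
        Measurable (fun x : Fin k → E => ∏ i, g i (x i)) := fun g hg =>
      Finset.measurable_prod _ fun i _ => (hg i).comp (measurable_pi_apply i)
    rw [lcons μ _ (hm f hf)]
    simp only [Fin.prod_univ_succ, Fin.cons_zero, Fin.cons_succ]
    simp_rw [lintegral_const_mul _ (hm _ fun i => hf (Fin.succ i))]
    rw [lintegral_mul_const _ (hf 0), ih _ fun i => hf (Fin.succ i)]

lemma pi_withDensity {n : ℕ} {E : Type*} [MeasurableSpace E] (μ : Measure E) [SigmaFinite μ]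
    (f : E → ℝ≥0∞) (hf : Measurable f) [SigmaFinite (μ.withDensity f)] :
    (Measure.pi fun _ : Fin n => μ.withDensity f) =
      (Measure.pi fun _ : Fin n => μ).withDensity (fun x => ∏ i, f (x i)) := by
  refine Measure.pi_eq fun s hs => ?_
  rw [withDensity_apply _ (MeasurableSet.univ_pi hs), ← lintegral_indicator (MeasurableSet.univ_pi hs)]
  have : ∀ i, (μ.withDensity f) (s i) = ∫⁻ y, (s i).indicator f y ∂μ := fun i => by
    rw [withDensity_apply _ (hs i), lintegral_indicator (hs i)]
  simp_rw [this]
  rw [← lintegral_fin_prod μ _ fun i => hf.indicator (hs i)]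
  refine lintegral_congr fun x => ?_
  by_cases hx : x ∈ Set.univ.pi s
  · rw [Set.indicator_of_mem hx]
    exact Finset.prod_congr rfl fun i _ => (Set.indicator_of_mem (hx i trivial) _).symm
  · rw [Set.indicator_of_notMem hx]
    simp only [Set.mem_pi, Set.mem_univ, true_implies, not_forall] at hx
    obtain ⟨i, hi⟩ := hx
    exact (Finset.prod_eq_zero (Finset.mem_univ i) (Set.indicator_of_notMem hi _)).symm

/-- exponential weight -/
noncomputable def ge (s : ℝ) : ℝ≥0∞ := ENNReal.ofReal (Real.exp (-s))

lemma ge_add (a b : ℝ) : ge (a + b) = ge a * ge b := by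
  unfold ge; rw [← ENNReal.ofReal_mul (Real.exp_pos _).le, ← Real.exp_add]; congr 2; ring

lemma ge_sum {n : ℕ} (a : Fin n → ℝ) : ∏ i, ge (a i) = ge (∑ i, a i) := by
  induction n with
  | zero => simp [ge]
  | succ n ih => rw [Fin.prod_univ_succ, Fin.sum_univ_succ, ge_add, ih]

lemma continuous_ge : Continuous ge := by unfold ge; exact ENNReal.continuous_ofReal.comp (by fun_prop)
lemma measurable_ge : Measurable ge := continuous_ge.measurable

lemma gr_density : gaussianReal 0 1 =
    volume.withDensity (fun x : ℝ => ENNReal.ofReal (√(2 * Real.pi))⁻¹ * ge (x ^ 2 / 2)) := by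
  rw [gaussianReal_of_var_ne_zero _ one_ne_zero]
  congr 1; ext x
  rw [gaussianPDF, gaussianPDFReal, ge, ← ENNReal.ofReal_mul (by positivity)]
  simp [neg_div]

/-- density of complex Gaussian -/
noncomputable def cgd (z : ℂ) : ℝ≥0∞ :=
  ENNReal.ofReal (√(2 * Real.pi))⁻¹ ^ 2 * ge (‖z‖ ^ 2 / 2)

lemma measurable_cgd : Measurable cgd := by
  unfold cgd; exact (continuous_ge.comp (by fun_prop)).measurable.const_mul _

lemma cg_density : complexGaussian = volume.withDensity cgd := by
  have hm : Measurable (fun x : ℝ => ENNReal.ofReal (√(2 * Real.pi))⁻¹ * ge (x ^ 2 / 2)) :=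
    (continuous_ge.comp (by fun_prop)).measurable.const_mul _
  have := Complex.volume_preserving_equiv_real_prod.symm
  ext s hs
  rw [complexGaussian, Measure.map_apply _ hs, gr_density, prod_withDensity hm hm,
    withDensity_apply, withDensity_apply _ hs, ← lintegral_indicator, ← lintegral_indicator hs,
    ← this.lintegral_comp]
  · refine lintegral_congr fun p => ?_
    simp only [Set.indicator, Set.mem_preimage]
    have e : Complex.measurableEquivRealProd.symm p = ⟨p.1, p.2⟩ := rfl
    rw [e]
    congr 1
    rw [cgd, Complex.sq_norm, Complex.normSq_mk, show (p.1 * p.1 + p.2 * p.2) / 2 = p.1^2/2+p.2^2/2 by ring, ge_add]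
    ring
  · exact measurable_cgd.indicator hs
  · exact (Complex.measurableEquivRealProd.symm.measurable hs)
  · exact (Complex.measurableEquivRealProd.symm.measurable hs)
  · exact Complex.measurableEquivRealProd.symm.measurable

/-- squared norm -/
noncomputable def nsq {n : ℕ} (v : Fin n → ℂ) : ℝ := ∑ i, ‖v i‖ ^ 2
/-- squared Frobenius norm -/
noncomputable def FN {n : ℕ} (G : Mat n) : ℝ := ∑ i, ∑ j, ‖G i j‖ ^ 2

lemma continuous_nsq {n : ℕ} : Continuous (nsq (n := n)) := by unfold nsq; fun_prop
lemma continuous_FN {n : ℕ} : Continuous (FN (n := n)) := by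
  unfold FN
  refine continuous_finsetSum _ fun i _ => continuous_finsetSum _ fun j _ => ?_
  exact (continuous_entry i j).norm.pow 2

/-- Lebesgue measure on matrices -/
noncomputable def volM (n : ℕ) : Measure (Mat n) := (volume : Measure (Fin n → Fin n → ℂ))

instance {n : ℕ} : SigmaFinite (volM n) :=
  inferInstanceAs (SigmaFinite (volume : Measure (Fin n → Fin n → ℂ)))

/-- normalizing constant -/
noncomputable def c0 : ℝ≥0∞ := ENNReal.ofReal (√(2 * Real.pi))⁻¹
lemma c0_ne : c0 ≠ 0 := by
  unfold c0
  rw [Ne, ENNReal.ofReal_eq_zero, not_le]; positivity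
lemma c0_ne_top : c0 ≠ ⊤ := ENNReal.ofReal_ne_top

lemma mg_density (n : ℕ) : matrixGaussian n =
    (volM n).withDensity (fun G => (c0 ^ 2) ^ (n * n) * ge (FN G / 2)) := by
  have hs : SigmaFinite (volume.withDensity cgd) := by rw [← cg_density]; infer_instance
  have h1 : (Measure.pi fun _ : Fin n => complexGaussian) =
      (volume : Measure (Fin n → ℂ)).withDensity (fun x => ∏ i, cgd (x i)) := by
    simp_rw [cg_density]; exact pi_withDensity _ _ measurable_cgd
  have hm : Measurable (fun x : Fin n → ℂ => ∏ i, cgd (x i)) :=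
    Finset.measurable_prod _ fun i _ => measurable_cgd.comp (measurable_pi_apply i)
  have hs2 : SigmaFinite ((volume : Measure (Fin n → ℂ)).withDensity (fun x => ∏ i, cgd (x i))) := by
    rw [← h1]; infer_instance
  have h2 := pi_withDensity (n := n) (volume : Measure (Fin n → ℂ)) _ hm
  rw [matrixGaussian]
  simp_rw [h1]
  rw [h2]
  change _ = (volume : Measure (Fin n → Fin n → ℂ)).withDensity _
  congr 1
  ext G
  simp only [cgd, Finset.prod_mul_distrib, ge_sum, Finset.prod_const, Finset.card_univ, Fintype.card_fin]
  change _ = (c0 ^ 2) ^ (n * n) * ge ((∑ i, ∑ j, ‖G i j‖ ^ 2) / 2)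
  rw [Finset.sum_div, ← pow_mul]
  simp_rw [Finset.sum_div]
  rfl

lemma lint_mg {n : ℕ} (f : Mat n → ℝ≥0∞) (hf : Measurable f) :
    ∫⁻ G, f G ∂(matrixGaussian n) = (c0 ^ 2) ^ (n * n) * ∫⁻ G, f G * ge (FN G / 2) ∂(volM n) := by
  have hm : Measurable (fun G : Mat n => ge (FN G / 2)) :=
    (continuous_ge.comp (continuous_FN.div_const 2)).measurable
  rw [mg_density, lintegral_withDensity_eq_lintegral_mul _ (hm.const_mul _) hf, ← lintegral_const_mul _ (show Measurable (fun G => f G * _) from hf.mul hm)]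
  refine lintegral_congr fun G => ?_
  simp only [Pi.mul_apply]; ring

lemma lint_gr (f : ℝ → ℝ≥0∞) (hf : Measurable f) :
    ∫⁻ G, f G ∂(gaussianReal 0 1) = c0 * ∫⁻ G, f G * ge (G ^ 2 / 2) := by
  have hm : Measurable (fun G : ℝ => ge (G ^ 2 / 2)) :=
    (continuous_ge.comp (by fun_prop)).measurable
  rw [gr_density, lintegral_withDensity_eq_lintegral_mul _ (hm.const_mul _) hf, ← lintegral_const_mul _ (show Measurable (fun G => f G * _) from hf.mul hm)]
  refine lintegral_congr fun G => ?_
  simp only [Pi.mul_apply, c0]; ring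

lemma lint_GG {n : ℕ} (f : ℝ × Mat n → ℝ≥0∞) (hf : Measurable f) :
    ∫⁻ p, f p ∂(GG n) = (c0 * (c0 ^ 2) ^ (n * n)) *
      ∫⁻ t, ∫⁻ G, f (t, G) * ge (t ^ 2 / 2 + FN G / 2) ∂(volM n) := by
  have hm : Measurable (fun G : Mat n => ge (FN G / 2)) :=
    (continuous_ge.comp (continuous_FN.div_const 2)).measurable
  have hm2 : Measurable (fun p : ℝ × Mat n => f p * ge (FN p.2 / 2)) :=
    hf.mul (hm.comp measurable_snd)
  rw [lintegral_prod _ hf.aemeasurable, lint_gr _ hf.lintegral_prod_right']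
  have : ∀ t, ∫⁻ G, f (t, G) ∂(matrixGaussian n) = _ := fun t => lint_mg _ (hf.comp measurable_prodMk_left)
  simp_rw [this, mul_assoc]
  rw [lintegral_const_mul]
  · congr 2
    refine lintegral_congr fun t => ?_
    rw [← lintegral_mul_const]
    · refine lintegral_congr fun G => ?_
      simp only [ge_add]; ring
    · exact hm2.comp measurable_prodMk_left
  · refine Measurable.mul (Measurable.lintegral_prod_right' (f := fun p : ℝ × Mat n => f p * ge (FN p.2 / 2)) hm2) ?_
    exact (continuous_ge.comp (by fun_prop)).measurable
end GUEx

namespace GUEx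
open MeasureTheory ProbabilityTheory Matrix
open scoped ComplexOrder Topology ENNReal

lemma lint_affine {E : Type*} [NormedAddCommGroup E] [NormedSpace ℝ E] [MeasurableSpace E]
    [BorelSpace E] [FiniteDimensional ℝ E] (μ : Measure E) [μ.IsAddHaarMeasure]
    (L : E →ₗ[ℝ] E) (hL : LinearMap.det L ≠ 0) (b : E) (f : E → ℝ≥0∞) (hf : Measurable f) :
    ∫⁻ x, f x ∂μ = ENNReal.ofReal |LinearMap.det L| * ∫⁻ x, f (L x + b) ∂μ := by
  have hLm : Measurable L := (LinearMap.continuous_of_finiteDimensional L).measurable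
  have h1 : ∫⁻ x, f (L x + b) ∂μ = ∫⁻ x, f (x + b) ∂(Measure.map L μ) := by
    rw [lintegral_map (by exact hf.comp (measurable_add_const b)) hLm]
  rw [h1, Measure.map_linearMap_addHaar_eq_smul_addHaar μ hL, lintegral_smul_measure,
    lintegral_add_right_eq_self, smul_eq_mul, ← mul_assoc, ← ENNReal.ofReal_mul (abs_nonneg _),
    ← abs_mul, mul_inv_cancel₀ hL]
  simp

abbrev VV (m : ℕ) := Fin m → ℂ

lemma mp_star (m : ℕ) : MeasurePreserving (fun r : VV m => star r) volume volume := by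
  have h : MeasurePreserving (fun z : ℂ => star z) volume volume :=
    Complex.conjLIE.measurePreserving
  exact volume_preserving_pi (f := fun _ : Fin m => fun z : ℂ => star z) fun _ => h

lemma measurable_ge_nsq {m : ℕ} : Measurable (fun v : VV m => ge (nsq v)) :=
  (continuous_ge.comp continuous_nsq).measurable

lemma rs_law (m : ℕ) : ∃ c : ℝ≥0∞, ∀ f : VV m → ℝ≥0∞, Measurable f →
    ∫⁻ r : VV m, ∫⁻ s : VV m, f ((1 / 2 : ℂ) • (s + star r)) * ge ((nsq r + nsq s) / 2) =
      c * ∫⁻ g : VV m, f g * ge (nsq g) := by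
  set L : VV m →ₗ[ℝ] VV m := (2 : ℝ) • LinearMap.id with hL
  have hdet : LinearMap.det L ≠ 0 := by simp [hL]
  refine ⟨ENNReal.ofReal |LinearMap.det L| * ∫⁻ r : VV m, ge (nsq r), fun f hf => ?_⟩
  have h1 : ∀ r : VV m, ∫⁻ s : VV m, f ((1 / 2 : ℂ) • (s + star r)) * ge ((nsq r + nsq s) / 2) =
      ENNReal.ofReal |LinearMap.det L| * ∫⁻ g : VV m, (f g * ge (nsq g)) * ge (nsq (g - star r)) := by
    intro r
    rw [lint_affine volume L hdet (-star r)]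
    · congr 1
      refine lintegral_congr fun g => ?_
      rw [mul_assoc, ← ge_add]
      congr 2
      · ext i; simp [hL]
      · simp only [nsq, ← Finset.sum_add_distrib, Finset.sum_div]
        refine Finset.sum_congr rfl fun i _ => ?_
        simp only [hL, LinearMap.smul_apply, LinearMap.id_apply, Pi.add_apply, Pi.smul_apply, Pi.neg_apply,
          Pi.sub_apply, Pi.star_apply, Complex.sq_norm, Complex.normSq_apply]
        simp
        ring
    · refine (hf.comp (by fun_prop)).mul ?_
      exact (continuous_ge.comp ((continuous_const.add continuous_nsq).div_const 2)).measurable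
  simp_rw [h1]
  have hc : Continuous (fun p : VV m × VV m => nsq (p.2 - star p.1)) :=
    continuous_nsq.comp (by fun_prop)
  have hm : Measurable (fun p : VV m × VV m => (f p.2 * ge (nsq p.2)) * ge (nsq (p.2 - star p.1))) :=
    ((hf.comp measurable_snd).mul (measurable_ge_nsq.comp measurable_snd)).mul
      (continuous_ge.comp hc).measurable
  rw [lintegral_const_mul _ (Measurable.lintegral_prod_right' hm), mul_assoc]
  congr 1
  rw [lintegral_lintegral_swap hm.aemeasurable]
  have h2 : ∀ g : VV m, ∫⁻ r : VV m, (f g * ge (nsq g)) * ge (nsq (g - star r)) =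
      (∫⁻ r : VV m, ge (nsq r)) * (f g * ge (nsq g)) := by
    intro g
    have hm2 : Measurable (fun r : VV m => ge (nsq (g - r))) :=
      (continuous_ge.comp (continuous_nsq.comp (by fun_prop))).measurable
    rw [lintegral_const_mul, mul_comm]
    · congr 1
      rw [(mp_star m).lintegral_comp hm2]
      exact lintegral_sub_left_eq_self (fun r : VV m => ge (nsq r)) g
    · exact hm2.comp (mp_star m).measurable
  simp_rw [h2]
  rw [lintegral_const_mul _ (by exact hf.mul measurable_ge_nsq)]

lemma z_law : ∃ c : ℝ≥0∞, ∀ f : ℝ → ℝ≥0∞, Measurable f →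
    ∫⁻ z : ℂ, f z.re * ge (‖z‖ ^ 2 / 2) = c * ∫⁻ h : ℝ, f h * ge (h ^ 2 / 2) := by
  refine ⟨∫⁻ y : ℝ, ge (y ^ 2 / 2), fun f hf => ?_⟩
  have h := Complex.volume_preserving_equiv_real_prod.symm
  have hg : Measurable (fun y : ℝ => ge (y ^ 2 / 2)) := (continuous_ge.comp (by fun_prop)).measurable
  have hm : Measurable (fun z : ℂ => f z.re * ge (‖z‖ ^ 2 / 2)) :=
    (hf.comp Complex.measurable_re).mul (continuous_ge.comp (by fun_prop)).measurable
  rw [← h.lintegral_comp hm, Measure.volume_eq_prod,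
    lintegral_prod _ (by exact (hm.comp (MeasurableEquiv.measurable _)).aemeasurable), ← lintegral_const_mul]
  · refine lintegral_congr fun x => ?_
    rw [← lintegral_mul_const _ hg]
    refine lintegral_congr fun y => ?_
    have e : Complex.measurableEquivRealProd.symm (x, y) = ⟨x, y⟩ := rfl
    rw [e, Complex.sq_norm, Complex.normSq_mk, show (x * x + y * y) / 2 = x^2/2+y^2/2 by ring, ge_add]
    simp only; ring
  · exact hf.mul hg

/-- bordered matrix -/
noncomputable def blk {m : ℕ} (h : ℝ) (g : VV m) (K : Mat m) : Mat (m + 1) :=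
  Matrix.of (Fin.cons (Fin.cons (h : ℂ) (star g)) (fun i => Fin.cons (g i) (K i)))

/-- bordered matrix, general -/
noncomputable def blk' {m : ℕ} (z : ℂ) (r s : VV m) (K : Mat m) : Mat (m + 1) :=
  Matrix.of (Fin.cons (Fin.cons z r) (fun i => Fin.cons (s i) (K i)))

lemma herm_blk' {m : ℕ} (z : ℂ) (r s : VV m) (K : Mat m) :
    herm (blk' z r s K) = blk z.re ((1 / 2 : ℂ) • (s + star r)) (herm K) := by
  ext i j
  refine Fin.cases ?_ (fun i => ?_) i <;> refine Fin.cases ?_ (fun j => ?_) j <;>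
    simp [herm, blk, blk', Matrix.conjTranspose_apply]
  · apply Complex.ext <;> simp
    ring
  all_goals ring

lemma FN_blk' {m : ℕ} (z : ℂ) (r s : VV m) (K : Mat m) :
    FN (blk' z r s K) = ‖z‖ ^ 2 + nsq r + nsq s + FN K := by
  simp only [FN, blk', Matrix.of_apply, Fin.sum_univ_succ, Fin.cons_zero, Fin.cons_succ, nsq, Finset.sum_add_distrib]
  ring

lemma continuous_blk {m : ℕ} {X : Type*} [TopologicalSpace X] {h : X → ℝ} {g : X → VV m} {K : X → Mat m}
    (hh : Continuous h) (hg : Continuous g) (hK : Continuous K) :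
    Continuous (fun x => blk (h x) (g x) (K x)) := by
  refine continuous_matrix fun i j => ?_
  refine Fin.cases ?_ (fun i => ?_) i <;> refine Fin.cases ?_ (fun j => ?_) j <;> simp only [blk, Matrix.of_apply, Fin.cons_zero, Fin.cons_succ]
  · fun_prop
  · simp only [Pi.star_apply]; fun_prop
  · fun_prop
  · exact hK.matrix_elem i j

lemma vol_split {m : ℕ} (f : Mat (m + 1) → ℝ≥0∞) (hf : Measurable f) :
    ∫⁻ G, f G ∂(volM (m + 1)) = ∫⁻ z : ℂ, ∫⁻ r : VV m, ∫⁻ s : VV m, ∫⁻ K, f (blk' z r s K) ∂(volM m) := by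
  have h0 : ∫⁻ G, f G ∂(volM (m + 1)) = ∫⁻ e : VV (m + 1), ∫⁻ v : Fin m → VV (m + 1), f (Matrix.of (Fin.cons e v)) :=
    lcons (volume : Measure (VV (m + 1))) f hf
  have hcm : Measurable (fun p : VV (m + 1) × (Fin m → VV (m + 1)) => (Matrix.of (Fin.cons p.1 p.2) : Mat (m + 1))) := by
    refine measurable_pi_iff.2 fun i => ?_
    refine Fin.cases ?_ (fun i => ?_) i
    · exact measurable_fst
    · exact (measurable_pi_apply i).comp measurable_snd
  have hF := hf.comp hcm
  rw [h0]
  have h1 := lcons (volume : Measure ℂ) (fun e : VV (m + 1) => ∫⁻ v : Fin m → VV (m + 1), f (Matrix.of (Fin.cons e v)))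
    (Measurable.lintegral_prod_right' hF)
  refine h1.trans (lintegral_congr fun z => lintegral_congr fun r => ?_)
  have e1 := volume_preserving_pi (fun _ : Fin m => (volume_preserving_piFinSuccAbove (fun _ : Fin (m + 1) => ℂ) 0).symm)
  have e2 := (volume_measurePreserving_arrowProdEquivProdArrow ℂ (VV m) (Fin m)).symm
  have e3 := e1.comp e2
  have hF2 : Measurable (fun v : Fin m → VV (m + 1) => f (Matrix.of (Fin.cons (Fin.cons z r) v))) :=
    hF.comp measurable_prodMk_left
  rw [← e3.lintegral_comp hF2, Measure.volume_eq_prod, lintegral_prod _ (by exact (hF2.comp e3.measurable).aemeasurable)]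
  refine lintegral_congr fun s => ?_
  change _ = ∫⁻ K : Fin m → Fin m → ℂ, f (blk' z r s K)
  refine lintegral_congr fun K => ?_
  congr 1
  ext i j
  refine Fin.cases rfl (fun i => ?_) i
  refine Fin.cases ?_ (fun j => ?_) j <;> 
    simp [blk', MeasurableEquiv.piFinSuccAbove, Fin.insertNthEquiv, MeasurableEquiv.arrowProdEquivProdArrow, Equiv.arrowProdEquivProdArrow]

lemma blockLaw (m : ℕ) : ∃ c : ℝ≥0∞, ∀ Φ : Mat (m + 1) → ℝ≥0∞, Measurable Φ →
    ∫⁻ G, Φ (herm G) ∂(matrixGaussian (m + 1)) = c * ∫⁻ p : VV m × Mat m, (∫⁻ h : ℝ,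
      Φ (blk h p.1 (herm p.2)) * ge (h ^ 2 / 2 + nsq p.1 + FN p.2 / 2)) ∂((volume : Measure (VV m)).prod (volM m)) := by
  obtain ⟨c1, h1⟩ := z_law
  obtain ⟨c2, h2⟩ := rs_law m
  refine ⟨(c0 ^ 2) ^ ((m + 1) * (m + 1)) * (c2 * c1), fun Φ hΦ => ?_⟩
  have hge : Measurable (fun G : Mat (m + 1) => ge (FN G / 2)) :=
    (continuous_ge.comp (continuous_FN.div_const 2)).measurable
  rw [lint_mg _ (by exact hΦ.comp continuous_herm.measurable), mul_assoc]
  congr 1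
  rw [vol_split _ (by exact (hΦ.comp continuous_herm.measurable).mul hge)]
  have hmeas : Measurable (fun q : (ℝ × VV m) × Mat m => Φ (blk q.1.1 q.1.2 (herm q.2)) * ge (FN q.2 / 2)) := by
    refine (hΦ.comp (continuous_blk (by fun_prop) (by fun_prop) (continuous_herm.comp continuous_snd)).measurable).mul ?_
    exact ((continuous_ge.comp (continuous_FN.div_const 2)).comp continuous_snd).measurable
  set Ψ : ℝ × VV m → ℝ≥0∞ := fun q => ∫⁻ K, Φ (blk q.1 q.2 (herm K)) * ge (FN K / 2) ∂(volM m) with hΨ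
  have hΨm : Measurable Ψ := hmeas.lintegral_prod_right'
  have s1 : ∀ z : ℂ, ∫⁻ r : VV m, ∫⁻ s : VV m, ∫⁻ K, Φ (herm (blk' z r s K)) * ge (FN (blk' z r s K) / 2) ∂(volM m) =
      c2 * (∫⁻ g : VV m, Ψ (z.re, g) * ge (nsq g)) * ge (‖z‖ ^ 2 / 2) := by
    intro z
    have : ∀ r s : VV m, ∫⁻ K, Φ (herm (blk' z r s K)) * ge (FN (blk' z r s K) / 2) ∂(volM m) =
        (Ψ (z.re, (1 / 2 : ℂ) • (s + star r)) * ge (‖z‖ ^ 2 / 2)) * ge ((nsq r + nsq s) / 2) := by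
      intro r s
      rw [hΨ, mul_assoc, ← ge_add]
      dsimp only
      rw [← lintegral_mul_const]
      · refine lintegral_congr fun K => ?_
        rw [herm_blk', FN_blk', mul_assoc, ← ge_add]
        congr 2; ring
      · exact hmeas.comp (measurable_prodMk_left (x := (z.re, (1 / 2 : ℂ) • (s + star r))))
    simp_rw [this]
    rw [h2 (fun g => Ψ (z.re, g) * ge (‖z‖ ^ 2 / 2)) ((hΨm.comp measurable_prodMk_left).mul_const _), mul_assoc, ← lintegral_mul_const]
    · congr 1; refine lintegral_congr fun g => ?_
      ring
    · exact (hΨm.comp measurable_prodMk_left).mul measurable_ge_nsq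
  simp_rw [s1]
  have hm4 : Measurable (fun q : ℝ × VV m => Ψ q * ge (nsq q.2)) := hΨm.mul (measurable_ge_nsq.comp measurable_snd)
  have hm3 : Measurable (fun h : ℝ => ∫⁻ g : VV m, Ψ (h, g) * ge (nsq g)) := hm4.lintegral_prod_right'
  rw [h1 (fun h => c2 * ∫⁻ g : VV m, Ψ (h, g) * ge (nsq g)) (hm3.const_mul _), mul_comm c2 c1, mul_assoc]
  congr 1
  simp_rw [mul_assoc]
  have hg1 : Measurable (fun h : ℝ => ge (h ^ 2 / 2)) := (continuous_ge.comp (by fun_prop)).measurable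
  rw [lintegral_const_mul _ (by exact hm3.mul hg1)]
  congr 1
  have hbig : Measurable (fun q : ℝ × (VV m × Mat m) => Φ (blk q.1 q.2.1 (herm q.2.2)) * ge (q.1 ^ 2 / 2 + nsq q.2.1 + FN q.2.2 / 2)) := by
    refine (hΦ.comp (continuous_blk (by fun_prop) (by fun_prop) (continuous_herm.comp (by fun_prop))).measurable).mul ?_
    refine (continuous_ge.comp ?_).measurable
    have := continuous_FN (n := m)
    have := continuous_nsq (n := m)
    fun_prop
  rw [lintegral_lintegral_swap (f := fun (p : VV m × Mat m) (h : ℝ) => Φ (blk h p.1 (herm p.2)) * ge (h ^ 2 / 2 + nsq p.1 + FN p.2 / 2))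
    (hbig.comp measurable_swap).aemeasurable]
  refine lintegral_congr fun h => ?_
  rw [lintegral_prod _ (by exact (hbig.comp measurable_prodMk_left).aemeasurable), ← lintegral_mul_const]
  · refine lintegral_congr fun g => ?_
    rw [hΨ]; dsimp only
    rw [mul_assoc, ← lintegral_mul_const]
    · refine lintegral_congr fun K => ?_
      rw [mul_assoc, ← ge_add, ← ge_add]; congr 2; ring
    · exact hmeas.comp (measurable_prodMk_left (x := (h, g)))
  · exact hm4.comp measurable_prodMk_left
end GUEx

namespace GUEx
open MeasureTheory ProbabilityTheory Matrix
open scoped ComplexOrder Topology ENNReal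

/-- real quadratic form -/
noncomputable def qf {m : ℕ} (P : Mat m) (y : VV m) : ℝ := (star y ⬝ᵥ P *ᵥ y).re

lemma qf_eq {m : ℕ} {P : Mat m} (hP : P.IsHermitian) (y : VV m) :
    star y ⬝ᵥ P *ᵥ y = (qf P y : ℂ) := by
  have : star (star y ⬝ᵥ P *ᵥ y) = star y ⬝ᵥ P *ᵥ y := by
    rw [← star_dotProduct_star, star_star, star_mulVec, hP.eq, dotProduct_comm, dotProduct_comm, ← dotProduct_mulVec]
  exact (Complex.conj_eq_iff_re.1 this).symm

lemma vec_qf {m : ℕ} (v : VV m) : star v ⬝ᵥ v = (nsq v : ℂ) := by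
  simp only [dotProduct, nsq, Pi.star_apply, Complex.ofReal_sum]
  refine Finset.sum_congr rfl fun i _ => ?_
  rw [Complex.sq_norm, Complex.normSq_eq_conj_mul_self]; rfl

/-- border factor -/
noncomputable def BB {m : ℕ} (y : VV m) : Matrix (Fin m) (Fin (m + 1)) ℂ :=
  Matrix.of fun i => Fin.cons (-y i) ((1 : Mat m) i)

lemma blk_isHermitian {m : ℕ} (h : ℝ) (g : VV m) {K : Mat m} (hK : K.IsHermitian) :
    (blk h g K).IsHermitian := by
  ext i j
  refine Fin.cases ?_ (fun i => ?_) i <;> refine Fin.cases ?_ (fun j => ?_) j <;>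
    simp [blk, Matrix.conjTranspose_apply]
  exact congrFun (congrFun hK i) j

lemma one_apply_sum {m : ℕ} (i : Fin m) (f : Fin m → ℂ) : ∑ x, (1 : Mat m) x i * f x = f i := by
  simp [Matrix.one_apply]

lemma BB_conj {m : ℕ} (y : VV m) (P : Mat m) (i j : Fin (m + 1)) :
    ((BB y)ᴴ * P * BB y) i j = Fin.cases (Fin.cases (star y ⬝ᵥ P *ᵥ y) (fun j => -(star y ᵥ* P) j) j)
      (fun i => Fin.cases (-(P *ᵥ y) i) (fun j => P i j) j) i := by
  have h1 : ∀ k, ((BB y)ᴴ * P) 0 k = -(star y ᵥ* P) k := by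
    intro k
    simp [Matrix.mul_apply, BB, vecMul, dotProduct]
  have h2 : ∀ i k, ((BB y)ᴴ * P) (Fin.succ i) k = P i k := by
    intro i k
    simp [Matrix.mul_apply, BB, Matrix.one_apply]
  have h3 : ∀ v : Fin m → ℂ, ∑ k, v k * BB y k 0 = - (v ⬝ᵥ y) := by
    intro v; simp [BB, dotProduct]
  have h4 : ∀ (v : Fin m → ℂ) j, ∑ k, v k * BB y k (Fin.succ j) = v j := by
    intro v j; simp [BB, Matrix.one_apply]
  rw [Matrix.mul_apply]
  refine Fin.cases ?_ (fun i => ?_) i <;> refine Fin.cases ?_ (fun j => ?_) j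
  · rw [h3, show ((BB y)ᴴ * P) 0 = -(star y ᵥ* P) from funext h1]; simp only [Fin.cases_zero]
    rw [dotProduct_mulVec]; simp [dotProduct]
  · rw [h4, h1]; rfl
  · rw [h3, show ((BB y)ᴴ * P) (Fin.succ i) = P i from funext (h2 i)]; rfl
  · rw [h4, h2]; rfl

lemma pen_blk {m : ℕ} (l : ℝ) {K : Mat m} (hK : K.IsHermitian) (y : VV m) :
    pen l (blk (l - qf (pen l K) y) (pen l K *ᵥ y) K) = (BB y)ᴴ * pen l K * BB y := by
  have hP := pen_isHermitian l hK
  ext i j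
  rw [BB_conj]
  refine Fin.cases ?_ (fun i => ?_) i <;> refine Fin.cases ?_ (fun j => ?_) j
  · simp only [Fin.cases_zero]
    rw [qf_eq hP]
    generalize qf (pen l K) y = q
    simp [pen, blk]
  · simp only [Fin.cases_zero, Fin.cases_succ]
    have : star (pen l K *ᵥ y) = star y ᵥ* pen l K := by rw [star_mulVec, hP.eq]
    rw [← this]
    generalize pen l K *ᵥ y = g
    generalize qf (pen l K) y = q
    simp [pen, blk, (Fin.succ_ne_zero j).symm]
  · simp [pen, blk]
  · simp [pen, blk, Matrix.one_apply]

lemma BB_null {m : ℕ} (y : VV m) : BB y *ᵥ (Fin.cons 1 y : Fin (m + 1) → ℂ) = 0 := by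
  ext i
  simp [BB, mulVec, dotProduct, Fin.sum_univ_succ, Matrix.one_apply]

lemma tp_blk {m : ℕ} (l : ℝ) {K : Mat (m + 1)} (hK : K.IsHermitian) (hP : (pen l K).PosDef) (y : VV (m + 1)) :
    tp (blk (l - qf (pen l K) y) (pen l K *ᵥ y) K) = l := by
  refine tp_eq l (blk_isHermitian _ _ hK) ?_ ?_
  · rw [pen_blk l hK]; exact hP.posSemidef.conjTranspose_mul_mul_same _
  · rw [pen_blk l hK]
    intro h
    have hne : (Fin.cons 1 y : Fin (m + 2) → ℂ) ≠ 0 := fun h => by simpa using congrFun h 0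
    have := h.dotProduct_mulVec_pos hne
    rw [← Matrix.mulVec_mulVec, BB_null, mulVec_zero, dotProduct_zero] at this
    exact lt_irrefl _ this

lemma BB_mul {m : ℕ} (y : VV m) : BB y * (BB y)ᴴ = 1 + vecMulVec y (star y) := by
  ext i j
  rw [Matrix.mul_apply, Fin.sum_univ_succ]
  simp [BB, Matrix.one_apply, vecMulVec_apply]
  rw [add_comm]

/-- scalar for the root -/
noncomputable def tc (q : ℝ) : ℝ := (√(1 + q))⁻¹ ^ 2 / (1 + (√(1 + q))⁻¹)

lemma tc_eq {q : ℝ} (hq : 0 ≤ q) : 1 - 2 * tc q * (1 + q) + tc q ^ 2 * q * (1 + q) = 0 := by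
  have hs : 0 < √(1 + q) := Real.sqrt_pos.2 (by linarith)
  have h2 : √(1 + q) ^ 2 = 1 + q := Real.sq_sqrt (by linarith)
  unfold tc
  set s := √(1 + q)
  have hq' : q = s ^ 2 - 1 := by linarith
  rw [hq']
  field_simp
  ring

/-- inverse square root of `1 + y y*` -/
noncomputable def Rm {m : ℕ} (y : VV m) : Mat m := 1 - (tc (nsq y) : ℂ) • vecMulVec y (star y)

lemma nsq_nonneg {m : ℕ} (y : VV m) : 0 ≤ nsq y := by unfold nsq; positivity

lemma Rm_isHermitian {m : ℕ} (y : VV m) : (Rm y).IsHermitian := by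
  ext i j
  simp [Rm, vecMulVec_apply, Matrix.one_apply, Matrix.conjTranspose_apply, apply_ite]
  rw [mul_comm (y i)]; simp [eq_comm]

lemma Rm_mul {m : ℕ} (y : VV m) : Rm y * (1 + vecMulVec y (star y)) * Rm y = 1 := by
  have hW : vecMulVec y (star y) * vecMulVec y (star y) = (nsq y : ℂ) • vecMulVec y (star y) := by
    rw [vecMulVec_mul_vecMulVec, vec_qf, vecMulVec_smul]
  have ht := tc_eq (nsq_nonneg y)
  unfold Rm
  set W := vecMulVec y (star y)
  set t : ℂ := (tc (nsq y) : ℂ) with htd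
  set q : ℂ := (nsq y : ℂ) with hqd
  have ht' : 1 - 2 * t * (1 + q) + t ^ 2 * q * (1 + q) = 0 := by
    rw [htd, hqd]; exact_mod_cast ht
  have : (1 - t • W) * (1 + W) * (1 - t • W) = 1 + (1 - 2 * t * (1 + q) + t ^ 2 * q * (1 + q)) • W := by
    simp only [mul_add, add_mul, mul_sub, sub_mul, one_mul, mul_one, smul_mul_assoc, mul_smul_comm, hW, smul_smul]
    module
  rw [this, ht', zero_smul, add_zero]

lemma Rm_isUnit {m : ℕ} (y : VV m) : IsUnit (Rm y) := by
  have := Rm_mul y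
  rw [mul_assoc] at this
  exact IsUnit.of_mul_eq_one _ this

/-- partial isometry -/
noncomputable def Vm {m : ℕ} (y : VV m) : Matrix (Fin m) (Fin (m + 1)) ℂ := Rm y * BB y

lemma Vm_mul {m : ℕ} (y : VV m) : Vm y * (Vm y)ᴴ = 1 := by
  unfold Vm
  rw [conjTranspose_mul, (Rm_isHermitian y).eq]
  calc _ = Rm y * (BB y * (BB y)ᴴ) * Rm y := by simp only [Matrix.mul_assoc]
    _ = 1 := by rw [BB_mul, Rm_mul]

/-- the deflated matrix back-transformed -/
noncomputable def Km {m : ℕ} (l : ℝ) (y : VV m) (M : Mat m) : Mat m :=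
  (l : ℂ) • (1 - Rm y * Rm y) + Rm y * M * Rm y

lemma Km_isHermitian {m : ℕ} (l : ℝ) (y : VV m) {M : Mat m} (hM : M.IsHermitian) : (Km l y M).IsHermitian := by
  have hR := Rm_isHermitian y
  unfold Km
  rw [IsHermitian, conjTranspose_add, conjTranspose_smul, conjTranspose_sub, conjTranspose_mul, conjTranspose_mul,
    conjTranspose_mul, hR.eq, hM.eq]
  simp [Matrix.mul_assoc]

lemma pen_Km {m : ℕ} (l : ℝ) (y : VV m) (M : Mat m) : pen l (Km l y M) = Rm y * pen l M * Rm y := by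
  unfold pen Km
  rw [Matrix.mul_sub, Matrix.sub_mul, Matrix.mul_smul, Matrix.smul_mul, Matrix.mul_one, smul_sub]
  abel

lemma pen_Km_posDef {m : ℕ} (l : ℝ) (y : VV m) (M : Mat m) : (pen l (Km l y M)).PosDef ↔ (pen l M).PosDef := by
  rw [pen_Km]
  have := (Rm_isUnit y).posDef_star_left_conjugate_iff (x := pen l M)
  rwa [star_eq_conjTranspose, (Rm_isHermitian y).eq] at this

/-- the bordered matrix -/
noncomputable def Hm {m : ℕ} (l : ℝ) (y : VV m) (K : Mat m) : Mat (m + 1) :=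
  blk (l - qf (pen l K) y) (pen l K *ᵥ y) K

lemma Hm_eq {m : ℕ} (l : ℝ) (y : VV m) {M : Mat m} (hM : M.IsHermitian) :
    Hm l y (Km l y M) = (l : ℂ) • (1 - (Vm y)ᴴ * Vm y) + (Vm y)ᴴ * M * Vm y := by
  have h := pen_blk l (Km_isHermitian l y hM) y
  rw [pen_Km] at h
  have h2 : (BB y)ᴴ * (Rm y * pen l M * Rm y) * BB y = (Vm y)ᴴ * pen l M * Vm y := by
    unfold Vm; rw [conjTranspose_mul, (Rm_isHermitian y).eq]; simp only [Matrix.mul_assoc]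
  rw [h2] at h
  have h3 : Hm l y (Km l y M) = (l : ℂ) • 1 - pen l (Hm l y (Km l y M)) := by unfold pen; abel
  rw [h3]
  have h4 : pen l (Hm l y (Km l y M)) = (Vm y)ᴴ * pen l M * Vm y := by
    rw [← h, Hm, pen_Km]
  rw [h4]
  unfold pen
  rw [Matrix.mul_sub, Matrix.sub_mul, Matrix.mul_smul, Matrix.smul_mul, Matrix.mul_one, smul_sub]
  abel

lemma bt_Hm {m : ℕ} (l : ℝ) (y : VV (m + 1)) {M : Mat (m + 1)} (hM : M.IsHermitian) (hl : (pen l M).PosDef) :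
    bt (Hm l y (Km l y M)) = bt M := by
  have hH : (Hm l y (Km l y M)).IsHermitian := blk_isHermitian _ _ (Km_isHermitian l y hM)
  have hV := Vm_mul y
  refine eq_of_forall_le_iff fun t => ?_
  rw [le_bt_iff hH]
  constructor
  · intro h
    rw [le_bt_iff hM]
    have h2 := h.conjTranspose_mul_mul_same (Vm y)ᴴ
    rw [conjTranspose_conjTranspose, Hm_eq l y hM] at h2
    convert h2 using 1
    set V := Vm y
    symm
    calc V * ((l : ℂ) • (1 - Vᴴ * V) + Vᴴ * M * V - (t : ℂ) • 1) * Vᴴ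
        = (l : ℂ) • (V * Vᴴ - (V * Vᴴ) * (V * Vᴴ)) + (V * Vᴴ) * M * (V * Vᴴ) - (t : ℂ) • (V * Vᴴ) := by
          simp only [Matrix.mul_add, Matrix.add_mul, Matrix.mul_sub, Matrix.sub_mul, Matrix.mul_smul, Matrix.smul_mul,
            Matrix.mul_one, Matrix.mul_assoc]
      _ = _ := by rw [hV]; simp
  · intro h
    have hlt : t ≤ l := h.trans ((bt_le_tp hM).trans ((tp_lt_iff hM l).2 hl).le)
    rw [le_bt_iff hM] at h
    rw [Hm_eq l y hM]
    set V := Vm y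
    have e : (l : ℂ) • (1 - Vᴴ * V) + Vᴴ * M * V - (t : ℂ) • 1 =
        ((l - t : ℝ) : ℂ) • ((1 - Vᴴ * V)ᴴ * (1 - Vᴴ * V)) + Vᴴ * (M - (t : ℂ) • 1) * V := by
      have e1 : (1 - Vᴴ * V)ᴴ * (1 - Vᴴ * V) = 1 - Vᴴ * V := by
        rw [conjTranspose_sub, conjTranspose_one, conjTranspose_mul, conjTranspose_conjTranspose]
        have : Vᴴ * V * (Vᴴ * V) = Vᴴ * V := by
          calc _ = Vᴴ * (V * Vᴴ) * V := by simp only [Matrix.mul_assoc]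
            _ = _ := by rw [hV, Matrix.mul_one]
        rw [Matrix.mul_sub, Matrix.sub_mul, Matrix.sub_mul, this]; simp
      rw [e1, Matrix.mul_sub, Matrix.sub_mul, Matrix.mul_smul, Matrix.smul_mul, Matrix.mul_one]
      push_cast
      module
    rw [e]
    refine PosSemidef.add ?_ (h.conjTranspose_mul_mul_same V)
    refine (posSemidef_conjTranspose_mul_self _).smul ?_
    exact_mod_cast sub_nonneg.2 hlt

lemma FN_trace {m : ℕ} (A : Mat m) : (FN A : ℂ) = trace (A * Aᴴ) := by
  simp only [FN, trace, Matrix.diag, Matrix.mul_apply, conjTranspose_apply, Complex.ofReal_sum]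
  refine Finset.sum_congr rfl fun i _ => Finset.sum_congr rfl fun j _ => ?_
  rw [Complex.sq_norm, Complex.normSq_eq_conj_mul_self, mul_comm]; rfl

lemma FN_Hm {m : ℕ} (l : ℝ) (y : VV m) {M : Mat m} (hM : M.IsHermitian) :
    FN (Hm l y (Km l y M)) = l ^ 2 + FN M := by
  have hH : (Hm l y (Km l y M)).IsHermitian := blk_isHermitian _ _ (Km_isHermitian l y hM)
  have hV := Vm_mul y
  have : (FN (Hm l y (Km l y M)) : ℂ) = ((l ^ 2 + FN M : ℝ) : ℂ) := by
    push_cast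
    rw [FN_trace, FN_trace, hH.eq, hM.eq, Hm_eq l y hM]
    set V := Vm y
    have hA : (1 - Vᴴ * V) * Vᴴ = 0 := by
      rw [Matrix.sub_mul, Matrix.mul_assoc, hV]; simp
    have hB : V * (1 - Vᴴ * V) = 0 := by
      rw [Matrix.mul_sub, ← Matrix.mul_assoc, hV]; simp
    have h1 : ((l : ℂ) • (1 - Vᴴ * V) + Vᴴ * M * V) * ((l : ℂ) • (1 - Vᴴ * V) + Vᴴ * M * V) =
        ((l : ℂ) ^ 2) • (1 - Vᴴ * V) + Vᴴ * (M * M) * V := by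
      have e1 : (1 - Vᴴ * V) * (1 - Vᴴ * V) = 1 - Vᴴ * V := by
        rw [Matrix.mul_sub, ← Matrix.mul_assoc, hA]; simp
      have e2 : (1 - Vᴴ * V) * (Vᴴ * M * V) = 0 := by
        rw [Matrix.mul_assoc, ← Matrix.mul_assoc, hA, Matrix.zero_mul]
      have e3 : (Vᴴ * M * V) * (1 - Vᴴ * V) = 0 := by
        rw [Matrix.mul_assoc, hB, Matrix.mul_zero]
      have e4 : (Vᴴ * M * V) * (Vᴴ * M * V) = Vᴴ * (M * M) * V := by
        calc _ = Vᴴ * M * (V * Vᴴ) * (M * V) := by simp only [Matrix.mul_assoc]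
          _ = _ := by rw [hV]; simp only [Matrix.mul_assoc, Matrix.one_mul]
      rw [Matrix.mul_add, Matrix.add_mul, Matrix.add_mul, Matrix.smul_mul, Matrix.mul_smul, Matrix.mul_smul, Matrix.smul_mul,
        e1, e2, e3, e4, smul_smul, ← sq]
      simp
    have h2 : ∀ X : Mat m, trace (Vᴴ * X * V) = trace X := fun X => by
      rw [trace_mul_comm, ← Matrix.mul_assoc, hV, Matrix.one_mul]
    have h3 : trace (Vᴴ * V) = m := by
      rw [trace_mul_comm, hV]; simp
    rw [h1, trace_add, h2, trace_smul, trace_sub, h3]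
    simp
  exact_mod_cast this

lemma FN_blk {m : ℕ} (h : ℝ) (g : VV m) (K : Mat m) : FN (blk h g K) = h ^ 2 + 2 * nsq g + FN K := by
  have e : blk h g K = blk' (h : ℂ) (star g) g K := rfl
  rw [e, FN_blk']
  have : nsq (star g) = nsq g := by simp [nsq]
  rw [this, Complex.norm_real, Real.norm_eq_abs, sq_abs]; ring

lemma FN_herm {m : ℕ} (G : Mat m) : FN G = FN (herm G) + FN (G - herm G) := by
  have h : (FN G : ℂ) = ((FN (herm G) + FN (G - herm G) : ℝ) : ℂ) := by
    push_cast
    have e1 : (G - herm G)ᴴ = -(G - herm G) := by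
      rw [conjTranspose_sub, (herm_isHermitian G).eq]; unfold herm; ext i j; simp; ring
    have e2 : Gᴴ = herm G - (G - herm G) := by unfold herm; ext i j; simp; ring
    have e3 : G = herm G + (G - herm G) := by abel
    rw [FN_trace, FN_trace, FN_trace, (herm_isHermitian G).eq, e1, e2]
    generalize hC : G - herm G = C at e3 ⊢
    generalize herm G = A at e3 ⊢
    rw [e3, Matrix.add_mul, Matrix.mul_sub, Matrix.mul_sub, Matrix.mul_neg, trace_add, trace_sub, trace_sub, trace_neg, trace_mul_comm A C]
    ring
  exact_mod_cast h
end GUEx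

namespace GUEx
open MeasureTheory ProbabilityTheory Matrix
open scoped ComplexOrder Topology ENNReal

/-- resolvent applied to g -/
noncomputable def yv {m : ℕ} (l : ℝ) (K : Mat m) (g : VV m) : VV m := (pen l K)⁻¹ *ᵥ g

lemma pd_unit {m : ℕ} {P : Mat m} (hP : P.PosDef) : IsUnit P.det :=
  isUnit_iff_ne_zero.2 hP.det_pos.ne'

lemma pen_yv {m : ℕ} {l : ℝ} {K : Mat m} (hP : (pen l K).PosDef) (g : VV m) : pen l K *ᵥ yv l K g = g := by
  rw [yv, mulVec_mulVec, Matrix.mul_nonsing_inv _ (pd_unit hP), one_mulVec]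

/-- secular function -/
noncomputable def rho {m : ℕ} (K : Mat m) (g : VV m) (l : ℝ) : ℝ := l - qf (pen l K) (yv l K g)

lemma tp_rho {n : ℕ} {l : ℝ} {K : Mat (n + 1)} (hK : K.IsHermitian) (hl : tp K < l) (g : VV (n + 1)) :
    tp (blk (rho K g l) g K) = l := by
  have hP := (tp_lt_iff hK l).1 hl
  have := tp_blk l hK hP (yv l K g)
  rwa [pen_yv hP] at this

lemma qf_yv {m : ℕ} {l : ℝ} {K : Mat m} (hK : K.IsHermitian) (hP : (pen l K).PosDef) (g : VV m) :
    qf (pen l K) (yv l K g) = (star g ⬝ᵥ (pen l K)⁻¹ *ᵥ g).re := by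
  unfold qf
  rw [pen_yv hP, ← Complex.conj_re]
  congr 1
  change star _ = _
  rw [← star_dotProduct_star, star_star, dotProduct_comm]
  exact dotProduct_comm _ _

lemma hasDerivAt_rho {n : ℕ} {l : ℝ} {K : Mat (n + 1)} (hK : K.IsHermitian) (hl : tp K < l) (g : VV (n + 1)) :
    HasDerivAt (rho K g) (1 + nsq (yv l K g)) l := by
  have hP := (tp_lt_iff hK l).1 hl
  rw [hasDerivAt_iff_tendsto_slope]
  have hev : ∀ᶠ t in 𝓝[≠] l, slope (rho K g) l t = 1 + (star g ⬝ᵥ ((pen t K)⁻¹ * (pen l K)⁻¹) *ᵥ g).re := by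
    have h1 : ∀ᶠ t in 𝓝[≠] l, tp K < t := nhdsWithin_le_nhds (lt_mem_nhds hl)
    filter_upwards [h1, self_mem_nhdsWithin] with t ht hne
    have hPt := (tp_lt_iff hK t).1 ht
    have hne' : t - l ≠ 0 := sub_ne_zero.2 hne
    have hdiff : (pen t K)⁻¹ - (pen l K)⁻¹ = -((t - l : ℝ) : ℂ) • ((pen t K)⁻¹ * (pen l K)⁻¹) := by
      have e : pen l K - pen t K = -((t - l : ℝ) : ℂ) • 1 := by
        unfold pen; push_cast; module
      calc (pen t K)⁻¹ - (pen l K)⁻¹ = (pen t K)⁻¹ * (pen l K - pen t K) * (pen l K)⁻¹ := by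
            rw [Matrix.mul_sub, Matrix.sub_mul, Matrix.nonsing_inv_mul _ (pd_unit hPt), Matrix.mul_assoc,
              Matrix.mul_nonsing_inv _ (pd_unit hP)]; simp
        _ = _ := by rw [e, Matrix.mul_smul, Matrix.smul_mul, Matrix.mul_one]
    have h2 : (star g ⬝ᵥ (pen t K)⁻¹ *ᵥ g).re - (star g ⬝ᵥ (pen l K)⁻¹ *ᵥ g).re =
        -(t - l) * (star g ⬝ᵥ ((pen t K)⁻¹ * (pen l K)⁻¹) *ᵥ g).re := by
      rw [← Complex.sub_re, ← dotProduct_sub, ← sub_mulVec, hdiff, smul_mulVec, dotProduct_smul, smul_eq_mul,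
        ← Complex.ofReal_neg, Complex.re_ofReal_mul]
    rw [slope_def_field, rho, rho, qf_yv hK hPt, qf_yv hK hP, div_eq_iff hne']
    linear_combination -h2
  refine Filter.Tendsto.congr' (hev.mono fun _ h => h.symm) ?_
  have hlim : (1 + nsq (yv l K g)) = 1 + (star g ⬝ᵥ ((pen l K)⁻¹ * (pen l K)⁻¹) *ᵥ g).re := by
    have h : (nsq (yv l K g) : ℂ) = star g ⬝ᵥ ((pen l K)⁻¹ * (pen l K)⁻¹) *ᵥ g := by
      rw [← vec_qf, yv, star_mulVec, conjTranspose_nonsing_inv, (pen_isHermitian l hK).eq, ← mulVec_mulVec,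
        ← dotProduct_mulVec]
    rw [← h, Complex.ofReal_re]
  rw [hlim]
  have hpc : Continuous (fun t : ℝ => pen t K) := by unfold pen; fun_prop
  have hc : ContinuousAt (fun t : ℝ => (pen t K)⁻¹) l := by
    have hd : ContinuousAt (fun t : ℝ => (pen t K).det⁻¹ • (pen t K).adjugate) l := by
      refine ContinuousAt.smul (ContinuousAt.inv₀ hpc.matrix_det.continuousAt hP.det_pos.ne') ?_
      exact hpc.matrix_adjugate.continuousAt
    refine hd.congr ?_
    exact Filter.Eventually.of_forall fun t => by simp only [Matrix.inv_def, Ring.inverse_eq_inv']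
  have hc2 : ContinuousAt (fun t : ℝ => 1 + (star g ⬝ᵥ ((pen t K)⁻¹ * (pen l K)⁻¹) *ᵥ g).re) l := by
    have hcc : Continuous (fun A : Mat (n + 1) => 1 + (star g ⬝ᵥ (A * (pen l K)⁻¹) *ᵥ g).re) := by fun_prop
    exact hcc.continuousAt.comp hc
  exact hc2.tendsto.mono_left nhdsWithin_le_nhds

lemma pen_blk_sub {m : ℕ} (l h k : ℝ) (g : VV m) (K : Mat m) (x : Fin (m + 1) → ℂ) :
    star x ⬝ᵥ (pen l (blk h g K)) *ᵥ x = star x ⬝ᵥ (pen l (blk k g K)) *ᵥ x + ((k - h : ℝ) : ℂ) * (star (x 0) * x 0) := by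
  have e : pen l (blk h g K) = pen l (blk k g K) + Matrix.single 0 0 ((k - h : ℝ) : ℂ) := by
    ext i j
    refine Fin.cases ?_ (fun i => ?_) i <;> refine Fin.cases ?_ (fun j => ?_) j <;>
      simp [pen, blk, Matrix.single_apply, (Fin.succ_ne_zero _).symm]
  rw [e, add_mulVec, dotProduct_add]
  congr 1
  simp only [dotProduct, mulVec, Matrix.single_apply, Pi.star_apply]
  rw [Fin.sum_univ_succ, Fin.sum_univ_succ]
  simp [(Fin.succ_ne_zero _).symm]
  ring

lemma pen_blk_cons {m : ℕ} (l h : ℝ) (g : VV m) (K : Mat m) (v : VV m) :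
    (pen l (blk h g K)) *ᵥ (Fin.cons 0 v : Fin (m + 1) → ℂ) = Fin.cons (-(star g ⬝ᵥ v)) (pen l K *ᵥ v) := by
  ext i
  refine Fin.cases ?_ (fun i => ?_) i
  · simp [mulVec, dotProduct, Fin.sum_univ_succ, pen, blk, (Fin.succ_ne_zero _).symm]
  · simp [mulVec, dotProduct, Fin.sum_univ_succ, pen, blk, Matrix.one_apply]

lemma top_vec {n : ℕ} {K : Mat (n + 1)} (hK : K.IsHermitian) : ∃ v : VV (n + 1), v ≠ 0 ∧ pen (tp K) K *ᵥ v = 0 := by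
  have h1 := (tp_le_iff hK (tp K)).1 le_rfl
  have h2 : ¬ (pen (tp K) K).PosDef := fun h => lt_irrefl _ ((tp_lt_iff hK _).2 h)
  rw [h1.posDef_iff_det_ne_zero, not_not] at h2
  exact Matrix.exists_mulVec_eq_zero_iff.2 h2

lemma rho_surj {n : ℕ} {K : Mat (n + 1)} (hK : K.IsHermitian) {v : VV (n + 1)}
    (hv : pen (tp K) K *ᵥ v = 0) {g : VV (n + 1)} (hg : star g ⬝ᵥ v ≠ 0) (h : ℝ) :
    ∃ l, tp K < l ∧ rho K g l = h := by
  set H := blk h g K with hH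
  have hHh : H.IsHermitian := blk_isHermitian _ _ hK
  set l := tp H with hl
  have hps := (tp_le_iff hHh l).1 le_rfl
  have hnpd : ¬ (pen l H).PosDef := fun h => lt_irrefl _ ((tp_lt_iff hHh _).2 h)
  have hquad : ∀ w : VV (n + 1), star (Fin.cons 0 w : Fin (n + 2) → ℂ) ⬝ᵥ pen l H *ᵥ (Fin.cons 0 w : Fin (n + 2) → ℂ) =
      star w ⬝ᵥ pen l K *ᵥ w := by
    intro w
    rw [hH, pen_blk_cons]
    simp [dotProduct, Fin.sum_univ_succ]
  have hPs : (pen l K).PosSemidef := by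
    refine PosSemidef.of_dotProduct_mulVec_nonneg (pen_isHermitian l hK) fun w => ?_
    rw [← hquad]; exact hps.dotProduct_mulVec_nonneg _
  have hle : tp K ≤ l := (tp_le_iff hK l).2 hPs
  have hlt : tp K < l := by
    refine lt_of_le_of_ne hle fun heq => hg ?_
    rw [heq] at hv
    have h0 : star (Fin.cons 0 v : Fin (n + 2) → ℂ) ⬝ᵥ pen l H *ᵥ (Fin.cons 0 v : Fin (n + 2) → ℂ) = 0 := by
      rw [hquad, hv, dotProduct_zero]
    rw [hps.dotProduct_mulVec_zero_iff, hH, pen_blk_cons] at h0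
    simpa using congrFun h0 0
  refine ⟨l, hlt, ?_⟩
  have hP := (tp_lt_iff hK l).1 hlt
  have hform : ∀ x : Fin (n + 2) → ℂ, star x ⬝ᵥ pen l H *ᵥ x =
      star (BB (yv l K g) *ᵥ x) ⬝ᵥ pen l K *ᵥ (BB (yv l K g) *ᵥ x) + ((rho K g l - h : ℝ) : ℂ) * (star (x 0) * x 0) := by
    intro x
    rw [hH, pen_blk_sub l h (rho K g l)]
    congr 1
    have := pen_blk l hK (yv l K g)
    rw [pen_yv hP] at this
    rw [rho, this, star_mulVec, ← mulVec_mulVec, ← mulVec_mulVec, ← dotProduct_mulVec]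
  rcases lt_trichotomy (rho K g l) h with hlt2 | heq | hgt
  · exfalso
    have h1 := hps.dotProduct_mulVec_nonneg (Fin.cons 1 (yv l K g) : Fin (n + 2) → ℂ)
    rw [hform, BB_null, mulVec_zero, dotProduct_zero] at h1
    simp only [Fin.cons_zero, star_one, one_mul, mul_one, zero_add] at h1
    have h2 : (0 : ℝ) ≤ rho K g l - h := by exact_mod_cast h1
    linarith
  · exact heq
  · exfalso
    refine hnpd (PosDef.of_dotProduct_mulVec_pos (pen_isHermitian l hHh) fun x hx => ?_)
    rw [hform]
    have hpos : (0 : ℂ) < ((rho K g l - h : ℝ) : ℂ) := by exact_mod_cast sub_pos.2 hgt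
    by_cases hx0 : x 0 = 0
    · have hB : BB (yv l K g) *ᵥ x ≠ 0 := by
        intro hz
        apply hx
        have hz' : ∀ i, x (Fin.succ i) = 0 := fun i => by
          have := congrFun hz i
          simpa [BB, mulVec, dotProduct, Fin.sum_univ_succ, hx0, Matrix.one_apply] using this
        ext i
        exact Fin.cases hx0 hz' i
      rw [hx0]
      simpa using hP.dotProduct_mulVec_pos hB
    · refine add_pos_of_nonneg_of_pos (hP.posSemidef.dotProduct_mulVec_nonneg _) (mul_pos hpos ?_)
      exact lt_of_le_of_ne (star_mul_self_nonneg _) (Ne.symm (by simpa using hx0))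

lemma step1 {n : ℕ} {K : Mat (n + 1)} (hK : K.IsHermitian) {v : VV (n + 1)}
    (hv : pen (tp K) K *ᵥ v = 0) {g : VV (n + 1)} (hg : star g ⬝ᵥ v ≠ 0) (F : ℝ → ℝ≥0∞) :
    ∫⁻ h, F h = ∫⁻ l in Set.Ioi (tp K), ENNReal.ofReal (1 + nsq (yv l K g)) * F (rho K g l) := by
  have himg : rho K g '' Set.Ioi (tp K) = Set.univ := by
    ext h; simp only [Set.mem_image, Set.mem_Ioi, Set.mem_univ, iff_true]
    exact rho_surj hK hv hg h
  have hinj : Set.InjOn (rho K g) (Set.Ioi (tp K)) := by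
    intro a ha b hb hab
    rw [← tp_rho hK ha g, ← tp_rho hK hb g, hab]
  have := lintegral_image_eq_lintegral_abs_deriv_mul measurableSet_Ioi
    (fun l (hl : tp K < l) => (hasDerivAt_rho hK hl g).hasDerivWithinAt) hinj F
  rw [himg, Measure.restrict_univ] at this
  rw [this]
  refine setLIntegral_congr_fun measurableSet_Ioi fun l _ => ?_
  rw [abs_of_nonneg (by have := nsq_nonneg (yv l K g); linarith)]

lemma bad_null {m : ℕ} {v : VV m} (hv : v ≠ 0) : ∀ᵐ g : VV m, star g ⬝ᵥ v ≠ 0 := by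
  let f : VV m →ₗ[ℝ] ℂ :=
    { toFun := fun g => star g ⬝ᵥ v
      map_add' := fun a b => by simp [add_dotProduct]
      map_smul' := fun c a => by simp [smul_dotProduct] }
  have hne : LinearMap.ker f ≠ ⊤ := by
    intro h
    have : v ∈ LinearMap.ker f := h ▸ Submodule.mem_top
    have h2 : star v ⬝ᵥ v = 0 := this
    exact hv (dotProduct_star_self_eq_zero.1 (by rwa [dotProduct_comm] at h2))
  have := Measure.addHaar_submodule volume _ hne
  rw [ae_iff]
  convert this using 2
  ext g; simp [f]
end GUEx

namespace GUEx
open MeasureTheory ProbabilityTheory Matrix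
open scoped ComplexOrder Topology ENNReal

/-- integrand after the change of variables -/
noncomputable def Xi {n : ℕ} (F : ℝ × ℝ → ℝ≥0∞) (l : ℝ) (y : VV (n + 1)) (G : Mat (n + 1)) : ℝ≥0∞ :=
  (DD n).indicator (fun _ => F (l, bt (herm (Hm l y (herm G)))) * ENNReal.ofReal (1 + nsq y) *
    ge ((l - qf (PP (l, G)) y) ^ 2 / 2 + nsq (PP (l, G) *ᵥ y) + FN G / 2)) (l, G)

lemma measurable_Xi {n : ℕ} {F : ℝ × ℝ → ℝ≥0∞} (hF : Measurable F) {α : Type*} [MeasurableSpace α]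
    {l : α → ℝ} {y : α → VV (n + 1)} {G : α → Mat (n + 1)} (hl : Measurable l) (hy : Measurable y) (hG : Measurable G) :
    Measurable (fun a => Xi F (l a) (y a) (G a)) := by
  suffices h : Measurable (fun p : ℝ × VV (n + 1) × Mat (n + 1) => Xi F p.1 p.2.1 p.2.2) from
    Measurable.comp (g := fun p : ℝ × VV (n + 1) × Mat (n + 1) => Xi F p.1 p.2.1 p.2.2)
      (f := fun a => (l a, y a, G a)) h (hl.prodMk (hy.prodMk hG))
  have e : (fun p : ℝ × VV (n + 1) × Mat (n + 1) => Xi F p.1 p.2.1 p.2.2) =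
      ((fun p : ℝ × VV (n + 1) × Mat (n + 1) => (p.1, p.2.2)) ⁻¹' DD n).indicator
      (fun p => F (p.1, bt (herm (Hm p.1 p.2.1 (herm p.2.2)))) * ENNReal.ofReal (1 + nsq p.2.1) *
        ge ((p.1 - qf (PP (p.1, p.2.2)) p.2.1) ^ 2 / 2 + nsq (PP (p.1, p.2.2) *ᵥ p.2.1) + FN p.2.2 / 2)) := by
    ext p; rfl
  rw [e]
  have hPc : Continuous (fun p : ℝ × VV (n + 1) × Mat (n + 1) => PP (p.1, p.2.2)) :=
    continuous_PP.comp (by fun_prop)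
  have hPy : Continuous (fun p : ℝ × VV (n + 1) × Mat (n + 1) => PP (p.1, p.2.2) *ᵥ p.2.1) :=
    hPc.matrix_mulVec (by fun_prop)
  have hq : Continuous (fun p : ℝ × VV (n + 1) × Mat (n + 1) => qf (PP (p.1, p.2.2)) p.2.1) := by
    unfold qf
    exact Complex.continuous_re.comp (Continuous.dotProduct (by fun_prop) hPy)
  have hH : Continuous (fun p : ℝ × VV (n + 1) × Mat (n + 1) => Hm p.1 p.2.1 (herm p.2.2)) := by
    unfold Hm
    exact continuous_blk (continuous_fst.sub hq) hPy (continuous_herm.comp (by fun_prop))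
  refine Measurable.indicator ?_ (isOpen_DD.preimage (by fun_prop)).measurableSet
  refine Measurable.mul (Measurable.mul ?_ ?_) ?_
  · exact hF.comp (measurable_fst.prodMk (measurable_bt_herm.comp hH.measurable))
  · have := continuous_nsq (n := n + 1)
    exact (ENNReal.continuous_ofReal.comp (by fun_prop)).measurable
  · have h1 := continuous_nsq (n := n + 1)
    have h2 := continuous_FN (n := n + 1)
    refine (continuous_ge.comp ?_).measurable
    refine (((continuous_fst.sub hq).pow 2).div_const 2 |>.add (h1.comp hPy)).add ?_
    exact (h2.comp (by fun_prop)).div_const 2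

lemma measurable_yv {n : ℕ} : Measurable (fun p : ℝ × VV n × Mat n => yv p.1 (herm p.2.2) p.2.1) := by
  have hPc : Continuous (fun p : ℝ × VV n × Mat n => PP (p.1, p.2.2)) :=
    continuous_PP.comp (by fun_prop)
  have hd := hPc.matrix_det.measurable
  have ha : Continuous (fun p : ℝ × VV n × Mat n => (PP (p.1, p.2.2)).adjugate *ᵥ p.2.1) :=
    hPc.matrix_adjugate.matrix_mulVec (by fun_prop)
  have e : (fun p : ℝ × VV n × Mat n => yv p.1 (herm p.2.2) p.2.1) =
    fun p => (PP (p.1, p.2.2)).det⁻¹ • ((PP (p.1, p.2.2)).adjugate *ᵥ p.2.1) := by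
    ext p : 1
    simp only [yv, Matrix.inv_def, Ring.inverse_eq_inv', smul_mulVec]
    rfl
  rw [e]
  exact hd.inv.smul ha.measurable

lemma measurable_yv2 {n : ℕ} {α : Type*} [MeasurableSpace α]
    {l : α → ℝ} {y : α → VV n} {G : α → Mat n} (hl : Measurable l) (hy : Measurable y) (hG : Measurable G) :
    Measurable (fun a => yv (l a) (herm (G a)) (y a)) :=
  Measurable.comp (g := fun p : ℝ × VV n × Mat n => yv p.1 (herm p.2.2) p.2.1)
    (f := fun a => (l a, y a, G a)) measurable_yv (hl.prodMk (hy.prodMk hG))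

lemma stepA {n : ℕ} (F : ℝ × ℝ → ℝ≥0∞) (G : Mat (n + 1)) : ∀ᵐ g : VV (n + 1),
    ∫⁻ h : ℝ, F (tp (herm (blk h g (herm G))), bt (herm (blk h g (herm G)))) * ge (h ^ 2 / 2 + nsq g + FN G / 2)
      = ∫⁻ l, Xi F l (yv l (herm G) g) G := by
  have hK := herm_isHermitian G
  obtain ⟨v, hv0, hv⟩ := top_vec hK
  filter_upwards [bad_null hv0] with g hg
  rw [step1 hK hv hg, ← lintegral_indicator measurableSet_Ioi]
  refine lintegral_congr fun l => ?_
  unfold Xi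
  by_cases hl : tp (herm G) < l
  · have hD : (l, G) ∈ DD n := hl
    rw [Set.indicator_of_mem (show l ∈ Set.Ioi _ from hl), Set.indicator_of_mem hD]
    have hP := (tp_lt_iff hK l).1 hl
    have e1 : Hm l (yv l (herm G) g) (herm G) = blk (rho (herm G) g l) g (herm G) := by
      unfold Hm rho; rw [pen_yv hP]
    rw [e1, herm_of_isHermitian (blk_isHermitian _ _ hK), tp_rho hK hl]
    have e2 : PP (l, G) = pen l (herm G) := rfl
    rw [e2, pen_yv hP]
    rw [rho]
    ring
  · have hD : (l, G) ∉ DD n := hl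
    rw [Set.indicator_of_notMem (show l ∉ Set.Ioi _ from hl), Set.indicator_of_notMem hD]

lemma stepC {n : ℕ} {F : ℝ × ℝ → ℝ≥0∞} (hF : Measurable F) (l : ℝ) (G : Mat (n + 1)) :
    ∫⁻ g : VV (n + 1), Xi F l (yv l (herm G) g) G = ∫⁻ y : VV (n + 1), ENNReal.ofReal (dr (l, G) ^ 2) * Xi F l y G := by
  by_cases hD : (l, G) ∈ DD n
  · have hP := (mem_DD _).1 hD
    have hu := pd_unit hP
    simp only at hP hu
    set P := pen l (herm G) with hPd
    let L : VV (n + 1) →ₗ[ℝ] VV (n + 1) := (Matrix.toLin' P).restrictScalars ℝ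
    have hdet : LinearMap.det L = dr (l, G) ^ 2 := by
      have h1 : P.det = (dr (l, G) : ℂ) := det_eq_dr (l, G)
      rw [LinearMap.det_restrictScalars, LinearMap.det_toLin', Algebra.norm_complex_apply, h1, Complex.normSq_ofReal]
      ring
    have hdr : dr (l, G) ≠ 0 := by
      intro h0
      have h1 : P.det = (dr (l, G) : ℂ) := det_eq_dr (l, G)
      rw [h1, h0] at hu; simp at hu
    rw [lint_affine volume L (by rw [hdet]; positivity) 0 (fun g => Xi F l (yv l (herm G) g) G)]
    · rw [hdet, abs_of_nonneg (by positivity), lintegral_const_mul]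
      · congr 1
        refine lintegral_congr fun y => ?_
        have : yv l (herm G) (L y + 0) = y := by
          rw [add_zero]
          change P⁻¹ *ᵥ (P *ᵥ y) = y
          rw [mulVec_mulVec, Matrix.nonsing_inv_mul _ hu, one_mulVec]
        rw [this]
      · exact measurable_Xi hF measurable_const measurable_id measurable_const
    · refine measurable_Xi hF measurable_const ?_ measurable_const
      exact measurable_yv2 measurable_const measurable_id measurable_const
  · simp [Xi, hD]

/-- the linear part of the conjugation -/
noncomputable def LL {m : ℕ} (y : VV m) : Mat m →ₗ[ℝ] Mat m where
  toFun G := Rm y * herm G * Rm y + (G - herm G)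
  map_add' a b := by rw [herm_add, Matrix.mul_add, Matrix.add_mul]; abel
  map_smul' c a := by
    rw [herm_smul]
    simp only [Matrix.mul_smul, Matrix.smul_mul, RingHom.id_apply, smul_add, smul_sub]
    rfl

lemma LL_apply {m : ℕ} (y : VV m) (G : Mat m) : LL y G = Rm y * herm G * Rm y + (G - herm G) := rfl

lemma herm_sub_herm {m : ℕ} (G : Mat m) : herm (G - herm G) = 0 := by
  rw [sub_eq_add_neg, herm_add, herm_neg, herm_of_isHermitian (herm_isHermitian G), add_neg_cancel]

lemma herm_LL {m : ℕ} (y : VV m) (G : Mat m) : herm (LL y G) = Rm y * herm G * Rm y := by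
  rw [LL_apply, herm_add, herm_sub_herm, add_zero, herm_of_isHermitian]
  rw [IsHermitian, conjTranspose_mul, conjTranspose_mul, (Rm_isHermitian y).eq, (herm_isHermitian G).eq, mul_assoc]

lemma LL_inj {m : ℕ} (y : VV m) : Function.Injective (LL y) := by
  rw [injective_iff_map_eq_zero]
  intro G hG
  have h1 := herm_LL y G
  rw [hG] at h1
  have h0 : herm (0 : Mat m) = 0 := by simp [herm]
  rw [h0] at h1
  have hR := Rm_isUnit y
  have h2 : herm G = 0 := by
    have h3 := (hR.mul_left_eq_zero).1 h1.symm
    exact (hR.mul_right_eq_zero).1 h3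
  rw [LL_apply, h2] at hG
  simpa using hG

lemma LL_det {m : ℕ} (y : VV m) : LinearMap.det (LL y) ≠ 0 := by
  have h := (LinearEquiv.ofInjectiveEndo (LL y) (LL_inj y)).isUnit_det'
  have e : ((LinearEquiv.ofInjectiveEndo (LL y) (LL_inj y)) : Mat m →ₗ[ℝ] Mat m) = LL y := by ext1; rfl
  rw [e] at h
  exact h.ne_zero

lemma continuous_Rm {m : ℕ} : Continuous (fun y : VV m => Rm y) := by
  have h : Continuous (fun y : VV m => tc (nsq y)) := by
    unfold tc
    have hn := continuous_nsq (n := m)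
    have h1 : Continuous (fun y : VV m => (√(1 + nsq y))⁻¹) := by
      refine Continuous.inv₀ (by fun_prop) fun y => ?_
      have := nsq_nonneg y
      positivity
    refine (h1.pow 2).div (continuous_const.add h1) fun y => ?_
    positivity
  unfold Rm
  refine continuous_const.sub (Continuous.smul (Complex.continuous_ofReal.comp h) ?_)
  refine continuous_matrix fun i j => ?_
  simp only [vecMulVec_apply]
  fun_prop

lemma continuous_LL_det {m : ℕ} : Continuous (fun y : VV m => LinearMap.det (LL y)) := by
  let b := Module.finBasis ℝ (Mat m)
  have e : (fun y : VV m => LinearMap.det (LL y)) = fun y => (LinearMap.toMatrix b b (LL y)).det := by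
    ext y; rw [LinearMap.det_toMatrix]
  rw [e]
  refine Continuous.matrix_det (continuous_matrix fun i j => ?_)
  simp only [LinearMap.toMatrix_apply]
  change Continuous (fun y => (b.coord i) (LL y (b j)))
  refine (LinearMap.continuous_of_finiteDimensional (b.coord i)).comp ?_
  simp only [LL_apply]
  have := continuous_Rm (m := m)
  fun_prop

/-- the weight in y -/
noncomputable def wy {m : ℕ} (y : VV m) : ℝ≥0∞ :=
  ENNReal.ofReal |LinearMap.det (LL y)| * (ENNReal.ofReal ((Rm y).det.re ^ 4) * ENNReal.ofReal (1 + nsq y))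

lemma measurable_wy {m : ℕ} : Measurable (wy (m := m)) := by
  have h1 := continuous_LL_det (m := m)
  have h2 := (continuous_Rm (m := m)).matrix_det
  have h3 := continuous_nsq (n := m)
  have m1 : Measurable (fun y : VV m => ENNReal.ofReal |LinearMap.det (LL y)|) :=
    (ENNReal.continuous_ofReal.comp h1.abs).measurable
  have m2 : Measurable (fun y : VV m => ENNReal.ofReal ((Rm y).det.re ^ 4)) :=
    (ENNReal.continuous_ofReal.comp ((Complex.continuous_re.comp h2).pow 4)).measurable
  have m3 : Measurable (fun y : VV m => ENNReal.ofReal (1 + nsq y)) :=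
    (ENNReal.continuous_ofReal.comp (by fun_prop)).measurable
  exact m1.mul (m2.mul m3)

lemma lint_affineM {m : ℕ} (L : Mat m →ₗ[ℝ] Mat m) (hL : LinearMap.det L ≠ 0) (b : Mat m) (f : Mat m → ℝ≥0∞)
    (hf : Measurable f) :
    ∫⁻ x, f x ∂(volM m) = ENNReal.ofReal |LinearMap.det L| * ∫⁻ x, f (L x + b) ∂(volM m) := by
  have : (volume : Measure (Fin m → ℂ)).IsAddHaarMeasure := inferInstance
  have : (volume : Measure (Fin m → Fin m → ℂ)).IsAddHaarMeasure := Measure.pi.isAddHaarMeasure _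
  exact lint_affine (E := Fin m → Fin m → ℂ) (volume : Measure (Fin m → Fin m → ℂ)) L hL b f hf

lemma cont_dr2 {n : ℕ} (l : ℝ) : Continuous (fun G : Mat (n + 1) => dr (l, G)) :=
  Complex.continuous_re.comp (continuous_PP.comp (by fun_prop : Continuous fun G : Mat (n + 1) => (l, G))).matrix_det

lemma stepE {n : ℕ} {F : ℝ × ℝ → ℝ≥0∞} (hF : Measurable F) (l : ℝ) (y : VV (n + 1)) :
    ∫⁻ G, ENNReal.ofReal (dr (l, G) ^ 2) * Xi F l y G ∂(volM (n + 1)) =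
      wy y * ∫⁻ G, (DD n).indicator (fun p => F (p.1, bt (herm p.2)) * ENNReal.ofReal (dr p ^ 2)) (l, G) *
        ge (l ^ 2 / 2 + FN G / 2) ∂(volM (n + 1)) := by
  have hm1 : Measurable (fun G : Mat (n + 1) => ENNReal.ofReal (dr (l, G) ^ 2) * Xi F l y G) := by
    refine Measurable.mul ?_ (measurable_Xi hF measurable_const measurable_const measurable_id)
    exact (ENNReal.continuous_ofReal.comp ((cont_dr2 l).pow 2)).measurable
  have hm2 : Measurable (fun G : Mat (n + 1) =>
      (DD n).indicator (fun p => F (p.1, bt (herm p.2)) * ENNReal.ofReal (dr p ^ 2)) (l, G) *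
        ge (l ^ 2 / 2 + FN G / 2)) := by
    have hFN := continuous_FN (n := n + 1)
    refine Measurable.mul ?_ (continuous_ge.comp (by fun_prop)).measurable
    suffices h : Measurable ((DD n).indicator (fun p => F (p.1, bt (herm p.2)) * ENNReal.ofReal (dr p ^ 2))) from
      h.comp (measurable_const.prodMk measurable_id)
    refine Measurable.indicator (Measurable.mul ?_ ?_) isOpen_DD.measurableSet
    · exact hF.comp (measurable_fst.prodMk (measurable_bt_herm.comp measurable_snd))
    · exact (ENNReal.continuous_ofReal.comp ((Complex.continuous_re.comp continuous_PP.matrix_det).pow 2)).measurable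
  rw [lint_affineM (LL y) (LL_det y) ((l : ℂ) • (1 - Rm y * Rm y)) _ hm1, wy, mul_assoc]
  congr 1
  rw [← lintegral_const_mul _ hm2]
  refine lintegral_congr fun G => ?_
  set G' := LL y G + (l : ℂ) • (1 - Rm y * Rm y) with hG'
  have hR := Rm_isHermitian y
  have hbH : ((l : ℂ) • (1 - Rm y * Rm y)).IsHermitian := by
    rw [IsHermitian, conjTranspose_smul, conjTranspose_sub, conjTranspose_mul, hR.eq]; simp
  have hherm : herm G' = Km l y (herm G) := by
    rw [hG', herm_add, herm_LL, herm_of_isHermitian hbH, Km]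
    exact add_comm _ _
  have hdiff : G' - herm G' = G - herm G := by
    rw [hherm, hG', Km, LL_apply]; abel
  have hDD : (l, G') ∈ DD n ↔ (l, G) ∈ DD n := by
    rw [mem_DD, mem_DD]; simp only; rw [hherm]; exact pen_Km_posDef _ _ _
  have hPP : PP (l, G') = Rm y * PP (l, G) * Rm y := by
    change pen l (herm G') = _
    rw [hherm, pen_Km]; rfl
  have hRd : (Rm y).det = ((Rm y).det.re : ℂ) := by
    have h : star (Rm y).det = (Rm y).det := by rw [← det_conjTranspose, hR.eq]
    exact (Complex.conj_eq_iff_re.1 h).symm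
  have hdr : dr (l, G') = (Rm y).det.re ^ 2 * dr (l, G) := by
    have h1 := det_eq_dr (l, G')
    rw [hPP, det_mul, det_mul, det_eq_dr, hRd] at h1
    have h2 : (((Rm y).det.re * dr (l, G) * (Rm y).det.re : ℝ) : ℂ) = (dr (l, G') : ℂ) := by
      push_cast; exact h1
    rw [← Complex.ofReal_injective h2]; ring
  by_cases hD : (l, G) ∈ DD n
  · have hD' := hDD.2 hD
    have hHm : (Hm l y (Km l y (herm G))).IsHermitian :=
      blk_isHermitian _ _ (Km_isHermitian l y (herm_isHermitian G))
    have hexp : (l - qf (PP (l, G')) y) ^ 2 / 2 + nsq (PP (l, G') *ᵥ y) + FN G' / 2 = l ^ 2 / 2 + FN G / 2 := by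
      have h1 := FN_Hm l y (herm_isHermitian G)
      rw [Hm, FN_blk, ← hherm] at h1
      have h2 := FN_herm G'
      have h3 := FN_herm G
      rw [hdiff] at h2
      change (l - qf (pen l (herm G')) y) ^ 2 / 2 + nsq (pen l (herm G') *ᵥ y) + FN G' / 2 = _
      linarith
    rw [Xi, Set.indicator_of_mem hD', Set.indicator_of_mem hD, hexp, hherm, herm_of_isHermitian hHm,
      bt_Hm l y (herm_isHermitian G) ((mem_DD _).1 hD), hdr]
    have : ((Rm y).det.re ^ 2 * dr (l, G)) ^ 2 = (Rm y).det.re ^ 4 * dr (l, G) ^ 2 := by ring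
    rw [this, ENNReal.ofReal_mul (by positivity)]
    ring
  · have hD' := fun h => hD (hDD.1 h)
    rw [Xi, Set.indicator_of_notMem hD', Set.indicator_of_notMem hD]
    simp

lemma deflate (n : ℕ) : ∃ Z : ℝ≥0∞, ∀ F : ℝ × ℝ → ℝ≥0∞, Measurable F →
    ∫⁻ G, F (tp (herm G), bt (herm G)) ∂(matrixGaussian (n + 2)) =
      Z * ∫⁻ p in DD n, F (p.1, bt (herm p.2)) * ENNReal.ofReal (dr p ^ 2) ∂(GG (n + 1)) := by
  obtain ⟨c, hc⟩ := blockLaw (n + 1)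
  refine ⟨c * (∫⁻ y : VV (n + 1), wy y) * (c0 * (c0 ^ 2) ^ ((n + 1) * (n + 1)))⁻¹, fun F hF => ?_⟩
  have hΦ : Measurable (fun H : Mat (n + 2) => F (tp (herm H), bt (herm H))) :=
    hF.comp (measurable_tp_herm.prodMk measurable_bt_herm)
  have hΨ : Measurable (fun p : ℝ × Mat (n + 1) => (DD n).indicator
      (fun p => F (p.1, bt (herm p.2)) * ENNReal.ofReal (dr p ^ 2)) p) := by
    refine Measurable.indicator (Measurable.mul ?_ ?_) isOpen_DD.measurableSet
    · exact hF.comp (measurable_fst.prodMk (measurable_bt_herm.comp measurable_snd))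
    · exact (ENNReal.continuous_ofReal.comp ((Complex.continuous_re.comp continuous_PP.matrix_det).pow 2)).measurable
  have h1 := hc _ hΦ
  simp only [herm_of_isHermitian (herm_isHermitian _)] at h1
  rw [← lintegral_indicator isOpen_DD.measurableSet, lint_GG _ hΨ]
  set J : ℝ → ℝ≥0∞ := fun l => ∫⁻ G, (DD n).indicator (fun p => F (p.1, bt (herm p.2)) * ENNReal.ofReal (dr p ^ 2)) (l, G) *
        ge (l ^ 2 / 2 + FN G / 2) ∂(volM (n + 1)) with hJ
  have hc0 : (c0 * (c0 ^ 2) ^ ((n + 1) * (n + 1))) ≠ 0 :=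
    mul_ne_zero c0_ne (pow_ne_zero _ (pow_ne_zero _ c0_ne))
  have hc1 : (c0 * (c0 ^ 2) ^ ((n + 1) * (n + 1))) ≠ ⊤ :=
    ENNReal.mul_ne_top c0_ne_top (ENNReal.pow_ne_top (ENNReal.pow_ne_top c0_ne_top))
  have hmJ : Measurable J := by
    have : Measurable (fun q : ℝ × Mat (n + 1) => (DD n).indicator (fun p => F (p.1, bt (herm p.2)) * ENNReal.ofReal (dr p ^ 2)) q *
        ge (q.1 ^ 2 / 2 + FN q.2 / 2)) := by
      have hFN := continuous_FN (n := n + 1)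
      exact hΨ.mul (continuous_ge.comp (by fun_prop)).measurable
    exact this.lintegral_prod_right'
  have h2 : c * (∫⁻ y : VV (n + 1), wy y) * (c0 * (c0 ^ 2) ^ ((n + 1) * (n + 1)))⁻¹ *
      ((c0 * (c0 ^ 2) ^ ((n + 1) * (n + 1))) * ∫⁻ l, J l) = c * ∫⁻ l, ∫⁻ y : VV (n + 1), wy y * J l := by
    rw [mul_assoc, ← mul_assoc _⁻¹, ENNReal.inv_mul_cancel hc0 hc1, one_mul, mul_assoc,
      ← lintegral_const_mul _ hmJ]
    congr 1
    refine lintegral_congr fun l => ?_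
    rw [lintegral_mul_const _ measurable_wy]
  rw [h2, h1]
  congr 1
  have hmA : Measurable (fun q : (VV (n + 1) × Mat (n + 1)) × ℝ =>
      F (tp (herm (blk q.2 q.1.1 (herm q.1.2))), bt (herm (blk q.2 q.1.1 (herm q.1.2)))) *
        ge (q.2 ^ 2 / 2 + nsq q.1.1 + FN q.1.2 / 2)) := by
    have hn := continuous_nsq (n := n + 1)
    have hFN := continuous_FN (n := n + 1)
    refine Measurable.mul ?_ (continuous_ge.comp (by fun_prop)).measurable
    exact hΦ.comp (continuous_blk (by fun_prop) (by fun_prop) (continuous_herm.comp (by fun_prop))).measurable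
  rw [lintegral_prod_symm' _ (by exact hmA.lintegral_prod_right')]
  have hB : ∀ G : Mat (n + 1), ∫⁻ g : VV (n + 1), ∫⁻ h : ℝ, F (tp (herm (blk h g (herm G))), bt (herm (blk h g (herm G)))) *
      ge (h ^ 2 / 2 + nsq g + FN G / 2) = ∫⁻ l, ∫⁻ y : VV (n + 1), ENNReal.ofReal (dr (l, G) ^ 2) * Xi F l y G := by
    intro G
    rw [lintegral_congr_ae (stepA F G), lintegral_lintegral_swap]
    · exact lintegral_congr fun l => stepC hF l G
    · refine Measurable.aemeasurable (measurable_Xi hF measurable_snd ?_ measurable_const)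
      exact measurable_yv2 measurable_snd measurable_fst measurable_const
  rw [lintegral_congr hB]
  have hdr : Measurable (fun p : ℝ × Mat (n + 1) => ENNReal.ofReal (dr p ^ 2)) :=
    (ENNReal.continuous_ofReal.comp ((Complex.continuous_re.comp continuous_PP.matrix_det).pow 2)).measurable
  rw [lintegral_lintegral_swap]
  · refine lintegral_congr fun l => ?_
    rw [lintegral_lintegral_swap]
    · exact lintegral_congr fun y => stepE hF l y
    · refine Measurable.aemeasurable (Measurable.mul ?_ (measurable_Xi hF measurable_const measurable_snd measurable_fst))
      exact hdr.comp (measurable_const.prodMk measurable_fst)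
  · refine Measurable.aemeasurable ?_
    have : Measurable (fun q : (Mat (n + 1) × ℝ) × VV (n + 1) => ENNReal.ofReal (dr (q.1.2, q.1.1) ^ 2) * Xi F q.1.2 q.2 q.1.1) := by
      refine Measurable.mul ?_ (measurable_Xi hF (by fun_prop) (by fun_prop) (by fun_prop))
      exact hdr.comp (by fun_prop)
    exact this.lintegral_prod_right'
end GUEx

namespace GUEx
open MeasureTheory ProbabilityTheory Matrix
open scoped ComplexOrder Topology ENNReal

lemma hasDerivAt_dr {n : ℕ} {l : ℝ} {G : Mat (n + 1)} (h : tp (herm G) < l) :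
    HasDerivAt (fun t => dr (t, G)) (jr (l, G)) l := by
  have hD : (l, G) ∈ DD n := h
  have hu := pd_unit ((mem_DD _).1 hD)
  have h1 := hasDerivAt_det (PP (l, G)) 1 hu
  rw [Matrix.mul_one] at h1
  have h2 : HasDerivAt (fun a : ℝ => (PP (l, G) + (a : ℂ) • (1 : Mat (n + 1))).det.re) (jr (l, G)) 0 := by
    exact (Complex.reCLM.hasFDerivAt.comp_hasDerivAt (0 : ℝ) h1)
  have h3 : HasDerivAt (fun t : ℝ => t - l) 1 l := (hasDerivAt_id l).sub_const l
  have h4 := HasDerivAt.comp (h₂ := fun a : ℝ => (PP (l, G) + (a : ℂ) • (1 : Mat (n + 1))).det.re) l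
    (by simpa using h2) h3
  rw [mul_one] at h4
  refine h4.congr_of_eventuallyEq (Filter.Eventually.of_forall fun t => ?_)
  simp only [Function.comp, dr, PP, pen]
  congr 2
  push_cast
  module

lemma slice {n : ℕ} {G : Mat (n + 1)} {l0 : ℝ} (h0 : tp (herm G) < l0)
    (hfin : ∫⁻ l, ENNReal.ofReal (dr (l, G) ^ 2) * ge (l ^ 2 / 2) < ⊤) :
    ENNReal.ofReal (dr (l0, G) ^ 2) * ge (l0 ^ 2 / 2) ≤
      ∫⁻ l in Set.Ioi (tp (herm G)), ENNReal.ofReal (|dr (l, G)| * |l * dr (l, G) - 2 * jr (l, G)|) * ge (l ^ 2 / 2) := by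
  set B := ∫⁻ l in Set.Ioi (tp (herm G)), ENNReal.ofReal (|dr (l, G)| * |l * dr (l, G) - 2 * jr (l, G)|) * ge (l ^ 2 / 2) with hB
  by_cases hBt : B = ⊤
  · rw [hBt]; exact le_top
  set f : ℝ → ℝ := fun l => dr (l, G) ^ 2 * Real.exp (-(l ^ 2 / 2)) with hf
  set f' : ℝ → ℝ := fun l => -(dr (l, G) * (l * dr (l, G) - 2 * jr (l, G))) * Real.exp (-(l ^ 2 / 2)) with hf'
  have cd : Continuous (fun l : ℝ => dr (l, G)) := cont_dr.comp (by fun_prop)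
  have cj : Continuous (fun l : ℝ => jr (l, G)) := cont_jr.comp (by fun_prop)
  have hfc : Continuous f := by fun_prop
  have hfc' : Continuous f' := by fun_prop
  have e1 : ∀ l, ‖f l‖ₑ = ENNReal.ofReal (dr (l, G) ^ 2) * ge (l ^ 2 / 2) := fun l => by
    rw [Real.enorm_eq_ofReal_abs, ge, ← ENNReal.ofReal_mul (by positivity), abs_of_nonneg]
    simp only [hf]; positivity
  have e2 : ∀ l, ‖f' l‖ₑ = ENNReal.ofReal (|dr (l, G)| * |l * dr (l, G) - 2 * jr (l, G)|) * ge (l ^ 2 / 2) := fun l => by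
    rw [Real.enorm_eq_ofReal_abs, ge, ← ENNReal.ofReal_mul (by positivity)]
    simp only [hf']
    rw [abs_mul, abs_neg, abs_mul, Real.abs_exp]
  have i1 : Integrable f := by
    refine ⟨hfc.aestronglyMeasurable, ?_⟩
    rw [HasFiniteIntegral]; simp only [e1]; exact hfin
  have i2 : IntegrableOn f' (Set.Ioi (tp (herm G))) := by
    refine ⟨hfc'.aestronglyMeasurable, ?_⟩
    rw [HasFiniteIntegral]; simp only [e2]; exact lt_top_iff_ne_top.2 hBt
  have hder : ∀ l, tp (herm G) < l → HasDerivAt f (f' l) l := by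
    intro l hl
    have h1 := (hasDerivAt_dr hl).pow 2
    have h2 : HasDerivAt (fun l : ℝ => Real.exp (-(l ^ 2 / 2))) (Real.exp (-(l ^ 2 / 2)) * (-(2 * l / 2))) l := by
      have := (((hasDerivAt_id l).pow 2).div_const 2).neg.exp
      simpa using this
    refine (h1.mul h2).congr_deriv ?_
    simp only [hf', Pi.pow_apply]; push_cast; ring
  have i3 : IntegrableOn f' (Set.Ioi l0) := i2.mono_set (Set.Ioi_subset_Ioi h0.le)
  have ht : Filter.Tendsto f Filter.atTop (𝓝 0) :=
    tendsto_zero_of_hasDerivAt_of_integrableOn_Ioi (a := l0)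
      (fun l hl => hder l (h0.trans hl)) i3 i1.integrableOn
  have hI := integral_Ioi_of_hasDerivAt_of_tendsto' (a := l0) (fun l hl => hder l (lt_of_lt_of_le h0 hl)) i3 ht
  rw [← e1]
  have : ‖f l0‖ₑ = ‖∫ l in Set.Ioi l0, f' l‖ₑ := by rw [hI, zero_sub, enorm_neg]
  rw [this]
  refine (enorm_integral_le_lintegral_enorm _).trans ?_
  simp only [e2]
  exact lintegral_mono_set (Set.Ioi_subset_Ioi h0.le)

lemma lint_sq_fin {n : ℕ} : ∀ᵐ G ∂(matrixGaussian (n + 1)), ∫⁻ l, ENNReal.ofReal (dr (l, G) ^ 2) * ge (l ^ 2 / 2) < ⊤ := by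
  have hi : Integrable (fun p : ℝ × Mat (n + 1) => (PP p).det * (PP p).det) (GG (n + 1)) :=
    integrable_PG (cont_d.mul cont_d) (PG_d.mul PG_d)
  have h2 : ∀ p : ℝ × Mat (n + 1), ‖(PP p).det * (PP p).det‖ₑ = ENNReal.ofReal (dr p ^ 2) := fun p => by
    rw [det_eq_dr, ← Complex.ofReal_mul, ← ofReal_norm_eq_enorm, Complex.norm_real, Real.norm_eq_abs, abs_of_nonneg (mul_self_nonneg _)]
    rw [sq]
  have h3 := hi.2
  rw [HasFiniteIntegral] at h3
  simp only [h2] at h3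
  have hm : Measurable (fun p : ℝ × Mat (n + 1) => ENNReal.ofReal (dr p ^ 2)) :=
    (ENNReal.continuous_ofReal.comp (cont_dr.pow 2)).measurable
  rw [lintegral_prod_symm' _ hm] at h3
  have := ae_lt_top (hm.lintegral_prod_left') h3.ne
  filter_upwards [this] with G hG
  rw [lint_gr _ (by exact hm.comp (by fun_prop))] at hG
  by_contra hc
  rw [not_lt, top_le_iff] at hc
  rw [hc, ENNReal.mul_top c0_ne] at hG
  exact absurd hG (lt_irrefl _)

lemma density_bound {n : ℕ} {S : Set (ℝ × ℝ)} (hS : MeasurableSet S) {κ : ℝ} (hκ : 0 ≤ κ)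
    (hvol : ∀ m : ℝ, volume {l : ℝ | (l, m) ∈ S} ≤ ENNReal.ofReal (κ * |m|)) :
    ∫⁻ p in DD n, S.indicator 1 (p.1, bt (herm p.2)) * ENNReal.ofReal (dr p ^ 2) ∂(GG (n + 1)) ≤
    ∫⁻ p in DD n, ENNReal.ofReal (κ * |bt (herm p.2)| * (|dr p| * |p.1 * dr p - 2 * jr p|)) ∂(GG (n + 1)) := by
  have hDm : MeasurableSet (DD n) := isOpen_DD.measurableSet
  have hbt : Measurable (fun p : ℝ × Mat (n + 1) => bt (herm p.2)) := measurable_bt_herm.comp measurable_snd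
  have hm1 : Measurable ((DD n).indicator fun p => S.indicator (1 : ℝ × ℝ → ℝ≥0∞) (p.1, bt (herm p.2)) * ENNReal.ofReal (dr p ^ 2)) := by
    refine Measurable.indicator (Measurable.mul ?_ ?_) hDm
    · have h1 : Measurable (S.indicator (1 : ℝ × ℝ → ℝ≥0∞)) := measurable_one.indicator hS
      exact h1.comp (measurable_fst.prodMk hbt)
    · exact (ENNReal.continuous_ofReal.comp (cont_dr.pow 2)).measurable
  have hm2 : Measurable ((DD n).indicator fun p : ℝ × Mat (n + 1) => ENNReal.ofReal (κ * |bt (herm p.2)| * (|dr p| * |p.1 * dr p - 2 * jr p|))) := by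
    refine Measurable.indicator ?_ hDm
    refine ENNReal.measurable_ofReal.comp ((measurable_const.mul ?_).mul ?_)
    · exact (continuous_abs.measurable.comp hbt)
    · have := cont_dr (n := n + 1)
      have := cont_jr (n := n + 1)
      exact Continuous.measurable (by fun_prop)
  rw [← lintegral_indicator hDm, ← lintegral_indicator hDm, lintegral_prod_symm' _ hm1, lintegral_prod_symm' _ hm2]
  refine lintegral_mono_ae ?_
  filter_upwards [lint_sq_fin] with G hG
  rw [lint_gr _ (by exact hm1.comp (by fun_prop)), lint_gr _ (by exact hm2.comp (by fun_prop))]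
  gcongr 1
  set μ := tp (herm G)
  set m := bt (herm G) with hm
  set B := ∫⁻ l in Set.Ioi (tp (herm G)), ENNReal.ofReal (|dr (l, G)| * |l * dr (l, G) - 2 * jr (l, G)|) * ge (l ^ 2 / 2) with hB
  have hSm : MeasurableSet {l : ℝ | (l, m) ∈ S} := measurableSet_preimage (by fun_prop : Measurable fun l : ℝ => (l, m)) hS
  have hR : ∫⁻ l, (DD n).indicator (fun p : ℝ × Mat (n + 1) => ENNReal.ofReal (κ * |bt (herm p.2)| * (|dr p| * |p.1 * dr p - 2 * jr p|))) (l, G) *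
      ge (l ^ 2 / 2) = ENNReal.ofReal (κ * |m|) * B := by
    rw [hB, ← lintegral_const_mul', ← lintegral_indicator measurableSet_Ioi]
    · refine lintegral_congr fun l => ?_
      by_cases hl : μ < l
      · rw [Set.indicator_of_mem (show (l, G) ∈ DD n from hl), Set.indicator_of_mem (show l ∈ Set.Ioi (tp (herm G)) from hl),
          ENNReal.ofReal_mul (by positivity), mul_assoc]
      · rw [Set.indicator_of_notMem (show (l, G) ∉ DD n from hl), Set.indicator_of_notMem (show l ∉ Set.Ioi (tp (herm G)) from hl),
          zero_mul]
    · exact ENNReal.ofReal_ne_top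
  rw [hR]
  calc _ ≤ ∫⁻ l, {l : ℝ | (l, m) ∈ S}.indicator (fun _ => B) l := by
        refine lintegral_mono fun l => ?_
        by_cases hl : μ < l
        · rw [Set.indicator_of_mem (show (l, G) ∈ DD n from hl)]
          by_cases hs : (l, m) ∈ S
          · rw [Set.indicator_of_mem (show l ∈ {l : ℝ | (l, m) ∈ S} from hs), Set.indicator_of_mem hs, Pi.one_apply, one_mul]
            exact slice hl hG
          · rw [Set.indicator_of_notMem hs]; simp
        · rw [Set.indicator_of_notMem (show (l, G) ∉ DD n from hl)]; simp
    _ = B * volume {l : ℝ | (l, m) ∈ S} := by rw [lintegral_indicator_const hSm]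
    _ ≤ _ := by rw [mul_comm]; gcongr; exact hvol m
end GUEx

namespace GUEx
open MeasureTheory ProbabilityTheory Matrix
open scoped ComplexOrder Topology ENNReal

lemma intR {n : ℕ} {f : ℝ × Mat (n + 1) → ℝ} (hc : Continuous f) (hg : PG (N2 (n := n + 1)) (fun p => (f p : ℂ))) :
    Integrable f ((GG (n + 1)).restrict (DD n)) := by
  have := (integrable_PG (Complex.continuous_ofReal.comp hc) hg).re
  exact (by simpa using this : Integrable f (GG (n + 1))).restrict

lemma PG_dr {n : ℕ} : PG (N2 (n := n)) (fun p => (dr p : ℂ)) := by simpa only [det_eq_dr] using PG_d (n := n)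
lemma PG_jr {n : ℕ} : PG (N2 (n := n)) (fun p => (jr p : ℂ)) := by simpa only [tr_eq_jr] using PG_tr (n := n)

/-- second moment of the top eigenvalue -/
noncomputable def E2 (n : ℕ) : ℝ := ∫ G, tp (herm G) ^ 2 ∂(matrixGaussian n)

lemma integrable_tp_pow {n : ℕ} (k : ℕ) : Integrable (fun G => tp (herm G) ^ k) (matrixGaussian (n + 1)) := by
  refine (integrable_NG k).mono' (measurable_tp_herm.pow_const k).aestronglyMeasurable (ae_of_all _ fun G => ?_)
  rw [norm_pow, Real.norm_eq_abs]
  have := abs_tp_herm_le G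
  gcongr; linarith

lemma neg_cg : MeasurePreserving (fun z : ℂ => -z) complexGaussian complexGaussian := by
  have hn : MeasurePreserving (fun x : ℝ => -x) (gaussianReal 0 1) (gaussianReal 0 1) := by
    refine ⟨measurable_neg, ?_⟩
    have := gaussianReal_map_neg (μ := 0) (v := 1)
    simpa using this
  have h2 := hn.prod hn
  have hm : Measurable (fun p : ℝ × ℝ => Complex.mk p.1 p.2) := by
    exact Complex.measurableEquivRealProd.symm.measurable
  refine ⟨measurable_neg, ?_⟩
  unfold complexGaussian
  rw [Measure.map_map measurable_neg hm]
  conv_rhs => rw [← h2.map_eq, Measure.map_map hm h2.measurable]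
  rfl

lemma neg_mg (n : ℕ) : MeasurePreserving (fun G : Mat n => -G) (matrixGaussian n) (matrixGaussian n) := by
  have : ∀ _ : Fin n, MeasurePreserving (fun v : Fin n → ℂ => fun j => -v j)
      (Measure.pi fun _ : Fin n => complexGaussian) (Measure.pi fun _ : Fin n => complexGaussian) := fun _ =>
    measurePreserving_pi (μ := fun _ : Fin n => complexGaussian) (ν := fun _ : Fin n => complexGaussian) (fun _ => neg_cg)
  exact measurePreserving_pi (μ := fun _ : Fin n => Measure.pi fun _ : Fin n => complexGaussian)
    (ν := fun _ : Fin n => Measure.pi fun _ : Fin n => complexGaussian) this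

lemma E2_lint (n : ℕ) : ∫⁻ G, ENNReal.ofReal (tp (herm G) ^ 2) ∂(matrixGaussian (n + 1)) = ENNReal.ofReal (E2 (n + 1)) := by
  rw [E2, ofReal_integral_eq_lintegral_ofReal (integrable_tp_pow 2) (ae_of_all _ fun G => sq_nonneg _)]

lemma E2_bt (n : ℕ) : ∫⁻ G, ENNReal.ofReal (bt (herm G) ^ 2) ∂(matrixGaussian (n + 1)) = ENNReal.ofReal (E2 (n + 1)) := by
  rw [← E2_lint, ← (neg_mg (n + 1)).lintegral_comp]
  · refine lintegral_congr fun G => ?_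
    rw [herm_neg, bt, neg_sq, neg_neg]
  · exact ENNReal.measurable_ofReal.comp (measurable_bt_herm.pow_const 2)

lemma prob_bound (n : ℕ) : E2 (n + 2) ≤ 4 * (n + 2) ∧
    ∀ {S : Set (ℝ × ℝ)} (_ : MeasurableSet S) {κ : ℝ} (_ : 0 ≤ κ)
    (_ : ∀ m : ℝ, volume {l : ℝ | (l, m) ∈ S} ≤ ENNReal.ofReal (κ * |m|)) {s : ℝ} (_ : 0 < s),
    matrixGaussian (n + 2) {G | (tp (herm G), bt (herm G)) ∈ S} ≤
      ENNReal.ofReal (κ / 2 * (s * E2 (n + 2) + (4 * (n + 2) - E2 (n + 2)) / (3 * s))) := by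
  obtain ⟨Z, hZ⟩ := deflate n
  have hDm : MeasurableSet (DD n) := isOpen_DD.measurableSet
  have cd := cont_dr (n := n + 1)
  have cj := cont_jr (n := n + 1)
  have iA : Integrable (fun p => dr p ^ 2) ((GG (n + 1)).restrict (DD n)) := by
    refine intR (by fun_prop) ?_
    simpa [sq] using PG_dr.mul PG_dr
  have iL : Integrable (fun p => p.1 ^ 2 * dr p ^ 2) ((GG (n + 1)).restrict (DD n)) := by
    refine intR (by fun_prop) ?_
    simpa [sq] using (PG_N2_fst.mul PG_N2_fst).mul (PG_dr.mul PG_dr)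
  have iT : Integrable (fun p => (p.1 * dr p - 2 * jr p) ^ 2) ((GG (n + 1)).restrict (DD n)) := by
    refine intR (by fun_prop) ?_
    have h := PG.sub N2_nonneg (PG_N2_fst.mul (PG_dr (n := n + 1))) ((PG.const 2).mul PG_jr)
    simpa [sq] using h.mul h
  set A := ∫ p in DD n, dr p ^ 2 ∂(GG (n + 1)) with hA
  set L := ∫ p in DD n, p.1 ^ 2 * dr p ^ 2 ∂(GG (n + 1)) with hL
  set T := ∫ p in DD n, (p.1 * dr p - 2 * jr p) ^ 2 ∂(GG (n + 1)) with hT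
  have hT0 : 0 ≤ T := integral_nonneg fun p => sq_nonneg _
  have hA0 : 0 ≤ A := integral_nonneg fun p => sq_nonneg _
  have hid : 3 * T - 4 * (n + 2) * A + L = 0 := by
    rw [← ident (n := n), integral_add, integral_sub, integral_const_mul, integral_const_mul]
    · exact iT.const_mul 3
    · exact iA.const_mul _
    · exact (iT.const_mul 3).sub (iA.const_mul _)
    · exact iL
  have lA : ∫⁻ p in DD n, ENNReal.ofReal (dr p ^ 2) ∂(GG (n + 1)) = ENNReal.ofReal A :=
    (ofReal_integral_eq_lintegral_ofReal iA (ae_of_all _ fun p => sq_nonneg _)).symm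
  have lL : ∫⁻ p in DD n, ENNReal.ofReal (p.1 ^ 2 * dr p ^ 2) ∂(GG (n + 1)) = ENNReal.ofReal L :=
    (ofReal_integral_eq_lintegral_ofReal iL (ae_of_all _ fun p => by positivity)).symm
  have lT : ∫⁻ p in DD n, ENNReal.ofReal ((p.1 * dr p - 2 * jr p) ^ 2) ∂(GG (n + 1)) = ENNReal.ofReal T :=
    (ofReal_integral_eq_lintegral_ofReal iT (ae_of_all _ fun p => sq_nonneg _)).symm
  have h1 := hZ (fun _ => 1) measurable_const
  simp only [one_mul, lintegral_const, measure_univ, mul_one] at h1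
  rw [lA] at h1
  have h2 := hZ (fun q => ENNReal.ofReal (q.1 ^ 2)) (by fun_prop)
  simp only [← ENNReal.ofReal_mul (sq_nonneg _)] at h2
  rw [lL, E2_lint] at h2
  have h3 := hZ (fun q => ENNReal.ofReal (q.2 ^ 2)) (by fun_prop)
  rw [E2_bt] at h3
  simp only at h3
  have hZt : Z ≠ ⊤ := by
    rintro rfl
    rcases eq_or_ne (ENNReal.ofReal A) 0 with h | h
    · rw [h] at h1; simp at h1
    · rw [ENNReal.top_mul h] at h1; simp at h1
  set z := Z.toReal with hz
  have hz0 : 0 ≤ z := ENNReal.toReal_nonneg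
  have hZz : Z = ENNReal.ofReal z := (ENNReal.ofReal_toReal hZt).symm
  have hE0 : 0 ≤ E2 (n + 2) := integral_nonneg fun _ => sq_nonneg _
  have hL0 : 0 ≤ L := integral_nonneg fun p => by positivity
  have hzA : z * A = 1 := by
    rw [hZz, ← ENNReal.ofReal_mul hz0, ← ENNReal.ofReal_one, ENNReal.ofReal_eq_ofReal_iff (by positivity) (by positivity)] at h1
    exact h1.symm
  have hzL : z * L = E2 (n + 2) := by
    rw [hZz, ← ENNReal.ofReal_mul hz0, ENNReal.ofReal_eq_ofReal_iff (by positivity) (by positivity)] at h2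
    exact h2.symm
  have hzT : z * T = (4 * (n + 2) - E2 (n + 2)) / 3 := by
    have : z * (3 * T - 4 * (n + 2) * A + L) = 0 := by rw [hid, mul_zero]
    linear_combination this / 3 + (4 * (n + 2) / 3) * hzA - hzL / 3
  have hzT0 : 0 ≤ z * T := by positivity
  refine ⟨by rw [hzT] at hzT0; linarith, fun {S} hS {κ} hκ hvol {s} hs => ?_⟩
  have hSm : MeasurableSet {G : Mat (n + 2) | (tp (herm G), bt (herm G)) ∈ S} :=
    (measurable_tp_herm.prodMk measurable_bt_herm) hS
  have h4 := hZ (S.indicator 1) (measurable_one.indicator hS)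
  have h5 : ∫⁻ G, S.indicator 1 (tp (herm G), bt (herm G)) ∂(matrixGaussian (n + 2)) =
      matrixGaussian (n + 2) {G | (tp (herm G), bt (herm G)) ∈ S} := by
    rw [← lintegral_indicator_one hSm]; rfl
  rw [h5] at h4
  rw [h4]
  have hbt : Measurable (fun p : ℝ × Mat (n + 1) => bt (herm p.2)) := measurable_bt_herm.comp measurable_snd
  calc _ ≤ Z * ∫⁻ p in DD n, ENNReal.ofReal (κ * |bt (herm p.2)| * (|dr p| * |p.1 * dr p - 2 * jr p|)) ∂(GG (n + 1)) := by
        exact mul_le_mul_right (density_bound hS hκ hvol) _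
    _ ≤ Z * ∫⁻ p in DD n, (ENNReal.ofReal (κ / 2 * s) * (ENNReal.ofReal (bt (herm p.2) ^ 2) * ENNReal.ofReal (dr p ^ 2)) +
          ENNReal.ofReal (κ / 2 / s) * ENNReal.ofReal ((p.1 * dr p - 2 * jr p) ^ 2)) ∂(GG (n + 1)) := by
        gcongr with p
        rw [← ENNReal.ofReal_mul (sq_nonneg _), ← ENNReal.ofReal_mul (by positivity), ← ENNReal.ofReal_mul (by positivity),
          ← ENNReal.ofReal_add (by positivity) (by positivity)]
        refine ENNReal.ofReal_le_ofReal ?_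
        set a := |bt (herm p.2)| * |dr p| with ha
        set b := |p.1 * dr p - 2 * jr p| with hb
        have ea : bt (herm p.2) ^ 2 * dr p ^ 2 = a ^ 2 := by rw [ha, mul_pow, sq_abs, sq_abs]
        have eb : (p.1 * dr p - 2 * jr p) ^ 2 = b ^ 2 := by rw [hb, sq_abs]
        rw [ea, eb]
        have key : κ / 2 * s * a ^ 2 + κ / 2 / s * b ^ 2 - κ * (a * b) = κ / (2 * s) * (s * a - b) ^ 2 := by
          field_simp; ring
        have h0 : 0 ≤ κ / (2 * s) * (s * a - b) ^ 2 := by positivity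
        have : κ * |bt (herm p.2)| * (|dr p| * b) = κ * (a * b) := by rw [ha]; ring
        linarith
    _ = ENNReal.ofReal (κ / 2 * s) * (Z * ∫⁻ p in DD n, (ENNReal.ofReal (bt (herm p.2) ^ 2) * ENNReal.ofReal (dr p ^ 2)) ∂(GG (n + 1))) +
          ENNReal.ofReal (κ / 2 / s) * (Z * ENNReal.ofReal T) := by
        rw [lintegral_add_right, lintegral_const_mul, lintegral_const_mul, lT]
        · ring
        · exact (ENNReal.continuous_ofReal.comp (by fun_prop)).measurable
        · exact (ENNReal.measurable_ofReal.comp (hbt.pow_const 2)).mul (ENNReal.continuous_ofReal.comp (by fun_prop)).measurable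
        · exact (ENNReal.continuous_ofReal.comp (by fun_prop)).measurable.const_mul _
    _ = _ := by
        rw [← h3, hZz, ← ENNReal.ofReal_mul hz0, hzT, ← ENNReal.ofReal_mul (by positivity), ← ENNReal.ofReal_mul (by positivity),
          ← ENNReal.ofReal_add (by positivity) (mul_nonneg (by positivity) (by rw [← hzT]; exact hzT0))]
        congr 1
        field_simp
end GUEx

namespace GUEx
open MeasureTheory ProbabilityTheory Matrix
open scoped ComplexOrder Topology ENNReal

/-- quadratic functional with linear term -/
noncomputable def QQ {m : ℕ} (H : Mat m) (g w : VV m) : ℝ := qf H w + 2 * (star g ⬝ᵥ w).re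

/-- sphere -/
def Sph (m : ℕ) (b : ℝ) : Set (VV m) := {w | nsq w = b}

/-- maximum of the functional on a sphere -/
noncomputable def MM {m : ℕ} (b : ℝ) (H : Mat m) (g : VV m) : ℝ := sSup (QQ H g '' Sph m b)

lemma norm_le_of_sph {m : ℕ} {b : ℝ} {w : VV m} (hw : w ∈ Sph m b) (i : Fin m) : ‖w i‖ ≤ √b := by
  apply Real.le_sqrt_of_sq_le
  have h : nsq w = b := hw
  rw [← h]
  exact Finset.single_le_sum (f := fun i => ‖w i‖ ^ 2) (fun _ _ => by positivity) (Finset.mem_univ i)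

lemma isCompact_sph (m : ℕ) (b : ℝ) : IsCompact (Sph m b) := by
  apply Metric.isCompact_of_isClosed_isBounded
  · exact isClosed_eq continuous_nsq continuous_const
  · refine (Metric.isBounded_closedBall (x := (0 : VV m)) (r := √b)).subset fun w hw => ?_
    rw [mem_closedBall_zero_iff, pi_norm_le_iff_of_nonneg (Real.sqrt_nonneg _)]
    exact norm_le_of_sph hw

lemma sph_nonempty (m : ℕ) {b : ℝ} (hb : 0 ≤ b) : (Sph (m + 1) b).Nonempty := by
  refine ⟨Fin.cons (√b : ℂ) 0, ?_⟩
  simp [Sph, nsq, Fin.sum_univ_succ, Real.sq_sqrt hb]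

lemma continuous_QQ {m : ℕ} : Continuous (fun p : (Mat m × VV m) × VV m => QQ p.1.1 p.1.2 p.2) := by
  unfold QQ qf
  have h1 : Continuous (fun p : (Mat m × VV m) × VV m => p.1.1 *ᵥ p.2) :=
    Continuous.matrix_mulVec (by fun_prop) (by fun_prop)
  have h2 : Continuous (fun p : (Mat m × VV m) × VV m => star p.2 ⬝ᵥ p.1.1 *ᵥ p.2) :=
    Continuous.dotProduct (by fun_prop) h1
  have h3 : Continuous (fun p : (Mat m × VV m) × VV m => star p.1.2 ⬝ᵥ p.2) :=
    Continuous.dotProduct (by fun_prop) (by fun_prop)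
  fun_prop

lemma continuous_MM {m : ℕ} (b : ℝ) : Continuous (fun p : Mat m × VV m => MM b p.1 p.2) :=
  (isCompact_sph m b).continuous_sSup (f := fun (p : Mat m × VV m) (w : VV m) => QQ p.1 p.2 w) continuous_QQ

lemma le_MM {m : ℕ} {b : ℝ} (H : Mat m) (g : VV m) {w : VV m} (hw : w ∈ Sph m b) : QQ H g w ≤ MM b H g := by
  refine le_csSup ?_ ⟨w, hw, rfl⟩
  refine ((isCompact_sph m b).image ?_).bddAbove
  exact continuous_QQ.comp (by fun_prop : Continuous (fun w : VV m => ((H, g), w)))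

lemma MM_le {m : ℕ} {b : ℝ} (hb : 0 ≤ b) (H : Mat (m + 1)) (g : VV (m + 1)) {t : ℝ}
    (h : ∀ w ∈ Sph (m + 1) b, QQ H g w ≤ t) : MM b H g ≤ t := by
  refine csSup_le ((sph_nonempty m hb).image _) ?_
  rintro _ ⟨w, hw, rfl⟩
  exact h w hw

/-- l1 norm -/
noncomputable def N1 {m : ℕ} (g : VV m) : ℝ := ∑ i, ‖g i‖

lemma abs_QQ_le {m : ℕ} {b : ℝ} (hb : 0 ≤ b) (H : Mat m) (g w : VV m) (hw : w ∈ Sph m b) :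
    |QQ H g w| ≤ b * NG H + 2 * √b * N1 g := by
  have hn := norm_le_of_sph hw
  have h1 : |qf H w| ≤ b * NG H := by
    unfold qf
    refine (Complex.abs_re_le_norm _).trans ?_
    simp only [dotProduct, mulVec, Finset.mul_sum, NG]
    refine (norm_sum_le _ _).trans (Finset.sum_le_sum fun i _ => ?_)
    refine (norm_sum_le _ _).trans (Finset.sum_le_sum fun j _ => ?_)
    rw [norm_mul, norm_mul, Pi.star_apply, norm_star]
    calc ‖w i‖ * (‖H i j‖ * ‖w j‖) ≤ √b * (‖H i j‖ * √b) := by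
          gcongr
          · exact hn i
          · exact hn j
      _ = (√b * √b) * ‖H i j‖ := by ring
      _ = b * ‖H i j‖ := by rw [Real.mul_self_sqrt hb]
  have h2 : |(star g ⬝ᵥ w).re| ≤ √b * N1 g := by
    refine (Complex.abs_re_le_norm _).trans ?_
    simp only [dotProduct, N1, Finset.mul_sum]
    refine (norm_sum_le _ _).trans (Finset.sum_le_sum fun i _ => ?_)
    rw [norm_mul, Pi.star_apply, norm_star, mul_comm]
    gcongr
    exact hn i
  unfold QQ
  rw [abs_le] at *
  constructor <;> nlinarith [h1.1, h1.2, h2.1, h2.2]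

lemma abs_MM_le {m : ℕ} {b : ℝ} (hb : 0 ≤ b) (H : Mat (m + 1)) (g : VV (m + 1)) :
    |MM b H g| ≤ b * NG H + 2 * √b * N1 g := by
  obtain ⟨w, hw⟩ := sph_nonempty m hb
  rw [abs_le]
  constructor
  · exact (abs_le.1 (abs_QQ_le hb H g w hw)).1.trans (le_MM H g hw)
  · exact MM_le hb H g fun w hw => (abs_le.1 (abs_QQ_le hb H g w hw)).2

lemma MM_unitary {m : ℕ} {b : ℝ} (hb : 0 ≤ b) {U : Mat (m + 1)} (hU : Uᴴ * U = 1) (H : Mat (m + 1)) (g : VV (m + 1)) :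
    MM b H g ≤ MM b (U * H * Uᴴ) (U *ᵥ g) := by
  refine MM_le hb _ _ fun w hw => ?_
  have key : ∀ v w : VV (m + 1), star (U *ᵥ v) ⬝ᵥ U *ᵥ w = star v ⬝ᵥ w := by
    intro v w
    rw [star_mulVec, ← dotProduct_mulVec, mulVec_mulVec, hU, one_mulVec]
  have h1 : U *ᵥ w ∈ Sph (m + 1) b := by
    have h2 := key w w
    rw [vec_qf, vec_qf] at h2
    have h3 : nsq (U *ᵥ w) = nsq w := by exact_mod_cast h2
    have h4 : nsq w = b := hw
    exact h3.trans h4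
  refine le_of_eq_of_le ?_ (le_MM _ _ h1)
  unfold QQ qf
  rw [key, mulVec_mulVec, Matrix.mul_assoc, hU, Matrix.mul_one, ← mulVec_mulVec, key]

lemma MM_zero_le {m : ℕ} {b : ℝ} (hb : 0 ≤ b) {H : Mat (m + 1)} (hH : H.IsHermitian) :
    MM b H 0 ≤ b * tp H := by
  refine MM_le hb _ _ fun w hw => ?_
  have h := ((tp_le_iff hH _).1 le_rfl).dotProduct_mulVec_nonneg w
  unfold pen at h
  rw [sub_mulVec, dotProduct_sub, smul_mulVec, one_mulVec, dotProduct_smul, vec_qf, qf_eq hH] at h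
  have h4 : nsq w = b := hw
  rw [h4, smul_eq_mul] at h
  have h5 : (0 : ℝ) ≤ tp H * b - qf H w := by exact_mod_cast h
  unfold QQ
  simp
  linarith

lemma MM_blk {m : ℕ} {b : ℝ} (hb : 0 ≤ b) (al t h : ℝ) (g : VV (m + 1)) (K : Mat (m + 1)) :
    al ^ 2 * h + 2 * al * t + MM b K ((al : ℂ) • g) ≤ MM (al ^ 2 + b) (blk h g K) (Fin.cons (t : ℂ) 0) := by
  suffices MM b K ((al : ℂ) • g) ≤ MM (al ^ 2 + b) (blk h g K) (Fin.cons (t : ℂ) 0) - (al ^ 2 * h + 2 * al * t) by linarith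
  refine MM_le hb _ _ fun w hw => ?_
  have h4 : nsq w = b := hw
  have h1 : (Fin.cons (al : ℂ) w : VV (m + 2)) ∈ Sph (m + 2) (al ^ 2 + b) := by
    simp only [Sph, nsq, Set.mem_ofPred_eq, Fin.sum_univ_succ (n := m + 1), Fin.cons_zero, Fin.cons_succ]
    have : ∑ i, ‖w i‖ ^ 2 = b := h4
    rw [this]; simp
  have h2 := le_MM (blk h g K) (Fin.cons (t : ℂ) 0) h1
  suffices QQ (blk h g K) (Fin.cons (t : ℂ) 0) (Fin.cons (al : ℂ) w : VV (m + 2)) = QQ K ((al : ℂ) • g) w + (al ^ 2 * h + 2 * al * t) by linarith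
  have e1 : star (Fin.cons (t : ℂ) 0 : VV (m + 2)) ⬝ᵥ (Fin.cons (al : ℂ) w : VV (m + 2)) = t * al := by
    simp [dotProduct, Fin.sum_univ_succ (n := m + 1)]
  have e2 : star (Fin.cons (al : ℂ) w : VV (m + 2)) ⬝ᵥ blk h g K *ᵥ (Fin.cons (al : ℂ) w : VV (m + 2))
     = al * (h * al + star g ⬝ᵥ w) + (al * (star w ⬝ᵥ g) + star w ⬝ᵥ K *ᵥ w) := by
    simp [dotProduct, mulVec, blk, Fin.sum_univ_succ (n := m + 1)]
    simp only [mul_add, Finset.sum_add_distrib, Finset.mul_sum]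
    congr 1
    congr 1
    funext i; ring
  have e3 : (star w ⬝ᵥ g).re = (star g ⬝ᵥ w).re := by
    have : star (star g ⬝ᵥ w) = star w ⬝ᵥ g := by
      rw [← star_dotProduct_star, star_star, dotProduct_comm, dotProduct_comm]
    rw [← this]; simp
  unfold QQ qf
  rw [e1, e2, star_smul, smul_dotProduct]
  simp only [Complex.add_re, Complex.mul_re, Complex.ofReal_re, Complex.ofReal_im, Complex.add_im, Complex.mul_im, e3, smul_eq_mul]
  simp
  ring

end GUEx

namespace GUEx
open MeasureTheory ProbabilityTheory Matrix
open scoped ComplexOrder Topology ENNReal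

/-- iid complex Gaussian vector -/
noncomputable def PV (m : ℕ) : Measure (VV m) := Measure.pi fun _ : Fin m => complexGaussian

instance instProbPV {m : ℕ} : IsProbabilityMeasure (PV m) := by
  unfold PV; infer_instance

lemma mg_split {m : ℕ} (f : Mat (m + 1) → ℝ≥0∞) (hf : Measurable f) :
    ∫⁻ G, f G ∂(matrixGaussian (m + 1)) = ∫⁻ z, ∫⁻ r, ∫⁻ s, ∫⁻ K, f (blk' z r s K) ∂(matrixGaussian m) ∂(PV m) ∂(PV m) ∂complexGaussian := by
  have h0 : ∫⁻ G, f G ∂(matrixGaussian (m + 1)) = ∫⁻ e : VV (m + 1), ∫⁻ v : Fin m → VV (m + 1), f (Matrix.of (Fin.cons e v)) ∂(Measure.pi fun _ : Fin m => PV (m + 1)) ∂(PV (m + 1)) :=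
    lcons (PV (m + 1)) f hf
  have hcm : Measurable (fun p : VV (m + 1) × (Fin m → VV (m + 1)) => (Matrix.of (Fin.cons p.1 p.2) : Mat (m + 1))) := by
    refine measurable_pi_iff.2 fun i => ?_
    refine Fin.cases ?_ (fun i => ?_) i
    · exact measurable_fst
    · exact (measurable_pi_apply i).comp measurable_snd
  have hF := hf.comp hcm
  rw [h0]
  have h1 := lcons complexGaussian (fun e : VV (m + 1) => ∫⁻ v : Fin m → VV (m + 1), f (Matrix.of (Fin.cons e v)) ∂(Measure.pi fun _ : Fin m => PV (m + 1)))
    (Measurable.lintegral_prod_right' hF)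
  refine h1.trans (lintegral_congr fun z => lintegral_congr fun r => ?_)
  have e0 : MeasurePreserving (MeasurableEquiv.piFinSuccAbove (fun _ : Fin (m + 1) => ℂ) 0).symm (complexGaussian.prod (PV m)) (PV (m + 1)) :=
    (measurePreserving_piFinSuccAbove (fun _ : Fin (m + 1) => complexGaussian) 0).symm
  have e1 := measurePreserving_pi (fun _ : Fin m => complexGaussian.prod (PV m)) (fun _ : Fin m => PV (m + 1)) (fun _ => e0)
  have e2 := (measurePreserving_arrowProdEquivProdArrow ℂ (VV m) (Fin m) (fun _ => complexGaussian) (fun _ => PV m)).symm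
  have e3 := e1.comp e2
  have hF2 : Measurable (fun v : Fin m → VV (m + 1) => f (Matrix.of (Fin.cons (Fin.cons z r) v))) :=
    hF.comp measurable_prodMk_left
  rw [← e3.lintegral_comp hF2, lintegral_prod _ (by exact (hF2.comp e3.measurable).aemeasurable)]
  refine lintegral_congr fun s => ?_
  change _ = ∫⁻ K : Fin m → Fin m → ℂ, f (blk' z r s K) ∂(Measure.pi fun _ : Fin m => PV m)
  refine lintegral_congr fun K => ?_
  congr 1
  ext i j
  refine Fin.cases rfl (fun i => ?_) i
  refine Fin.cases ?_ (fun j => ?_) j <;> 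
    simp [blk', MeasurableEquiv.piFinSuccAbove, Fin.insertNthEquiv, MeasurableEquiv.arrowProdEquivProdArrow, Equiv.arrowProdEquivProdArrow]

lemma continuous_blk' {m : ℕ} : Continuous (fun p : ℂ × VV m × VV m × Mat m => blk' p.1 p.2.1 p.2.2.1 p.2.2.2) := by
  refine continuous_matrix fun i j => ?_
  refine Fin.cases ?_ (fun i => ?_) i <;> refine Fin.cases ?_ (fun j => ?_) j <;> simp only [blk', Matrix.of_apply, Fin.cons_zero, Fin.cons_succ]
  · fun_prop
  · fun_prop
  · fun_prop
  · exact Continuous.matrix_elem (by fun_prop) i j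

lemma mp_split {m : ℕ} : MeasurePreserving (fun p : ℂ × VV m × VV m × Mat m => blk' p.1 p.2.1 p.2.2.1 p.2.2.2)
    (complexGaussian.prod ((PV m).prod ((PV m).prod (matrixGaussian m)))) (matrixGaussian (m + 1)) := by
  have hm := (continuous_blk' (m := m)).measurable
  refine ⟨hm, Measure.ext_of_lintegral _ fun f hf => ?_⟩
  rw [mg_split f hf, lintegral_map hf hm, lintegral_prod _ (by exact (hf.comp hm).aemeasurable)]
  refine lintegral_congr fun z => ?_
  have h1 : Measurable (fun p : VV m × VV m × Mat m => f (blk' z p.1 p.2.1 p.2.2)) := (hf.comp hm).comp measurable_prodMk_left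
  rw [lintegral_prod _ h1.aemeasurable]
  refine lintegral_congr fun r => ?_
  have h2 : Measurable (fun p : VV m × Mat m => f (blk' z r p.1 p.2)) := h1.comp measurable_prodMk_left
  rw [lintegral_prod _ h2.aemeasurable]

/-- vector of off-diagonal entries -/
noncomputable def gv {m : ℕ} (p : VV m × VV m) : VV m := (1 / 2 : ℂ) • (p.2 + star p.1)

lemma continuous_gv {m : ℕ} : Continuous (gv (m := m)) := by unfold gv; fun_prop

/-- law of the off-diagonal entries -/
noncomputable def gl (m : ℕ) : Measure (VV m) := ((PV m).prod (PV m)).map gv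

instance instProbgl {m : ℕ} : IsProbabilityMeasure (gl m) := by
  unfold gl; exact Measure.isProbabilityMeasure_map continuous_gv.measurable.aemeasurable

lemma mp_gv (m : ℕ) : MeasurePreserving (gv (m := m)) ((PV m).prod (PV m)) (gl m) :=
  ⟨continuous_gv.measurable, rfl⟩

/-- Law of the Hermitian part in block form. -/
lemma mp_hsplit {m : ℕ} (F : Mat (m + 1) → ℝ) (hF : Continuous F) :
    ∫ G, F (herm G) ∂(matrixGaussian (m + 1)) =
      ∫ p : ℂ × VV m × Mat m, F (blk p.1.re p.2.1 (herm p.2.2)) ∂(complexGaussian.prod ((gl m).prod (matrixGaussian m))) := by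
  have a1 := mp_split (m := m)
  have a2 := ((measurePreserving_prodAssoc (PV m) (PV m) (matrixGaussian m)))
  have a3 := (MeasurePreserving.id complexGaussian).prod a2
  have a4 := a1.comp a3
  have i1 : IsProbabilityMeasure ((PV m).prod (PV m)) := inferInstance
  have i2 : SFinite ((PV m).prod (PV m)) := Measure.prod.instSFinite
  have a5 := (MeasurePreserving.id complexGaussian).prod ((mp_gv m).prod (MeasurePreserving.id (matrixGaussian m)))
  have c1 : Continuous (fun G : Mat (m + 1) => F (herm G)) := hF.comp continuous_herm
  have c2 : Continuous (fun p : ℂ × VV m × Mat m => F (blk p.1.re p.2.1 (herm p.2.2))) :=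
    hF.comp (continuous_blk (by fun_prop) (by fun_prop) (continuous_herm.comp (by fun_prop)))
  rw [← a4.map_eq, integral_map a4.measurable.aemeasurable (c1.measurable.aestronglyMeasurable),
    ← a5.map_eq, integral_map a5.measurable.aemeasurable (c2.measurable.aestronglyMeasurable)]
  refine integral_congr_ae (ae_of_all _ fun p => ?_)
  simp only [Function.comp]
  congr 1
  exact herm_blk' _ _ _ _

/-- Law of the Hermitian part in block form, integrability. -/
lemma int_hsplit {m : ℕ} (F : Mat (m + 1) → ℝ) (hF : Continuous F) :
    Integrable (fun G => F (herm G)) (matrixGaussian (m + 1)) →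
      Integrable (fun p : ℂ × VV m × Mat m => F (blk p.1.re p.2.1 (herm p.2.2))) (complexGaussian.prod ((gl m).prod (matrixGaussian m))) := by
  have a1 := mp_split (m := m)
  have a2 := ((measurePreserving_prodAssoc (PV m) (PV m) (matrixGaussian m)))
  have a3 := (MeasurePreserving.id complexGaussian).prod a2
  have a4 := a1.comp a3
  have i1 : IsProbabilityMeasure ((PV m).prod (PV m)) := inferInstance
  have i2 : SFinite ((PV m).prod (PV m)) := Measure.prod.instSFinite
  have a5 := (MeasurePreserving.id complexGaussian).prod ((mp_gv m).prod (MeasurePreserving.id (matrixGaussian m)))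
  have c1 : Continuous (fun G : Mat (m + 1) => F (herm G)) := hF.comp continuous_herm
  have c2 : Continuous (fun p : ℂ × VV m × Mat m => F (blk p.1.re p.2.1 (herm p.2.2))) :=
    hF.comp (continuous_blk (by fun_prop) (by fun_prop) (continuous_herm.comp (by fun_prop)))
  rw [← a4.integrable_comp c1.measurable.aestronglyMeasurable, ← a5.integrable_comp c2.measurable.aestronglyMeasurable]
  intro h
  refine h.congr (ae_of_all _ fun p => ?_)
  simp only [Function.comp]
  congr 1
  exact herm_blk' _ _ _ _

/-- conjugation as a real linear map -/
noncomputable def cj {m : ℕ} (U : Mat m) : Mat m →ₗ[ℝ] Mat m where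
  toFun G := U * G * Uᴴ
  map_add' A B := by rw [Matrix.mul_add, Matrix.add_mul]
  map_smul' a A := by simp

lemma FN_cj {m : ℕ} {U : Mat m} (hU : Uᴴ * U = 1) (G : Mat m) : FN (U * G * Uᴴ) = FN G := by
  have h := FN_trace (U * G * Uᴴ)
  have : U * G * Uᴴ * (U * G * Uᴴ)ᴴ = U * (G * Gᴴ) * Uᴴ := by
    simp only [conjTranspose_mul, conjTranspose_conjTranspose]
    calc U * G * Uᴴ * (U * (Gᴴ * Uᴴ)) = U * G * (Uᴴ * U) * (Gᴴ * Uᴴ) := by simp only [Matrix.mul_assoc]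
      _ = _ := by rw [hU]; simp only [Matrix.mul_assoc, Matrix.mul_one]
  rw [this, trace_mul_comm, ← Matrix.mul_assoc, hU, Matrix.one_mul, ← FN_trace] at h
  exact_mod_cast h

lemma mp_cj {m : ℕ} {U : Mat m} (hU : Uᴴ * U = 1) :
    MeasurePreserving (fun G : Mat m => U * G * Uᴴ) (matrixGaussian m) (matrixGaussian m) := by
  have hU2 : U * Uᴴ = 1 := mul_eq_one_comm.1 hU
  have hm : Measurable (fun G : Mat m => U * G * Uᴴ) := by
    have : Continuous (fun G : Mat m => U * G * Uᴴ) := by fun_prop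
    exact this.measurable
  have hdet : LinearMap.det (cj U) ≠ 0 := by
    have : cj U ∘ₗ cj Uᴴ = LinearMap.id := by
      ext1 G
      simp only [cj, LinearMap.comp_apply, LinearMap.coe_mk, AddHom.coe_mk, LinearMap.id_apply, conjTranspose_conjTranspose]
      calc U * (Uᴴ * G * U) * Uᴴ = (U * Uᴴ) * G * (U * Uᴴ) := by simp only [Matrix.mul_assoc]
        _ = G := by rw [hU2]; simp
    have h2 := congrArg LinearMap.det this
    rw [LinearMap.det_comp, LinearMap.det_id] at h2
    exact left_ne_zero_of_mul_eq_one h2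
  have hge : Measurable (fun G : Mat m => ge (FN G / 2)) := (continuous_ge.comp (continuous_FN.div_const 2)).measurable
  have key : ∀ f : Mat m → ℝ≥0∞, Measurable f → ∫⁻ G, f G ∂(matrixGaussian m) =
      ENNReal.ofReal |LinearMap.det (cj U)| * ∫⁻ G, f (U * G * Uᴴ) ∂(matrixGaussian m) := by
    intro f hf
    rw [lint_mg f hf, lint_affineM (cj U) hdet 0 (fun G => f G * ge (FN G / 2)) (hf.mul hge), lint_mg _ (by exact hf.comp hm)]
    have : ∀ G : Mat m, f (cj U G + 0) * ge (FN (cj U G + 0) / 2) = f (U * G * Uᴴ) * ge (FN G / 2) := by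
      intro G
      rw [add_zero]
      change f (U * G * Uᴴ) * ge (FN (U * G * Uᴴ) / 2) = _
      rw [FN_cj hU]
    simp only [this]
    ring
  have h1 := key (fun _ => 1) measurable_const
  simp only [lintegral_const, measure_univ, mul_one] at h1
  refine ⟨hm, Measure.ext_of_lintegral _ fun f hf => ?_⟩
  rw [lintegral_map hf hm, key f hf, ← h1, one_mul]

/-- A unitary matrix rotating the first basis vector to a given direction. -/
lemma exists_unitary {m : ℕ} (g : VV (m + 1)) : ∃ U : Mat (m + 1), Uᴴ * U = 1 ∧
    U *ᵥ (Fin.cons ((√(nsq g) : ℝ) : ℂ) 0 : VV (m + 1)) = g := by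
  by_cases hg : nsq g = 0
  · refine ⟨1, by simp, ?_⟩
    have hz : g = 0 := by
      funext i
      have := (Finset.sum_eq_zero_iff_of_nonneg (fun i _ => by positivity)).1 hg i (Finset.mem_univ i)
      simpa using this
    rw [hg, hz]
    ext i
    refine Fin.cases ?_ (fun i => ?_) i <;> simp
  have hpos : 0 < √(nsq g) := Real.sqrt_pos.2 (lt_of_le_of_ne (nsq_nonneg g) (Ne.symm hg))
  set u : EuclideanSpace ℂ (Fin (m + 1)) := WithLp.toLp 2 (((√(nsq g) : ℝ) : ℂ)⁻¹ • g) with hu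
  have hu1 : ‖u‖ = 1 := by
    rw [EuclideanSpace.norm_eq]
    have : ∑ i, ‖u i‖ ^ 2 = 1 := by
      simp only [hu, PiLp.toLp_apply, Pi.smul_apply, smul_eq_mul, norm_mul, norm_inv, Complex.norm_real, mul_pow, ← Finset.mul_sum, inv_pow, Real.norm_eq_abs, sq_abs]
      rw [Real.sq_sqrt (nsq_nonneg g)]
      exact inv_mul_cancel₀ hg
    rw [this, Real.sqrt_one]
  obtain ⟨B, hB⟩ := Orthonormal.exists_orthonormalBasis_extension_of_card_eq (𝕜 := ℂ) (E := EuclideanSpace ℂ (Fin (m + 1))) (ι := Fin (m + 1)) (by simp)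
    (v := fun _ => u) (s := {0}) (by
      constructor
      · intro i; exact hu1
      · intro i j hij; exact absurd (Subsingleton.elim i j) hij)
  have hB0 : B 0 = u := hB 0 rfl
  refine ⟨Matrix.of fun i j => B j i, ?_, ?_⟩
  · ext i j
    have := orthonormal_iff_ite.1 B.orthonormal i j
    rw [Matrix.mul_apply, Matrix.one_apply]
    simp only [conjTranspose_apply, Matrix.of_apply]
    rw [← this, PiLp.inner_apply]
    refine Finset.sum_congr rfl fun k _ => ?_
    simp [mul_comm]
  · funext i
    simp only [mulVec, dotProduct, Matrix.of_apply, Fin.sum_univ_succ, Fin.cons_zero, Fin.cons_succ, Pi.zero_apply, mul_zero, Finset.sum_const_zero, add_zero, hB0]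
    simp only [hu, PiLp.toLp_apply, Pi.smul_apply, smul_eq_mul]
    have : ((√(nsq g) : ℝ) : ℂ) ≠ 0 := by exact_mod_cast hpos.ne'
    field_simp

end GUEx

namespace GUEx
open MeasureTheory ProbabilityTheory Matrix
open scoped ComplexOrder Topology ENNReal

lemma memLp_gl {m : ℕ} (i : Fin m) (k : ℕ) : MemLp (fun g : VV m => ‖g i‖) k (gl m) := by
  have h0 : MeasurePreserving (fun v : VV m => v i) (PV m) complexGaussian :=
    measurePreserving_eval (fun _ : Fin m => complexGaussian) i
  have h1 : MemLp (fun v : VV m => ‖v i‖) k (PV m) := (memLp_norm_complexGaussian k).comp_measurePreserving h0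
  unfold gl
  rw [memLp_map_measure_iff (by exact (by fun_prop : Continuous fun g : VV m => ‖g i‖).measurable.aestronglyMeasurable) continuous_gv.measurable.aemeasurable]
  refine ((h1.comp_fst (PV m)).add (h1.comp_snd (PV m))).mono ?_ (ae_of_all _ fun p => ?_)
  · have : Continuous ((fun g : VV m => ‖g i‖) ∘ gv) := (by fun_prop : Continuous (fun g : VV m => ‖g i‖)).comp continuous_gv
    exact this.measurable.aestronglyMeasurable
  · simp only [Function.comp, norm_norm, Pi.add_apply, gv, Pi.smul_apply, smul_eq_mul, norm_mul, Pi.star_apply]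
    rw [Real.norm_of_nonneg (by positivity)]
    have := norm_add_le (p.2 i) (star (p.1 i))
    rw [norm_star] at this
    have h2 : ‖(1 / 2 : ℂ)‖ = 1 / 2 := by simp
    rw [h2]
    linarith [norm_nonneg (p.2 i), norm_nonneg (p.1 i)]

lemma integrable_N1 (m : ℕ) : Integrable (N1 (m := m)) (gl m) := by
  unfold N1
  refine integrable_finsetSum _ fun i _ => ?_
  have := memLp_gl i 1
  exact memLp_one_iff_integrable.1 (by simpa using this)

lemma integrable_NG1 (m : ℕ) : Integrable (NG (n := m)) (matrixGaussian m) := by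
  have := memLp_NG (n := m) 1
  exact memLp_one_iff_integrable.1 (by simpa using this)

lemma N1_nonneg {m : ℕ} (g : VV m) : 0 ≤ N1 g := by unfold N1; positivity

lemma N1_smul {m : ℕ} (a : ℝ) (g : VV m) : N1 ((a : ℂ) • g) = |a| * N1 g := by
  simp [N1, Finset.mul_sum]

lemma sqrt_nsq_le {m : ℕ} (g : VV m) : √(nsq g) ≤ N1 g := by
  rw [Real.sqrt_le_left (N1_nonneg g)]
  unfold nsq N1
  exact Finset.sum_sq_le_sq_sum_of_nonneg fun _ _ => norm_nonneg _

lemma continuous_MM' {m : ℕ} (b : ℝ) {X : Type*} [TopologicalSpace X] {H : X → Mat m} {g : X → VV m}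
    (hH : Continuous H) (hg : Continuous g) : Continuous (fun x => MM b (H x) (g x)) :=
  Continuous.comp (g := fun p : Mat m × VV m => MM b p.1 p.2) (f := fun x => (H x, g x)) (continuous_MM b) (hH.prodMk hg)

lemma continuous_MMc {m : ℕ} (b γ : ℝ) : Continuous (fun p : VV m × Mat m => MM b (herm p.2) ((γ : ℂ) • p.1)) :=
  continuous_MM' b (H := fun p : VV m × Mat m => herm p.2) (g := fun p : VV m × Mat m => (γ : ℂ) • p.1) (continuous_herm.comp continuous_snd) (by fun_prop)

lemma integrable_MM {m : ℕ} {b : ℝ} (hb : 0 ≤ b) (γ : ℝ) :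
    Integrable (fun p : VV (m + 1) × Mat (m + 1) => MM b (herm p.2) ((γ : ℂ) • p.1)) ((gl (m + 1)).prod (matrixGaussian (m + 1))) := by
  have h1 := (integrable_N1 (m + 1)).comp_fst (matrixGaussian (m + 1))
  have h2 := (integrable_NG1 (m + 1)).comp_snd (gl (m + 1))
  refine ((h2.const_mul b).add (h1.const_mul (2 * √b * |γ|))).mono' (continuous_MMc b γ).measurable.aestronglyMeasurable (ae_of_all _ fun p => ?_)
  rw [Real.norm_eq_abs]
  refine (abs_MM_le hb _ _).trans ?_
  rw [N1_smul]
  have := NG_herm_le p.2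
  simp only [Pi.add_apply]
  nlinarith [mul_le_mul_of_nonneg_left this hb]

lemma integrable_MM2 {m : ℕ} {b : ℝ} (hb : 0 ≤ b) (v : VV (m + 1)) :
    Integrable (fun G : Mat (m + 1) => MM b (herm G) v) (matrixGaussian (m + 1)) := by
  have hc : Continuous (fun G : Mat (m + 1) => MM b (herm G) v) := continuous_MM' b (g := fun _ => v) continuous_herm continuous_const
  refine (((integrable_NG1 (m + 1)).const_mul b).add (integrable_const (2 * √b * N1 v))).mono' hc.measurable.aestronglyMeasurable (ae_of_all _ fun G => ?_)
  rw [Real.norm_eq_abs]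
  refine (abs_MM_le hb _ _).trans ?_
  have := NG_herm_le G
  simp only [Pi.add_apply]
  nlinarith [mul_le_mul_of_nonneg_left this hb]

/-- mean of the maximum -/
noncomputable def mu (m : ℕ) (γ b : ℝ) : ℝ :=
  ∫ p : VV (m + 1) × Mat (m + 1), MM b (herm p.2) ((γ : ℂ) • p.1) ∂((gl (m + 1)).prod (matrixGaussian (m + 1)))

/-- mean length of a Gaussian vector -/
noncomputable def DV (m : ℕ) : ℝ := ∫ g, √(nsq g) ∂(gl m)

lemma integrable_re_cg : Integrable (fun z : ℂ => z.re) complexGaussian := by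
  have h := memLp_norm_complexGaussian 1
  have h1 : Integrable (fun z : ℂ => ‖z‖) complexGaussian := memLp_one_iff_integrable.1 (by simpa using h)
  exact h1.mono' (by fun_prop) (ae_of_all _ fun z => by rw [Real.norm_eq_abs]; exact Complex.abs_re_le_norm z)

lemma mean_re_cg : ∫ z : ℂ, z.re ∂complexGaussian = 0 := by
  have h : ∫ z : ℂ, z.re ∂complexGaussian = ∫ z : ℂ, (-z).re ∂complexGaussian := by
    conv_lhs => rw [← neg_cg.map_eq]
    rw [integral_map (by fun_prop) (by fun_prop)]
  simp only [Complex.neg_re, integral_neg] at h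
  linarith

lemma integrable_sqrt_nsq (m : ℕ) : Integrable (fun g : VV m => √(nsq g)) (gl m) := by
  have hc : Continuous (fun g : VV m => √(nsq g)) := continuous_nsq.sqrt
  refine (integrable_N1 m).mono' hc.measurable.aestronglyMeasurable (ae_of_all _ fun g => ?_)
  rw [Real.norm_of_nonneg (Real.sqrt_nonneg _)]
  exact sqrt_nsq_le g

lemma herm_cj {m : ℕ} (U G : Mat m) : herm (U * G * Uᴴ) = U * herm G * Uᴴ := by
  unfold herm
  simp only [conjTranspose_mul, conjTranspose_conjTranspose, Matrix.mul_smul, Matrix.smul_mul, Matrix.mul_add, Matrix.add_mul, Matrix.mul_assoc]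

lemma mu_fixed (m : ℕ) {b : ℝ} (hb : 0 ≤ b) (γ al : ℝ) (g : VV (m + 2)) :
    2 * γ * al * √(nsq g) + mu m al b ≤ ∫ G, MM (al ^ 2 + b) (herm G) ((γ : ℂ) • g) ∂(matrixGaussian (m + 2)) := by
  have hb2 : 0 ≤ al ^ 2 + b := by positivity
  obtain ⟨U, hU, hUg⟩ := exists_unitary g
  set e : VV (m + 2) := Fin.cons ((γ * √(nsq g) : ℝ) : ℂ) 0 with he
  have hUe : U *ᵥ e = (γ : ℂ) • g := by
    have : e = (γ : ℂ) • (Fin.cons ((√(nsq g) : ℝ) : ℂ) 0 : VV (m + 2)) := by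
      rw [he]
      ext i
      refine Fin.cases ?_ (fun i => ?_) i <;> simp
    rw [this, mulVec_smul, hUg]
  have hc : ∀ v : VV (m + 2), Continuous (fun G : Mat (m + 2) => MM (al ^ 2 + b) (herm G) v) := fun v => continuous_MM' _ (g := fun _ => v) continuous_herm continuous_const
  have hcF : Continuous (fun G : Mat (m + 2) => MM (al ^ 2 + b) G e) := continuous_MM' _ (H := fun G => G) (g := fun _ => e) continuous_id continuous_const
  have s1 : ∫ G, MM (al ^ 2 + b) (herm G) e ∂(matrixGaussian (m + 2)) ≤ ∫ G, MM (al ^ 2 + b) (herm G) ((γ : ℂ) • g) ∂(matrixGaussian (m + 2)) := by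
    have hmp := mp_cj hU
    conv_rhs => rw [← hmp.map_eq]
    rw [integral_map hmp.measurable.aemeasurable (hc _).measurable.aestronglyMeasurable]
    refine integral_mono (integrable_MM2 hb2 e) ?_ fun G => ?_
    · exact (hmp.integrable_comp (hc _).measurable.aestronglyMeasurable).2 (integrable_MM2 hb2 _)
    · simp only
      rw [herm_cj, ← hUe]
      exact MM_unitary hb2 hU _ _
  refine le_trans ?_ s1
  have s2 := mp_hsplit (fun G : Mat (m + 2) => MM (al ^ 2 + b) G e) hcF
  have s3 := int_hsplit (fun G : Mat (m + 2) => MM (al ^ 2 + b) G e) hcF (integrable_MM2 hb2 e)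
  rw [s2]
  have i1 : Integrable (fun p : ℂ × VV (m + 1) × Mat (m + 1) => al ^ 2 * p.1.re) (complexGaussian.prod ((gl (m + 1)).prod (matrixGaussian (m + 1)))) :=
    (integrable_re_cg.comp_fst _).const_mul _
  have i2 : Integrable (fun p : ℂ × VV (m + 1) × Mat (m + 1) => MM b (herm p.2.2) ((al : ℂ) • p.2.1)) (complexGaussian.prod ((gl (m + 1)).prod (matrixGaussian (m + 1)))) :=
    (integrable_MM hb al).comp_snd complexGaussian
  have e1 : ∫ p : ℂ × VV (m + 1) × Mat (m + 1), al ^ 2 * p.1.re ∂(complexGaussian.prod ((gl (m + 1)).prod (matrixGaussian (m + 1)))) = 0 := by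
    rw [integral_const_mul, integral_fun_fst (fun z : ℂ => z.re), mean_re_cg]; simp
  have e2 : ∫ p : ℂ × VV (m + 1) × Mat (m + 1), MM b (herm p.2.2) ((al : ℂ) • p.2.1) ∂(complexGaussian.prod ((gl (m + 1)).prod (matrixGaussian (m + 1)))) = mu m al b := by
    rw [integral_fun_snd (fun p : VV (m + 1) × Mat (m + 1) => MM b (herm p.2) ((al : ℂ) • p.1))]; simp [mu]
  have i3 : Integrable (fun p : ℂ × VV (m + 1) × Mat (m + 1) => al ^ 2 * p.1.re + 2 * al * (γ * √(nsq g))) (complexGaussian.prod ((gl (m + 1)).prod (matrixGaussian (m + 1)))) :=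
    i1.add (integrable_const _)
  have e3 : ∫ p : ℂ × VV (m + 1) × Mat (m + 1), (al ^ 2 * p.1.re + 2 * al * (γ * √(nsq g)) + MM b (herm p.2.2) ((al : ℂ) • p.2.1)) ∂(complexGaussian.prod ((gl (m + 1)).prod (matrixGaussian (m + 1)))) = 2 * γ * al * √(nsq g) + mu m al b := by
    rw [integral_add i3 i2, integral_add i1 (integrable_const _), e1, e2]
    simp
    ring
  rw [← e3]
  exact integral_mono (i3.add i2) s3 fun p => MM_blk hb al _ _ _ _

lemma mu_rec (m : ℕ) {b : ℝ} (hb : 0 ≤ b) (γ al : ℝ) :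
    2 * γ * al * DV (m + 2) + mu m al b ≤ mu (m + 1) γ (al ^ 2 + b) := by
  have hi := integrable_MM (m := m + 1) (b := al ^ 2 + b) (by positivity) γ
  have : mu (m + 1) γ (al ^ 2 + b) = ∫ g, ∫ G, MM (al ^ 2 + b) (herm G) ((γ : ℂ) • g) ∂(matrixGaussian (m + 2)) ∂(gl (m + 2)) :=
    integral_prod _ hi
  rw [this]
  have i1 := (integrable_sqrt_nsq (m + 2)).const_mul (2 * γ * al)
  have e : 2 * γ * al * DV (m + 2) + mu m al b = ∫ g : VV (m + 2), (2 * γ * al * √(nsq g) + mu m al b) ∂(gl (m + 2)) := by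
    rw [integral_add i1 (integrable_const _), integral_const_mul]; simp [DV]
  rw [e]
  exact integral_mono (i1.add (integrable_const _)) hi.integral_prod_left fun g => mu_fixed m hb γ al g

lemma mu_zero (m : ℕ) (γ : ℝ) : mu m γ 0 = 0 := by
  have : ∀ (H : Mat (m + 1)) (g : VV (m + 1)), MM 0 H g = 0 := by
    intro H g
    have := abs_MM_le le_rfl H g
    simpa using this
  simp [mu, this]

lemma mu_top (m : ℕ) {b : ℝ} (hb : 0 ≤ b) : mu m 0 b ≤ b * ∫ G, tp (herm G) ∂(matrixGaussian (m + 1)) := by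
  have h := integrable_MM (m := m) hb 0
  have e : b * ∫ G, tp (herm G) ∂(matrixGaussian (m + 1)) = ∫ p : VV (m + 1) × Mat (m + 1), b * tp (herm p.2) ∂((gl (m + 1)).prod (matrixGaussian (m + 1))) := by
    rw [integral_const_mul, integral_fun_snd (fun G : Mat (m + 1) => tp (herm G))]; simp
  have hi : Integrable (fun G => tp (herm G)) (matrixGaussian (m + 1)) := by simpa using integrable_tp_pow (n := m) 1
  rw [e]
  refine integral_mono h ((hi.comp_snd _).const_mul b) fun p => ?_
  simp only [Complex.ofReal_zero, zero_smul]
  exact MM_zero_le hb (herm_isHermitian _)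

/-- Chain of recursions. -/
lemma mu_chain (c : ℕ → ℝ) (k m : ℕ) :
    2 * ∑ i ∈ Finset.range k, c i * c (i + 1) * DV (m + k + 1 - i) ≤ mu (m + k) (c 0) (∑ i ∈ Finset.range k, c (i + 1) ^ 2) := by
  induction k generalizing c with
  | zero => simp [mu_zero]
  | succ k ih =>
    have h1 := ih (fun i => c (i + 1))
    have h2 := mu_rec (m + k) (b := ∑ i ∈ Finset.range k, c (i + 1 + 1) ^ 2) (by positivity) (c 0) (c 1)
    rw [Finset.sum_range_succ', Finset.sum_range_succ' (fun i => c (i + 1) ^ 2), add_comm _ (c (0 + 1) ^ 2)]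
    have e : ∀ i, m + (k + 1) + 1 - (i + 1) = m + k + 1 - i := fun i => by omega
    simp only [e]
    have e2 : m + (k + 1) + 1 - 0 = m + k + 2 := by omega
    rw [e2]
    simp only [zero_add, Nat.add_assoc] at *
    linarith

lemma chain_tp (c : ℕ → ℝ) (hc : c 0 = 0) (k m : ℕ) :
    2 * ∑ i ∈ Finset.range k, c i * c (i + 1) * DV (m + k + 1 - i) ≤
      (∑ i ∈ Finset.range k, c (i + 1) ^ 2) * ∫ G, tp (herm G) ∂(matrixGaussian (m + k + 1)) := by
  have h := mu_chain c k m
  rw [hc] at h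
  exact h.trans (mu_top _ (by positivity))

end GUEx

namespace GUEx
open MeasureTheory ProbabilityTheory Matrix
open scoped ComplexOrder Topology ENNReal

/-- squared modulus of one off-diagonal entry -/
noncomputable def ph (p : ℂ × ℂ) : ℝ := ‖(1 / 2 : ℂ) * (p.2 + star p.1)‖ ^ 2

/-- the underlying product law -/
noncomputable def cg2 : Measure (ℂ × ℂ) := complexGaussian.prod complexGaussian

instance instProbcg2 : IsProbabilityMeasure cg2 := by unfold cg2; infer_instance

lemma continuous_ph : Continuous ph := by unfold ph; fun_prop

lemma memLp_sq_cg : MemLp (fun z : ℂ => ‖z‖ ^ 2) 2 complexGaussian := by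
  have h := memLp_norm_complexGaussian 4
  have h1 : Integrable (fun z : ℂ => ‖z‖ ^ 4) complexGaussian := by
    simpa using h.integrable_norm_pow (by norm_num)
  rw [memLp_two_iff_integrable_sq (by fun_prop)]
  refine h1.congr (ae_of_all _ fun z => ?_)
  simp only; ring

lemma ph_le (p : ℂ × ℂ) : ph p ≤ ‖p.1‖ ^ 2 + ‖p.2‖ ^ 2 := by
  unfold ph
  rw [norm_mul]
  have := norm_add_le p.2 (star p.1)
  rw [norm_star] at this
  have h2 : ‖(1 / 2 : ℂ)‖ = 1 / 2 := by simp
  rw [h2]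
  nlinarith [norm_nonneg p.1, norm_nonneg p.2, norm_nonneg (p.2 + star p.1), sq_nonneg (‖p.1‖ - ‖p.2‖)]

lemma memLp_ph : MemLp ph 2 cg2 := by
  have h := (memLp_sq_cg.comp_fst complexGaussian).add (memLp_sq_cg.comp_snd complexGaussian)
  refine h.mono continuous_ph.measurable.aestronglyMeasurable (ae_of_all _ fun p => ?_)
  rw [Real.norm_of_nonneg (by unfold ph; positivity)]
  simp only [Pi.add_apply]
  rw [Real.norm_of_nonneg (by positivity)]
  exact ph_le p

lemma mean_sq_gr : ∫ x : ℝ, x ^ 2 ∂(gaussianReal 0 1) = 1 := by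
  have h := variance_eq_integral (μ := gaussianReal 0 1) (X := fun x : ℝ => x) (by fun_prop)
  rw [variance_fun_id_gaussianReal, integral_id_gaussianReal] at h
  simpa using h.symm

lemma mean_sq_cg : ∫ z : ℂ, ‖z‖ ^ 2 ∂complexGaussian = 2 := by
  have hm : Measurable (fun p : ℝ × ℝ => Complex.mk p.1 p.2) := Complex.measurableEquivRealProd.symm.measurable
  unfold complexGaussian
  rw [integral_map hm.aemeasurable (by fun_prop)]
  have hi : Integrable (fun x : ℝ => x ^ 2) (gaussianReal 0 1) := by
    have := (memLp_id_gaussianReal (μ := 0) (v := 1) 2).integrable_sq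
    simpa using this
  have : ∀ p : ℝ × ℝ, ‖Complex.mk p.1 p.2‖ ^ 2 = p.1 ^ 2 + p.2 ^ 2 := by
    intro p; rw [Complex.sq_norm, Complex.normSq_mk]; ring
  simp only [this]
  rw [integral_add (hi.comp_fst _) (hi.comp_snd _), integral_fun_fst (fun x : ℝ => x ^ 2), integral_fun_snd (fun x : ℝ => x ^ 2), mean_sq_gr]
  norm_num

lemma mean_ph : ∫ p, ph p ∂cg2 = 1 := by
  have hmp : MeasurePreserving (Prod.map (fun z : ℂ => -z) id) cg2 cg2 := neg_cg.prod (MeasurePreserving.id complexGaussian)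
  have hi : Integrable ph cg2 := memLp_ph.integrable (by norm_num)
  have hi2 : Integrable (fun p => ph (Prod.map (fun z : ℂ => -z) id p)) cg2 :=
    (hmp.integrable_comp continuous_ph.measurable.aestronglyMeasurable).2 hi
  have e1 : ∫ p, ph p ∂cg2 = ∫ p, ph (Prod.map (fun z : ℂ => -z) id p) ∂cg2 := by
    conv_lhs => rw [← hmp.map_eq]
    rw [integral_map hmp.measurable.aemeasurable continuous_ph.measurable.aestronglyMeasurable]
  have hz : Integrable (fun z : ℂ => ‖z‖ ^ 2) complexGaussian := memLp_sq_cg.integrable (by norm_num)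
  have e2 : ∫ p, (ph p + ph (Prod.map (fun z : ℂ => -z) id p)) ∂cg2 = ∫ p : ℂ × ℂ, (1 / 2) * (‖p.1‖ ^ 2 + ‖p.2‖ ^ 2) ∂cg2 := by
    refine integral_congr_ae (ae_of_all _ fun p => ?_)
    simp only [ph, Prod.map, Complex.sq_norm, Complex.normSq_apply, id]
    simp
    ring
  rw [integral_add hi hi2, ← e1, integral_const_mul] at e2
  unfold cg2 at e2
  rw [integral_add (hz.comp_fst _) (hz.comp_snd _), integral_fun_fst (fun x : ℂ => ‖x‖ ^ 2), integral_fun_snd (fun x : ℂ => ‖x‖ ^ 2), mean_sq_cg] at e2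
  simp at e2
  unfold cg2
  linarith

/-- variance constant -/
noncomputable def KV : ℝ := Var[ph; cg2]

lemma KV_nonneg : 0 ≤ KV := variance_nonneg _ _

lemma mp_pair (m : ℕ) : MeasurePreserving (fun p : Fin m → ℂ × ℂ => (fun i => (1 / 2 : ℂ) * ((p i).2 + star (p i).1) : VV m))
    (Measure.pi fun _ : Fin m => cg2) (gl m) := by
  have h := measurePreserving_arrowProdEquivProdArrow ℂ ℂ (Fin m) (fun _ => complexGaussian) (fun _ => complexGaussian)
  exact (mp_gv m).comp h

lemma sqrt_ineq {t : ℝ} (ht : 0 ≤ t) : 1 + (t - 1) / 2 - (t - 1) ^ 2 / 2 ≤ √t := by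
  obtain ⟨u, hu, rfl⟩ : ∃ u, 0 ≤ u ∧ t = u ^ 2 := ⟨√t, Real.sqrt_nonneg t, (Real.sq_sqrt ht).symm⟩
  rw [Real.sqrt_sq hu]
  have : 0 ≤ (u - 1) ^ 2 * ((u + 1) ^ 2 - 1) := mul_nonneg (sq_nonneg _) (by nlinarith)
  nlinarith

lemma DV_ge {m : ℕ} (hm : 1 ≤ m) : √m - KV / (2 * √m) ≤ DV m := by
  have hmp := mp_pair m
  have hm0 : (0 : ℝ) < m := by exact_mod_cast hm
  set T : (Fin m → ℂ × ℂ) → ℝ := ∑ i, fun p => ph (p i) with hT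
  have hTe : ∀ p, T p = ∑ i, ph (p i) := fun p => by simp [hT]
  have hT2 : MemLp T 2 (Measure.pi fun _ : Fin m => cg2) := by
    have : T = fun p => ∑ i, ph (p i) := funext hTe
    rw [this]
    exact memLp_finsetSum _ fun i _ => memLp_ph.comp_measurePreserving (measurePreserving_eval (fun _ : Fin m => cg2) i)
  have hTi : Integrable T (Measure.pi fun _ : Fin m => cg2) := hT2.integrable (by norm_num)
  have hmean : ∫ p, T p ∂(Measure.pi fun _ : Fin m => cg2) = m := by
    simp only [hTe]
    have hpi : ∀ i : Fin m, Integrable (fun p : Fin m → ℂ × ℂ => ph (p i)) (Measure.pi fun _ : Fin m => cg2) := fun i =>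
      (memLp_ph.comp_measurePreserving (measurePreserving_eval (fun _ : Fin m => cg2) i)).integrable (by norm_num)
    rw [integral_finsetSum _ fun i _ => hpi i]
    have : ∀ i : Fin m, ∫ p : Fin m → ℂ × ℂ, ph (p i) ∂(Measure.pi fun _ : Fin m => cg2) = 1 := by
      intro i
      rw [← mean_ph]
      have h := measurePreserving_eval (fun _ : Fin m => cg2) i
      conv_rhs => rw [← h.map_eq]
      rw [integral_map h.measurable.aemeasurable continuous_ph.measurable.aestronglyMeasurable]
    simp [this]
  have hvar : ∫ p, (T p - m) ^ 2 ∂(Measure.pi fun _ : Fin m => cg2) = m * KV := by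
    have h := variance_sum_pi (μ := fun _ : Fin m => cg2) (X := fun _ => ph) (fun _ => memLp_ph)
    rw [variance_eq_integral hT2.aemeasurable, hmean] at h
    rw [h]; simp [KV]
  have hvi : Integrable (fun p => (T p - m) ^ 2) (Measure.pi fun _ : Fin m => cg2) := (hT2.sub (memLp_const _)).integrable_sq
  have hc : Continuous (fun g : VV m => √(nsq g)) := continuous_nsq.sqrt
  have hsi : Integrable (fun p => √(T p)) (Measure.pi fun _ : Fin m => cg2) := by
    have := (hmp.integrable_comp hc.measurable.aestronglyMeasurable).2 (integrable_sqrt_nsq m)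
    refine this.congr (ae_of_all _ fun p => ?_)
    simp only [Function.comp, hTe]; rfl
  have hDV : DV m = ∫ p, √(T p) ∂(Measure.pi fun _ : Fin m => cg2) := by
    unfold DV
    rw [← hmp.map_eq, integral_map hmp.measurable.aemeasurable hc.measurable.aestronglyMeasurable]
    refine integral_congr_ae (ae_of_all _ fun p => ?_)
    simp only [hTe]; rfl
  rw [hDV]
  have hs : 0 < √(m : ℝ) := Real.sqrt_pos.2 hm0
  have hss : √(m : ℝ) * √(m : ℝ) = m := Real.mul_self_sqrt hm0.le
  have i1 : Integrable (fun p => √(m : ℝ) / 2 + (√m / (2 * m)) * T p) (Measure.pi fun _ : Fin m => cg2) :=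
    (integrable_const _).add (hTi.const_mul _)
  have i2 := hvi.const_mul (√m / (2 * m ^ 2))
  have hle : ∫ p, ((√(m : ℝ) / 2 + (√m / (2 * m)) * T p) - (√m / (2 * m ^ 2)) * (T p - m) ^ 2) ∂(Measure.pi fun _ : Fin m => cg2)
      ≤ ∫ p, √(T p) ∂(Measure.pi fun _ : Fin m => cg2) := by
    refine integral_mono (i1.sub i2) hsi fun p => ?_
    have hT0 : 0 ≤ T p := by rw [hTe]; exact Finset.sum_nonneg fun i _ => by unfold ph; positivity
    have h := mul_le_mul_of_nonneg_left (sqrt_ineq (t := T p / m) (by positivity)) hs.le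
    rw [Real.sqrt_div hT0, mul_div_cancel₀ _ hs.ne'] at h
    refine le_of_eq_of_le ?_ h
    simp only
    field_simp
    ring
  rw [integral_sub i1 i2, integral_add (integrable_const _) (hTi.const_mul _), integral_const_mul, integral_const_mul, hmean, hvar] at hle
  refine le_of_eq_of_le ?_ hle
  simp only [integral_const, probReal_univ, one_smul]
  have : KV / (2 * √(m : ℝ)) = √m / (2 * m ^ 2) * (m * KV) := by
    rw [div_eq_iff (by positivity)]
    field_simp
    rw [Real.sq_sqrt hm0.le]
  rw [this]
  field_simp
  ring

end GUEx

namespace GUEx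
open MeasureTheory ProbabilityTheory Matrix
open scoped ComplexOrder Topology ENNReal

/-- tent function -/
noncomputable def tent (p j : ℕ) : ℝ := (p : ℝ) - |(j : ℝ) - p|

lemma tent_of_le {p j : ℕ} (h : j ≤ p) : tent p j = j := by
  unfold tent
  have : (j : ℝ) ≤ p := by exact_mod_cast h
  rw [abs_of_nonpos (by linarith)]; ring

lemma tent_of_ge {p j : ℕ} (h : p ≤ j) : tent p j = 2 * p - j := by
  unfold tent
  have : (p : ℝ) ≤ j := by exact_mod_cast h
  rw [abs_of_nonneg (by linarith)]; ring

lemma tent_diff (p j : ℕ) : (tent p (j + 1) - tent p j) ^ 2 = 1 := by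
  rcases Nat.lt_or_ge j p with h | h
  · rw [tent_of_le h.le, tent_of_le h]; push_cast; ring
  · rw [tent_of_ge h, tent_of_ge (by omega)]; push_cast; ring

lemma tent_nonneg {p j : ℕ} (h : j ≤ 2 * p) : 0 ≤ tent p j := by
  have : (j : ℝ) ≤ 2 * p := by exact_mod_cast h
  rcases Nat.le_total j p with h | h
  · rw [tent_of_le h]; positivity
  · rw [tent_of_ge h]; linarith

lemma tent_sum (p : ℕ) : ∑ i ∈ Finset.range (2 * p), tent p i * tent p (i + 1) =
    ∑ i ∈ Finset.range (2 * p), tent p (i + 1) ^ 2 - p := by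
  have h1 : ∑ i ∈ Finset.range (2 * p), tent p (i + 1) ^ 2 = ∑ i ∈ Finset.range (2 * p), tent p i ^ 2 := by
    have a := Finset.sum_range_succ (fun i => tent p i ^ 2) (2 * p)
    have b := Finset.sum_range_succ' (fun i => tent p i ^ 2) (2 * p)
    have e1 : tent p (2 * p) = 0 := by rw [tent_of_ge (by omega)]; push_cast; ring
    have e2 : tent p 0 = 0 := by rw [tent_of_le (by omega)]; simp
    rw [e1] at a
    rw [e2] at b
    linarith
  have h2 : ∑ i ∈ Finset.range (2 * p), (tent p (i + 1) - tent p i) ^ 2 = 2 * p := by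
    simp [tent_diff]
  have h3 : ∑ i ∈ Finset.range (2 * p), (tent p (i + 1) - tent p i) ^ 2 =
      ∑ i ∈ Finset.range (2 * p), tent p (i + 1) ^ 2 + ∑ i ∈ Finset.range (2 * p), tent p i ^ 2
        - 2 * ∑ i ∈ Finset.range (2 * p), tent p i * tent p (i + 1) := by
    rw [Finset.mul_sum, ← Finset.sum_add_distrib, ← Finset.sum_sub_distrib]
    exact Finset.sum_congr rfl fun i _ => by ring
  linarith

lemma sum_sq_ge (p : ℕ) : (p : ℝ) ^ 3 / 3 ≤ ∑ i ∈ Finset.range p, ((i : ℝ) + 1) ^ 2 := by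
  induction p with
  | zero => simp
  | succ p ih =>
    rw [Finset.sum_range_succ]
    push_cast
    have : (0 : ℝ) ≤ p := by positivity
    nlinarith

lemma tent_Q (p : ℕ) : (p : ℝ) ^ 3 / 3 ≤ ∑ i ∈ Finset.range (2 * p), tent p (i + 1) ^ 2 := by
  refine (sum_sq_ge p).trans ?_
  calc ∑ i ∈ Finset.range p, ((i : ℝ) + 1) ^ 2 = ∑ i ∈ Finset.range p, tent p (i + 1) ^ 2 := by
        refine Finset.sum_congr rfl fun i hi => ?_
        rw [tent_of_le (Finset.mem_range.1 hi)]; push_cast; rfl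
    _ ≤ _ := Finset.sum_le_sum_of_subset_of_nonneg (Finset.range_mono (by omega)) fun _ _ _ => sq_nonneg _

lemma DV_low {N i p : ℕ} (hp : 1 ≤ p) (hN : 4 * p ≤ N) (hi : i < 2 * p) :
    √N - (2 * p + KV) / √N ≤ DV (N - i) := by
  refine le_trans ?_ (DV_ge (m := N - i) (by omega))
  have hc : ((N - i : ℕ) : ℝ) = N - i := by rw [Nat.cast_sub (by omega)]
  have hN' : (4 : ℝ) * p ≤ N := by exact_mod_cast hN
  have hi' : (i : ℝ) ≤ 2 * p := by exact_mod_cast hi.le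
  have hp' : (1 : ℝ) ≤ p := by exact_mod_cast hp
  have hi0 : (0 : ℝ) ≤ i := by positivity
  have hK := KV_nonneg
  rw [hc]
  have hN0 : (0 : ℝ) < N := by linarith
  have hs : 0 < √(N : ℝ) := Real.sqrt_pos.2 hN0
  have hss : √(N : ℝ) * √(N : ℝ) = N := Real.mul_self_sqrt hN0.le
  have h1 : √(N : ℝ) - i / √N ≤ √((N : ℝ) - i) := by
    apply Real.le_sqrt_of_sq_le
    have : (√(N : ℝ) - i / √N) ^ 2 = N - 2 * i + i * (i / N) := by
      field_simp
      rw [Real.sq_sqrt hN0.le]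
      ring
    rw [this]
    have : (i : ℝ) / N ≤ 1 := by rw [div_le_one hN0]; linarith
    nlinarith
  have h2 : √(N : ℝ) / 2 ≤ √((N : ℝ) - i) := by
    apply Real.le_sqrt_of_sq_le
    rw [div_pow, Real.sq_sqrt hN0.le]; linarith
  have h3 : KV / (2 * √((N : ℝ) - i)) ≤ KV / √N := by
    apply div_le_div_of_nonneg_left hK hs; linarith
  have h4 : (i : ℝ) / √N ≤ 2 * p / √N := by gcongr
  rw [add_div]
  linarith

/-- Lower bound for the mean of the top eigenvalue, in variance-like form. -/
lemma gap_bound {N p : ℕ} (hp : 1 ≤ p) (hN : 4 * p ≤ N) :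
    4 * (N : ℝ) - E2 N ≤ 8 * (2 * p + KV) + 24 * N / p ^ 2 := by
  obtain ⟨m, rfl⟩ : ∃ m, N = m + 2 * p + 1 := ⟨N - (2 * p + 1), by omega⟩
  set N := m + 2 * p + 1 with hNdef
  have hch := chain_tp (tent p) (by rw [tent_of_le (by omega)]; simp) (2 * p) m
  rw [← hNdef] at hch
  set Q := ∑ i ∈ Finset.range (2 * p), tent p (i + 1) ^ 2 with hQ
  set A := ∫ G, tp (herm G) ∂(matrixGaussian N) with hA
  have hN' : (4 : ℝ) * p ≤ N := by exact_mod_cast hN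
  have hp' : (1 : ℝ) ≤ p := by exact_mod_cast hp
  have hN0 : (0 : ℝ) < N := by linarith
  have hK := KV_nonneg
  have hs : 0 < √(N : ℝ) := Real.sqrt_pos.2 hN0
  have hss : √(N : ℝ) * √(N : ℝ) = N := Real.mul_self_sqrt hN0.le
  set d := √(N : ℝ) - (2 * p + KV) / √N with hd
  have hS := tent_sum p
  rw [← hQ] at hS
  have hQ3 := tent_Q p
  rw [← hQ] at hQ3
  have hQ0 : 0 < Q := lt_of_lt_of_le (by positivity) hQ3
  have h1 : d * (Q - p) ≤ ∑ i ∈ Finset.range (2 * p), tent p i * tent p (i + 1) * DV (N - i) := by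
    rw [← hS, Finset.mul_sum]
    refine Finset.sum_le_sum fun i hi => ?_
    have hi := Finset.mem_range.1 hi
    rw [mul_comm d]
    exact mul_le_mul_of_nonneg_left (DV_low hp hN hi) (mul_nonneg (tent_nonneg (by omega)) (tent_nonneg (by omega)))
  have hAsq : A ^ 2 ≤ E2 N := by
    have hi : Integrable (fun G => tp (herm G)) (matrixGaussian N) := by
      simpa using integrable_tp_pow (n := m + 2 * p) 1
    have h2 : MemLp (fun G => tp (herm G)) 2 (matrixGaussian N) := by
      rw [memLp_two_iff_integrable_sq hi.aestronglyMeasurable]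
      exact integrable_tp_pow (n := m + 2 * p) 2
    have h := variance_nonneg (fun G => tp (herm G)) (matrixGaussian N)
    rw [variance_eq_sub h2] at h
    have e : (matrixGaussian N)[(fun G => tp (herm G)) ^ 2] = E2 N := by
      unfold E2; rfl
    rw [e] at h
    linarith
  set l := 2 * (2 * p + KV) / √(N : ℝ) + 6 * √N / p ^ 2 with hl
  have hl0 : 0 ≤ l := by positivity
  have hlN : 4 * √(N : ℝ) * l = 8 * (2 * p + KV) + 24 * N / p ^ 2 := by
    rw [hl]
    field_simp
    rw [Real.sq_sqrt hN0.le]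
    ring
  rw [← hlN]
  rcases le_or_gt (2 * √(N : ℝ)) l with hcase | hcase
  · nlinarith [sq_nonneg A]
  have hd0 : 0 < d := by
    have : 0 ≤ 6 * √(N : ℝ) / p ^ 2 := by positivity
    have e : 2 * (2 * p + KV) / √(N : ℝ) = 2 * ((2 * p + KV) / √(N : ℝ)) := by ring
    rw [hl, e] at hcase
    rw [hd]; linarith
  have hdN : d ≤ √N := by
    have : 0 ≤ (2 * p + KV) / √(N : ℝ) := by positivity
    rw [hd]; linarith
  have h2 : 2 * (d * (Q - p)) ≤ Q * A := by linarith
  have h3 : (p : ℝ) ≤ Q * (3 / p ^ 2) := by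
    calc (p : ℝ) = (p : ℝ) ^ 3 / 3 * (3 / p ^ 2) := by field_simp
      _ ≤ _ := by gcongr
  have hA2 : 2 * √N - l ≤ A := by
    have h4 : Q * (2 * d - 2 * d * (3 / p ^ 2)) ≤ Q * A := by nlinarith
    have h5 := le_of_mul_le_mul_left h4 hQ0
    have h6 : 2 * d * (3 / (p : ℝ) ^ 2) ≤ 6 * √N / p ^ 2 := by
      calc 2 * d * (3 / (p : ℝ) ^ 2) ≤ 2 * √N * (3 / (p : ℝ) ^ 2) := by gcongr
        _ = _ := by ring
    have e : 2 * (2 * p + KV) / √(N : ℝ) = 2 * ((2 * p + KV) / √(N : ℝ)) := by ring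
    rw [hl, e]
    have h7 : 2 * d = 2 * √(N : ℝ) - 2 * ((2 * p + KV) / √(N : ℝ)) := by rw [hd]; ring
    linarith
  nlinarith [sq_nonneg l]

/-- The edge estimate. -/
lemma edge_bound {N : ℕ} (hN : 1 ≤ N) : 4 * (N : ℝ) - E2 N ≤ (112 + 8 * KV) * (N : ℝ) ^ ((1 : ℝ) / 3) := by
  have hN1 : (1 : ℝ) ≤ N := by exact_mod_cast hN
  set q := (N : ℝ) ^ ((1 : ℝ) / 3) with hq
  have hq1 : 1 ≤ q := Real.one_le_rpow hN1 (by norm_num)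
  have hq3 : q ^ 3 = N := by
    rw [hq, ← Real.rpow_natCast, ← Real.rpow_mul (by linarith)]; norm_num
  have hK := KV_nonneg
  rcases Nat.lt_or_ge N 8 with h8 | h8
  · have hE : 0 ≤ E2 N := integral_nonneg fun G => sq_nonneg _
    have hN8 : (N : ℝ) < 8 := by exact_mod_cast h8
    have hq2 : q < 2 := by
      by_contra h
      push Not at h
      nlinarith [mul_self_nonneg (q - 2), mul_nonneg (by linarith : (0:ℝ) ≤ q - 2) (sq_nonneg q)]
    have : (N : ℝ) ≤ 4 * q := by
      have h2 : q ^ 2 ≤ 4 := by nlinarith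
      calc (N : ℝ) = q * q ^ 2 := by rw [← hq3]; ring
        _ ≤ q * 4 := by gcongr
        _ = _ := by ring
    nlinarith
  · have hN8 : (8 : ℝ) ≤ N := by exact_mod_cast h8
    have hq2 : 2 ≤ q := by
      by_contra h
      push Not at h
      have : q ^ 3 < 2 ^ 3 := pow_lt_pow_left₀ h (by linarith) (by norm_num)
      linarith
    set p := ⌊q⌋₊ with hp
    have hpq : (p : ℝ) ≤ q := Nat.floor_le (by linarith)
    have hqp : q < p + 1 := Nat.lt_floor_add_one q
    have hp1 : 1 ≤ p := Nat.le_floor (by simpa using hq1)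
    have h4 : 4 * p ≤ N := by
      have : (4 : ℝ) * p ≤ N := by
        have h2 : 4 ≤ q ^ 2 := by nlinarith
        calc (4 : ℝ) * p ≤ q ^ 2 * q := by gcongr
          _ = N := by rw [← hq3]; ring
      exact_mod_cast this
    refine (gap_bound hp1 h4).trans ?_
    have hp1' : (1 : ℝ) ≤ p := by exact_mod_cast hp1
    have h5 : 24 * (N : ℝ) / p ^ 2 ≤ 96 * q := by
      rw [div_le_iff₀ (by positivity), ← hq3]
      have : q ≤ 2 * p := by linarith
      have h6 : q ^ 2 ≤ (2 * p) ^ 2 := pow_le_pow_left₀ (by linarith) this 2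
      nlinarith
    nlinarith

end GUEx

namespace GUEx
open MeasureTheory ProbabilityTheory Matrix
open scoped ComplexOrder Topology ENNReal

/-- the bad set of pairs -/
def SS (x : ℝ) : Set (ℝ × ℝ) := {p | Real.exp (-(1 / x)) < |p.1| / |p.2| ∧ |p.1| / |p.2| < Real.exp (1 / x)}

lemma measurableSet_SS (x : ℝ) : MeasurableSet (SS x) := by
  have h : Measurable (fun p : ℝ × ℝ => |p.1| / |p.2|) := by fun_prop
  exact (measurableSet_lt measurable_const h).inter (measurableSet_lt h measurable_const)

lemma exp_gap {y : ℝ} (h0 : 0 ≤ y) (h1 : y ≤ 1) : Real.exp y - Real.exp (-y) ≤ 3 * y := by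
  have a := Real.abs_exp_sub_one_sub_id_le (x := y) (by rw [abs_of_nonneg h0]; exact h1)
  have b := Real.add_one_le_exp (-y)
  have c := (abs_le.1 a).2
  nlinarith

lemma SS_slice {x : ℝ} (hx : 1 ≤ x) (m : ℝ) : volume {l : ℝ | (l, m) ∈ SS x} ≤ ENNReal.ofReal (6 / x * |m|) := by
  set a := |m| * Real.exp (-(1 / x)) with ha
  set b := |m| * Real.exp (1 / x) with hb
  have hx0 : 0 < x := by linarith
  have hsub : {l : ℝ | (l, m) ∈ SS x} ⊆ Set.Ioo a b ∪ Set.Ioo (-b) (-a) := by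
    rintro l ⟨h1, h2⟩
    simp only at h1 h2
    have hm : 0 < |m| := by
      rcases (abs_nonneg m).eq_or_lt with h | h
      · rw [← h, div_zero] at h1
        exact absurd h1 (not_lt.2 (Real.exp_pos _).le)
      · exact h
    rw [lt_div_iff₀ hm] at h1
    rw [div_lt_iff₀ hm] at h2
    rcases le_total 0 l with h | h
    · rw [abs_of_nonneg h] at h1 h2
      left; constructor <;> linarith
    · rw [abs_of_nonpos h] at h1 h2
      right; constructor <;> linarith
  have hab : b - a ≤ 3 / x * |m| := by
    have := exp_gap (y := 1 / x) (by positivity) (by rw [div_le_one hx0]; exact hx)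
    have h2 := mul_le_mul_of_nonneg_left this (abs_nonneg m)
    rw [ha, hb]
    calc _ = |m| * (Real.exp (1 / x) - Real.exp (-(1 / x))) := by ring
      _ ≤ _ := h2
      _ = _ := by ring
  calc volume {l : ℝ | (l, m) ∈ SS x} ≤ volume (Set.Ioo a b ∪ Set.Ioo (-b) (-a)) := measure_mono hsub
    _ ≤ volume (Set.Ioo a b) + volume (Set.Ioo (-b) (-a)) := measure_union_le _ _
    _ = ENNReal.ofReal (b - a) + ENNReal.ofReal (b - a) := by
        rw [Real.volume_Ioo, Real.volume_Ioo]; congr 2; ring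
    _ ≤ ENNReal.ofReal (3 / x * |m|) + ENNReal.ofReal (3 / x * |m|) := by gcongr
    _ = ENNReal.ofReal (6 / x * |m|) := by
        rw [← ENNReal.ofReal_add (by positivity) (by positivity)]; congr 1; ring

lemma mg_final (n : ℕ) {x : ℝ} (hx : 1 ≤ x) :
    matrixGaussian (n + 2) {G | (tp (herm G), bt (herm G)) ∈ SS x} ≤
      ENNReal.ofReal ((124 + 8 * KV) * ((n + 2 : ℕ) : ℝ) ^ ((2 : ℝ) / 3) / x) := by
  obtain ⟨hE, hP⟩ := prob_bound n
  have hN : (1 : ℝ) ≤ ((n + 2 : ℕ) : ℝ) := by exact_mod_cast (by omega : 1 ≤ n + 2)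
  have hx0 : 0 < x := by linarith
  set q := ((n + 2 : ℕ) : ℝ) ^ ((1 : ℝ) / 3) with hq
  have hq1 : 1 ≤ q := Real.one_le_rpow hN (by norm_num)
  have hq0 : 0 < q := by linarith
  have hq3 : q ^ 3 = ((n + 2 : ℕ) : ℝ) := by
    rw [hq, ← Real.rpow_natCast, ← Real.rpow_mul (by linarith)]; norm_num
  have hq2 : ((n + 2 : ℕ) : ℝ) ^ ((2 : ℝ) / 3) = q ^ 2 := by
    rw [hq, ← Real.rpow_natCast, ← Real.rpow_mul (by linarith)]; norm_num
  have hg := edge_bound (N := n + 2) (by omega)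
  rw [← hq] at hg
  refine (hP (measurableSet_SS x) (κ := 6 / x) (by positivity) (SS_slice hx) (s := 1 / q) (by positivity)).trans ?_
  apply ENNReal.ofReal_le_ofReal
  rw [hq2]
  have hcast : (4 : ℝ) * (n + 2) = 4 * q ^ 3 := by rw [hq3]; push_cast; ring
  rw [hcast] at hE ⊢
  rw [← hq3] at hg
  have h1 : 1 / q * E2 (n + 2) ≤ 4 * q ^ 2 := by
    rw [one_div_mul_eq_div, div_le_iff₀ hq0]; linarith
  have h2 : (4 * q ^ 3 - E2 (n + 2)) / (3 * (1 / q)) ≤ (112 + 8 * KV) / 3 * q ^ 2 := by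
    rw [div_le_iff₀ (by positivity)]
    calc _ ≤ _ := hg
      _ = _ := by field_simp
  calc 6 / x / 2 * (1 / q * E2 (n + 2) + (4 * q ^ 3 - E2 (n + 2)) / (3 * (1 / q)))
      ≤ 6 / x / 2 * (4 * q ^ 2 + (112 + 8 * KV) / 3 * q ^ 2) := by gcongr
    _ = _ := by field_simp; ring

lemma gue_event (n : ℕ) {x : ℝ} (A : Set (Mat (n + 1)))
    (hA : A ⊆ {H | (sortedEigs H ⟨n, by omega⟩, sortedEigs H ⟨0, by omega⟩) ∈ SS x}) :
    GUE (n + 1) A ≤ matrixGaussian (n + 1) {G | (tp (herm G), bt (herm G)) ∈ SS x} := by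
  set B : Set (Mat (n + 1)) := {H | (tp (herm H), bt (herm H)) ∈ SS x} with hB
  have hBm : MeasurableSet B := (measurable_tp_herm.prodMk measurable_bt_herm) (measurableSet_SS x)
  have hAB : A ⊆ B := by
    intro H hH
    have h := hA hH
    by_cases hh : H.IsHermitian
    · rw [Set.mem_ofPred_eq, sortedEigs_last hh, sortedEigs_zero hh] at h
      rw [hB, Set.mem_ofPred_eq, herm_of_isHermitian hh]
      exact h
    · exfalso
      have h1 := h.1
      simp only [sortedEigs, dif_neg hh, Pi.zero_apply, abs_zero, div_zero] at h1
      exact absurd h1 (not_lt.2 (Real.exp_pos _).le)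
  refine (measure_mono hAB).trans ?_
  have e : GUE (n + 1) = (matrixGaussian (n + 1)).map herm := rfl
  rw [e, Measure.map_apply continuous_herm.measurable hBm]
  apply le_of_eq
  congr 1
  ext G
  simp only [hB, Set.mem_preimage, Set.mem_ofPred_eq, herm_of_isHermitian (herm_isHermitian G)]

instance instProbGUE {n : ℕ} : IsProbabilityMeasure (GUE n) := by
  have e : GUE n = (matrixGaussian n).map herm := rfl
  rw [e]; exact Measure.isProbabilityMeasure_map continuous_herm.measurable.aemeasurable

end GUEx

/-- extreme eigenvalues of GUE.  There are absolute constants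
`C, c > 0` so that for all `n ≥ 1`, `x ≥ 1` and an `n × n` GUE matrix `H` with largest
and smallest eigenvalues `λ_max`, `λ_min`:
`Prob{e^{−1/x} < |λ_max|/|λ_min| < e^{1/x}} ≤ C·n^{2/3}/x + C·e^{−cn}`. -/
theorem gue_extreme_eigenvalue_ratio_bound :
    ∃ C c : ℝ, 0 < C ∧ 0 < c ∧
      ∀ (n : ℕ) (hn : 1 ≤ n) (x : ℝ) (hx : 1 ≤ x),
        GUE n {H | Real.exp (-(1 / x)) <
              |sortedEigs H ⟨n - 1, by omega⟩| / |sortedEigs H ⟨0, by omega⟩| ∧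
            |sortedEigs H ⟨n - 1, by omega⟩| / |sortedEigs H ⟨0, by omega⟩| <
              Real.exp (1 / x)} ≤
          ENNReal.ofReal (C * (n : ℝ) ^ ((2 : ℝ) / 3) / x + C * Real.exp (-(c * n))) := by
  have hK := GUEx.KV_nonneg
  refine ⟨124 + 8 * GUEx.KV, 1, by positivity, one_pos, fun n hn x hx => ?_⟩
  have hx0 : 0 < x := by linarith
  obtain ⟨k, rfl⟩ : ∃ k, n = k + 1 := ⟨n - 1, by omega⟩
  rcases k with _ | k
  · refine MeasureTheory.prob_le_one.trans ?_
    rw [← ENNReal.ofReal_one]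
    apply ENNReal.ofReal_le_ofReal
    have h1 : (1 : ℝ) ≤ 124 * Real.exp (-1) := by
      rw [Real.exp_neg, ← div_eq_mul_inv, le_div_iff₀ (Real.exp_pos 1)]
      linarith [Real.exp_one_lt_d9]
    have h2 : 0 ≤ 8 * GUEx.KV * Real.exp (-1) := by positivity
    have h3 : 0 ≤ (124 + 8 * GUEx.KV) * ((0 + 1 : ℕ) : ℝ) ^ ((2 : ℝ) / 3) / x := by positivity
    have h4 : -((1 : ℝ) * ((0 + 1 : ℕ) : ℝ)) = -1 := by norm_num
    rw [h4]
    linarith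
  · refine (GUEx.gue_event (k + 1) (x := x) _ fun H hH => hH).trans ?_
    refine (GUEx.mg_final k hx).trans ?_
    apply ENNReal.ofReal_le_ofReal
    have : 0 ≤ (124 + 8 * GUEx.KV) * Real.exp (-(1 * ((k + 1 + 1 : ℕ) : ℝ))) := by positivity
    linarith
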